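/- Under assumptions (A1)–(A3), for each pair 0 < A_0 < A_∞ < ∞, P(sup_{s ∈ [0, x m(u)]} X(s) ≤ u) ≤ (P(sup_{s ∈ [0,1]} X(s) ≤ u))^{⌊x m(u)⌋} · (1 + o(1)) as u → ∞, uniformly for x ∈ [A_0, A_∞]. -/

import Mathlib

open MeasureTheory ProbabilityTheory Filter Set Topology

namespace UB

/-- Centered Gaussian measure on `ι → ℝ` with covariance matrix `K`. -/
def CG {ι : Type*} [Fintype ι] (μ : Measure (ι → ℝ)) (K : ι → ι → ℝ) : Prop :=
  (∀ c : ι → ℝ, 0 ≤ ∑ i, ∑ j, c i * c j * K i j) ∧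
  ∀ c : ι → ℝ, μ.map (fun x => ∑ i, c i * x i)
    = gaussianReal 0 (Real.toNNReal (∑ i, ∑ j, c i * c j * K i j))

section CGbasic
variable {ι : Type*} [Fintype ι] {μ ν : Measure (ι → ℝ)} {K K' : ι → ι → ℝ}

lemma dual_eq (L : StrongDual ℝ (ι → ℝ)) [DecidableEq ι] :
    (L : (ι → ℝ) → ℝ) = fun x => ∑ i, L (Pi.single i 1) * x i := by
  funext x
  have : x = ∑ i, x i • (Pi.single i (1:ℝ) : ι → ℝ) := by
    ext j; simp [Finset.sum_apply, Pi.single_apply]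
  conv_lhs => rw [this]
  rw [map_sum]
  refine Finset.sum_congr rfl fun i _ => ?_
  rw [map_smul, smul_eq_mul, mul_comm]

lemma CG.isGaussian (h : CG μ K) : IsGaussian μ := by
  classical
  refine isGaussian_of_map_eq_gaussianReal fun L => ⟨0, _, by rw [dual_eq L]; exact h.2 _⟩

lemma CG.ext (h : CG μ K) (h' : CG ν K) : μ = ν := by
  classical
  have := h.isGaussian
  have := h'.isGaussian
  refine Measure.ext_of_charFunDual ?_
  funext L
  rw [charFunDual_eq_charFun_map_one, charFunDual_eq_charFun_map_one, dual_eq L, h.2, h'.2]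

lemma CG.comb (h : CG μ K) (h' : CG ν K') {p q : ℝ} (hp : 0 ≤ p) (hq : 0 ≤ q) :
    CG ((μ.prod ν).map (fun z => Real.sqrt p • z.1 + Real.sqrt q • z.2))
      (fun i j => p * K i j + q * K' i j) := by
  have := h.isGaussian
  have := h'.isGaussian
  have key : ∀ c : ι → ℝ, ∑ i, ∑ j, c i * c j * (p * K i j + q * K' i j)
      = p * (∑ i, ∑ j, c i * c j * K i j) + q * (∑ i, ∑ j, c i * c j * K' i j) := by
    intro c
    simp only [Finset.mul_sum, ← Finset.sum_add_distrib]
    refine Finset.sum_congr rfl fun i _ => Finset.sum_congr rfl fun j _ => by ring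
  constructor
  · intro c
    rw [key]
    exact add_nonneg (mul_nonneg hp (h.1 c)) (mul_nonneg hq (h'.1 c))
  · intro c
    rw [Measure.map_map (by fun_prop) (by fun_prop), key]
    have e : (fun x : ι → ℝ => ∑ i, c i * x i) ∘ (fun z : (ι → ℝ) × (ι → ℝ) => Real.sqrt p • z.1 + Real.sqrt q • z.2)
      = (fun z => Real.sqrt p * ∑ i, c i * z.1 i) + (fun z => Real.sqrt q * ∑ i, c i * z.2 i) := by
      funext z
      simp only [Function.comp, Pi.add_apply, Pi.smul_apply, smul_eq_mul, Finset.mul_sum,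
        ← Finset.sum_add_distrib]
      refine Finset.sum_congr rfl fun i _ => by ring
    rw [e]
    have ind : IndepFun (fun z : (ι → ℝ) × (ι → ℝ) => Real.sqrt p * ∑ i, c i * z.1 i)
        (fun z => Real.sqrt q * ∑ i, c i * z.2 i) (μ.prod ν) :=
      indepFun_prod (X := fun x : ι → ℝ => Real.sqrt p * ∑ i, c i * x i)
        (Y := fun x : ι → ℝ => Real.sqrt q * ∑ i, c i * x i) (by fun_prop) (by fun_prop)
    have m1 : (μ.prod ν).map (fun z => Real.sqrt p * ∑ i, c i * z.1 i)
        = gaussianReal 0 (Real.toNNReal (p * ∑ i, ∑ j, c i * c j * K i j)) := by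
      have : (fun z : (ι → ℝ) × (ι → ℝ) => Real.sqrt p * ∑ i, c i * z.1 i)
        = (fun y => Real.sqrt p * y) ∘ (fun x : ι → ℝ => ∑ i, c i * x i) ∘ Prod.fst := rfl
      rw [this, ← Measure.map_map (by fun_prop) (by fun_prop),
        ← Measure.map_map (by fun_prop) (by fun_prop)]
      rw [Measure.map_fst_prod]
      simp only [measure_univ, one_smul]
      rw [h.2, gaussianReal_map_const_mul]
      congr 1
      · simp
      · ext
        simp [Real.sq_sqrt hp, Real.toNNReal_mul hp, hp]
    have m2 : (μ.prod ν).map (fun z => Real.sqrt q * ∑ i, c i * z.2 i)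
        = gaussianReal 0 (Real.toNNReal (q * ∑ i, ∑ j, c i * c j * K' i j)) := by
      have : (fun z : (ι → ℝ) × (ι → ℝ) => Real.sqrt q * ∑ i, c i * z.2 i)
        = (fun y => Real.sqrt q * y) ∘ (fun x : ι → ℝ => ∑ i, c i * x i) ∘ Prod.snd := rfl
      rw [this, ← Measure.map_map (by fun_prop) (by fun_prop),
        ← Measure.map_map (by fun_prop) (by fun_prop)]
      rw [Measure.map_snd_prod]
      simp only [measure_univ, one_smul]
      rw [h'.2, gaussianReal_map_const_mul]
      congr 1
      · simp
      · ext
        simp [Real.sq_sqrt hq, Real.toNNReal_mul hq, hq]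
    rw [gaussianReal_add_gaussianReal_of_indepFun ind m1 m2]
    congr 1
    · simp
    · rw [Real.toNNReal_add (mul_nonneg hp (h.1 c)) (mul_nonneg hq (h'.1 c))]

lemma CG.memLp (h : CG μ K) (i : ι) (p : ENNReal) (hp : p ≠ ⊤) : MemLp (fun x : ι → ℝ => x i) p μ := by
  have := h.isGaussian
  exact IsGaussian.memLp_dual μ (ContinuousLinearMap.proj (R := ℝ) (φ := fun _ : ι => ℝ) i) p hp

lemma CG.integrable_eval (h : CG μ K) (i : ι) : Integrable (fun x : ι → ℝ => x i) μ := by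
  have := h.isGaussian
  exact (h.memLp i 1 (by simp)).integrable le_rfl

lemma CG.integrable_mul (h : CG μ K) (i j : ι) : Integrable (fun x : ι → ℝ => x i * x j) μ := by
  have := h.isGaussian
  exact (h.memLp i 2 (by simp)).integrable_mul (h.memLp j 2 (by simp))

lemma CG.integral_sq (h : CG μ K) (c : ι → ℝ) :
    ∫ x, (∑ i, c i * x i) ^ 2 ∂μ = ∑ i, ∑ j, c i * c j * K i j := by
  have : ∫ x, (∑ i, c i * x i) ^ 2 ∂μ = ∫ y, y ^ 2 ∂(μ.map (fun x => ∑ i, c i * x i)) := by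
    rw [integral_map (Measurable.aemeasurable (by fun_prop)) (by fun_prop)]
  rw [this, h.2]
  have hv := variance_fun_id_gaussianReal (μ := 0) (v := Real.toNNReal (∑ i, ∑ j, c i * c j * K i j))
  rw [variance_eq_integral (by fun_prop)] at hv
  simp only [integral_id_gaussianReal, sub_zero] at hv
  rw [hv, Real.coe_toNNReal _ (h.1 c)]

lemma CG.integral_eval (h : CG μ K) (i : ι) : ∫ x, x i ∂μ = 0 := by
  classical
  have := h.2 (Pi.single i 1)
  have e : (fun x : ι → ℝ => ∑ j, (Pi.single i (1:ℝ) : ι → ℝ) j * x j) = fun x => x i := by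
    funext x; simp [Pi.single_apply]
  rw [e] at this
  have h2 : ∫ x, x i ∂μ = ∫ y, y ∂(μ.map (fun x => x i)) := by
    rw [integral_map (Measurable.aemeasurable (by fun_prop)) (by fun_prop)]
  rw [h2, this, integral_id_gaussianReal]

lemma CG.integral_mul (h : CG μ K) (hK : ∀ i j, K i j = K j i) (i j : ι) :
    ∫ x, x i * x j ∂μ = K i j := by
  classical
  have h1 := h.integral_sq (Pi.single i 1 + Pi.single j 1)
  have h2 := h.integral_sq (Pi.single i 1)
  have h3 := h.integral_sq (Pi.single j 1)
  simp only [Pi.add_apply, add_mul, mul_add, Finset.sum_add_distrib, Pi.single_apply, ite_mul,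
    one_mul, zero_mul, mul_ite, mul_one, mul_zero, Finset.sum_ite_eq', Finset.mem_univ, if_true] at h1 h2 h3
  have e : (fun x : ι → ℝ => (x i + x j) ^ 2) = fun x => x i ^ 2 + x j ^ 2 + 2 * (x i * x j) := by
    funext x; ring
  rw [e] at h1
  have i1 : Integrable (fun x : ι → ℝ => x i ^ 2) μ := by
    simpa [sq] using h.integrable_mul i i
  have i2 : Integrable (fun x : ι → ℝ => x j ^ 2) μ := by
    simpa [sq] using h.integrable_mul j j
  have i12 : Integrable (fun x : ι → ℝ => x i ^ 2 + x j ^ 2) μ := i1.add i2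
  rw [integral_add i12 ((h.integrable_mul i j).const_mul 2), integral_add i1 i2,
    integral_const_mul, h2, h3, hK j i] at h1
  linarith
end CGbasic
end UB

open MeasureTheory ProbabilityTheory Filter Set Topology
set_option linter.unusedSectionVars false
set_option linter.deprecated false

namespace UB

section Taylor
variable {ι : Type*} [Fintype ι] [DecidableEq ι] (G : ℕ → ℝ → ℝ)

/-- Mixed derivative of the product function. -/
def DD (e : ι → ℕ) (w : ι → ℝ) : ℝ := ∏ l, G (e l) (w l)

variable {G}

lemma hasDerivAt_DD (hG : ∀ k x, HasDerivAt (G k) (G (k+1) x) x) (e : ι → ℕ) (w h : ι → ℝ) (s : ℝ) :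
    HasDerivAt (fun s : ℝ => DD G e (w + s • h))
      (∑ i, h i * DD G (e + Pi.single i 1) (w + s • h)) s := by
  have h1 : ∀ i ∈ (Finset.univ : Finset ι),
      HasDerivAt (fun s : ℝ => G (e i) (w i + s * h i)) (G (e i + 1) (w i + s * h i) * h i) s := by
    intro i _
    have := (hG (e i) (w i + s * h i))
    have h2 : HasDerivAt (fun s : ℝ => w i + s * h i) (h i) s := by
      simpa using ((hasDerivAt_id s).mul_const (h i)).const_add (w i)
    exact HasDerivAt.comp s this h2
  have h3 := HasDerivAt.fun_finset_prod h1
  simp only [DD, Pi.add_apply, Pi.smul_apply, smul_eq_mul] at h3 ⊢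
  refine h3.congr_deriv ?_
  refine Finset.sum_congr rfl fun i _ => ?_
  rw [← Finset.mul_prod_erase Finset.univ _ (Finset.mem_univ i)]
  have : ∏ x ∈ Finset.univ.erase i, G (e x + (Pi.single i 1 : ι → ℕ) x) (w x + s * h x)
      = ∏ x ∈ Finset.univ.erase i, G (e x) (w x + s * h x) := by
    refine Finset.prod_congr rfl fun x hx => ?_
    rw [Pi.single_eq_of_ne (Finset.ne_of_mem_erase hx), add_zero]
  rw [this, Pi.single_eq_same]
  ring

lemma abs_DD_le {B : ℝ} (hB : ∀ k ≤ 3, ∀ x, |G k x| ≤ B) (e : ι → ℕ) (he : ∀ i, e i ≤ 3)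
    (w : ι → ℝ) : |DD G e w| ≤ B ^ Fintype.card ι := by
  rw [DD, Finset.abs_prod]
  calc _ ≤ ∏ l : ι, B := Finset.prod_le_prod (fun _ _ => abs_nonneg _) (fun i _ => hB _ (he i) _)
    _ = _ := by simp

lemma taylor1 {f f1 f2 f3 : ℝ → ℝ} (h1 : ∀ s, HasDerivAt f (f1 s) s)
    (h2 : ∀ s, HasDerivAt f1 (f2 s) s) (h3 : ∀ s, HasDerivAt f2 (f3 s) s) {M : ℝ}
    (hM : ∀ s, |f3 s| ≤ M) : |f 1 - f 0 - f1 0 - f2 0 / 2| ≤ M := by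
  have a2 : ∀ s ∈ Icc (0:ℝ) 1, |f2 s - f2 0| ≤ M := by
    intro s hs
    have := (convex_Icc (0:ℝ) 1).norm_image_sub_le_of_norm_hasDerivWithin_le
      (f := f2) (f' := f3) (C := M) (fun x _ => (h3 x).hasDerivWithinAt) (fun x _ => hM x)
      (left_mem_Icc.2 zero_le_one) hs
    simp only [Real.norm_eq_abs, sub_zero, abs_of_nonneg hs.1] at this
    have hM0 : 0 ≤ M := (abs_nonneg _).trans (hM 0)
    exact this.trans (mul_le_of_le_one_right hM0 hs.2)
  have hM0 : 0 ≤ M := (abs_nonneg _).trans (hM 0)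
  have a1 : ∀ s ∈ Icc (0:ℝ) 1, |f1 s - f1 0 - s * f2 0| ≤ M := by
    intro s hs
    have := (convex_Icc (0:ℝ) 1).norm_image_sub_le_of_norm_hasDerivWithin_le
      (f := fun s => f1 s - s * f2 0) (f' := fun s => f2 s - f2 0) (C := M)
      (fun x _ => by
        have := (h2 x).sub ((hasDerivAt_id x).mul_const (f2 0))
        simpa using! this.hasDerivWithinAt) (fun x hx => a2 x hx)
      (left_mem_Icc.2 zero_le_one) hs
    simp only [Real.norm_eq_abs, sub_zero, abs_of_nonneg hs.1, zero_mul] at this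
    have h5 : f1 s - f1 0 - s * f2 0 = f1 s - s * f2 0 - f1 0 := by ring
    rw [h5]
    exact this.trans (mul_le_of_le_one_right hM0 hs.2)
  have := (convex_Icc (0:ℝ) 1).norm_image_sub_le_of_norm_hasDerivWithin_le
      (f := fun s => f s - s * f1 0 - s ^ 2 / 2 * f2 0) (f' := fun s => f1 s - f1 0 - s * f2 0) (C := M)
      (fun x _ => by
        have h6 := ((h1 x).sub ((hasDerivAt_id x).mul_const (f1 0))).sub
          ((((hasDerivAt_id x).pow 2).div_const 2).mul_const (f2 0))
        have := h6.hasDerivWithinAt (s := Icc 0 1)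
        simp only [id] at this
        refine HasDerivWithinAt.congr_deriv (f' := _) (by simpa using! this) ?_
        ring) (fun x hx => a1 x hx)
      (left_mem_Icc.2 zero_le_one) (right_mem_Icc.2 zero_le_one)
  simp only [Real.norm_eq_abs] at this
  norm_num at this
  have h5 : f 1 - f 0 - f1 0 - f2 0 / 2 = f 1 - f1 0 - 1 / 2 * f2 0 - f 0 := by ring
  rw [h5]
  exact this

lemma taylorDD (hG : ∀ k x, HasDerivAt (G k) (G (k+1) x) x) {B : ℝ}
    (hB : ∀ k ≤ 3, ∀ x, |G k x| ≤ B) (w h : ι → ℝ) :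
    |DD G 0 (w + h) - DD G 0 w - ∑ i, h i * DD G (Pi.single i 1) w
      - (∑ i, ∑ j, h i * h j * DD G (Pi.single i 1 + Pi.single j 1) w) / 2|
      ≤ B ^ Fintype.card ι * (∑ i, |h i|) ^ 3 := by
  have h1 := fun s => hasDerivAt_DD hG 0 w h s
  have h2 : ∀ s, HasDerivAt (fun s : ℝ => ∑ i, h i * DD G (0 + Pi.single i 1) (w + s • h))
      (∑ i, h i * ∑ j, h j * DD G (0 + Pi.single i 1 + Pi.single j 1) (w + s • h)) s := by
    intro s
    exact HasDerivAt.fun_sum fun i _ => (hasDerivAt_DD hG _ w h s).const_mul (h i)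
  have h3 : ∀ s, HasDerivAt (fun s : ℝ => ∑ i, h i * ∑ j, h j * DD G (0 + Pi.single i 1 + Pi.single j 1) (w + s • h))
      (∑ i, h i * ∑ j, h j * ∑ k, h k * DD G (0 + Pi.single i 1 + Pi.single j 1 + Pi.single k 1) (w + s • h)) s := by
    intro s
    exact HasDerivAt.fun_sum fun i _ => HasDerivAt.const_mul (h i) <|
      HasDerivAt.fun_sum fun j _ => (hasDerivAt_DD hG _ w h s).const_mul (h j)
  have hM : ∀ s : ℝ, |∑ i, h i * ∑ j, h j * ∑ k, h k * DD G (0 + Pi.single i 1 + Pi.single j 1 + Pi.single k 1) (w + s • h)|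
      ≤ B ^ Fintype.card ι * (∑ i, |h i|) ^ 3 := by
    intro s
    have e3 : ∀ i j k l : ι, ((0 + Pi.single i 1 + Pi.single j 1 + Pi.single k 1 : ι → ℕ)) l ≤ 3 := by
      intro i j k l
      simp only [Pi.add_apply, Pi.zero_apply, Pi.single_apply]
      split_ifs <;> omega
    have b1 : ∀ i j, |∑ k, h k * DD G (0 + Pi.single i 1 + Pi.single j 1 + Pi.single k 1) (w + s • h)|
        ≤ (∑ k, |h k|) * B ^ Fintype.card ι := by
      intro i j
      refine (Finset.abs_sum_le_sum_abs _ _).trans ?_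
      rw [Finset.sum_mul]
      refine Finset.sum_le_sum fun k _ => ?_
      rw [abs_mul]
      exact mul_le_mul_of_nonneg_left (abs_DD_le hB _ (e3 i j k) _) (abs_nonneg _)
    have b2 : ∀ i, |∑ j, h j * ∑ k, h k * DD G (0 + Pi.single i 1 + Pi.single j 1 + Pi.single k 1) (w + s • h)|
        ≤ (∑ k, |h k|) * ((∑ k, |h k|) * B ^ Fintype.card ι) := by
      intro i
      refine (Finset.abs_sum_le_sum_abs _ _).trans ?_
      conv_rhs => rw [Finset.sum_mul]
      refine Finset.sum_le_sum fun k _ => ?_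
      rw [abs_mul]
      exact mul_le_mul_of_nonneg_left (b1 i k) (abs_nonneg _)
    have : B ^ Fintype.card ι * (∑ i, |h i|) ^ 3 = (∑ k, |h k|) * ((∑ k, |h k|) * ((∑ k, |h k|) * B ^ Fintype.card ι)) := by ring
    rw [this]
    refine (Finset.abs_sum_le_sum_abs _ _).trans ?_
    conv_rhs => rw [Finset.sum_mul]
    refine Finset.sum_le_sum fun k _ => ?_
    rw [abs_mul]
    exact mul_le_mul_of_nonneg_left (b2 k) (abs_nonneg _)
  have := taylor1 h1 h2 h3 hM
  simp only [one_smul, zero_smul, add_zero, zero_add, Finset.mul_sum] at this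
  simpa only [mul_assoc] using this

variable {μ ν lam : Measure (ι → ℝ)} {K K' : ι → ι → ℝ}

lemma cont_DD (hG : ∀ k x, HasDerivAt (G k) (G (k+1) x) x) (e : ι → ℕ) : Continuous (DD G e) := by
  unfold DD
  have : ∀ k, Continuous (G k) := fun k => continuous_iff_continuousAt.2 fun x => (hG k x).continuousAt
  fun_prop

lemma integrable_DD (hG : ∀ k x, HasDerivAt (G k) (G (k+1) x) x) {B : ℝ}
    (hB : ∀ k ≤ 3, ∀ x, |G k x| ≤ B) [IsFiniteMeasure μ] (e : ι → ℕ) (he : ∀ i, e i ≤ 3) :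
    Integrable (DD G e) μ :=
  Integrable.of_bound (cont_DD hG e).aestronglyMeasurable _
    (Filter.Eventually.of_forall fun w => abs_DD_le hB e he w)

lemma integrable_abs3 (h : CG μ K) : Integrable (fun x : ι → ℝ => (∑ i, |x i|) ^ 3) μ := by
  have := h.isGaussian
  have h1 : MemLp (fun x : ι → ℝ => ∑ i, |x i|) 3 μ :=
    memLp_finset_sum _ fun i _ => (h.memLp i 3 (by simp)).abs
  have h2 := h1.integrable_norm_pow (by norm_num : (3:ℕ) ≠ 0)
  refine h2.congr (Filter.Eventually.of_forall fun x => ?_)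
  simp only [Real.norm_eq_abs]
  rw [abs_of_nonneg (Finset.sum_nonneg fun i _ => abs_nonneg _)]

lemma taylor_int (hG : ∀ k x, HasDerivAt (G k) (G (k+1) x) x) {B : ℝ}
    (hB : ∀ k ≤ 3, ∀ x, |G k x| ≤ B) (h : CG μ K) (hK : ∀ i j, K i j = K j i) {d : ℝ} (hd : 0 ≤ d)
    (w : ι → ℝ) :
    |∫ x, DD G 0 (w + Real.sqrt d • x) ∂μ - DD G 0 w
      - d / 2 * ∑ i, ∑ j, K i j * DD G (Pi.single i 1 + Pi.single j 1) w|
      ≤ (Real.sqrt d) ^ 3 * (B ^ Fintype.card ι * ∫ x, (∑ i, |x i|) ^ 3 ∂μ) := by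
  have := h.isGaussian
  have i0 : Integrable (fun x : ι → ℝ => DD G 0 (w + Real.sqrt d • x)) μ := by
    refine Integrable.of_bound (C := B ^ Fintype.card ι) ?_ ?_
    · exact ((cont_DD hG 0).comp (by fun_prop)).aestronglyMeasurable
    · exact Filter.Eventually.of_forall fun x => abs_DD_le hB 0 (by simp) _
  set a1 : ι → ℝ := fun i => DD G (Pi.single i 1) w
  set a2 : ι → ι → ℝ := fun i j => DD G (Pi.single i 1 + Pi.single j 1) w
  have i1 : Integrable (fun x : ι → ℝ => ∑ i, (Real.sqrt d * x i) * a1 i) μ := by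
    refine integrable_finset_sum _ fun i _ => ?_
    exact ((h.integrable_eval i).const_mul _).mul_const _
  have i2' : ∀ i j, Integrable (fun x : ι → ℝ => (Real.sqrt d * x i) * (Real.sqrt d * x j) * a2 i j) μ := by
    intro i j
    have := ((h.integrable_mul i j).const_mul d).mul_const (a2 i j)
    refine this.congr (Filter.Eventually.of_forall fun x => ?_)
    have := Real.mul_self_sqrt hd
    simp only
    linear_combination -(x i * x j * a2 i j) * this
  have i2 : Integrable (fun x : ι → ℝ => (∑ i, ∑ j, (Real.sqrt d * x i) * (Real.sqrt d * x j) * a2 i j)/2) μ := by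
    refine Integrable.div_const ?_ _
    exact integrable_finset_sum _ fun i _ => integrable_finset_sum _ fun j _ => i2' i j
  have e1 : ∫ x, (∑ i, (Real.sqrt d * x i) * a1 i) ∂μ = 0 := by
    rw [integral_finset_sum _ fun i _ => ((h.integrable_eval i).const_mul _).mul_const _]
    refine Finset.sum_eq_zero fun i _ => ?_
    rw [integral_mul_const, integral_const_mul, h.integral_eval]; simp
  have e2 : ∫ x, (∑ i, ∑ j, (Real.sqrt d * x i) * (Real.sqrt d * x j) * a2 i j)/2 ∂μ
      = d / 2 * ∑ i, ∑ j, K i j * a2 i j := by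
    rw [integral_div, integral_finset_sum _ fun i _ => integrable_finset_sum _ fun j _ => i2' i j]
    have : ∀ i, ∫ x, ∑ j, (Real.sqrt d * x i) * (Real.sqrt d * x j) * a2 i j ∂μ = d * ∑ j, K i j * a2 i j := by
      intro i
      rw [integral_finset_sum _ fun j _ => i2' i j, Finset.mul_sum]
      refine Finset.sum_congr rfl fun j _ => ?_
      have e : (fun x : ι → ℝ => (Real.sqrt d * x i) * (Real.sqrt d * x j) * a2 i j)
        = fun x => (d * a2 i j) * (x i * x j) := by
        funext x
        have := Real.mul_self_sqrt hd
        linear_combination (x i * x j * a2 i j) * this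
      rw [e, integral_const_mul, h.integral_mul hK]; ring
    simp_rw [this]
    rw [← Finset.mul_sum]; ring
  have key : ∫ x, DD G 0 (w + Real.sqrt d • x) ∂μ - DD G 0 w
      - d / 2 * ∑ i, ∑ j, K i j * a2 i j
      = ∫ x, (DD G 0 (w + Real.sqrt d • x) - DD G 0 w - (∑ i, (Real.sqrt d * x i) * a1 i)
        - (∑ i, ∑ j, (Real.sqrt d * x i) * (Real.sqrt d * x j) * a2 i j)/2) ∂μ := by
    have j1 : Integrable (fun x : ι → ℝ => DD G 0 (w + Real.sqrt d • x) - DD G 0 w) μ := i0.sub (integrable_const _)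
    have j2 : Integrable (fun x : ι → ℝ => DD G 0 (w + Real.sqrt d • x) - DD G 0 w - (∑ i, (Real.sqrt d * x i) * a1 i)) μ := j1.sub i1
    rw [integral_sub j2 i2, integral_sub j1 i1, integral_sub i0 (integrable_const _), e1, e2]
    simp
  rw [key]
  have bd : ∀ x : ι → ℝ, ‖(DD G 0 (w + Real.sqrt d • x) - DD G 0 w - (∑ i, (Real.sqrt d * x i) * a1 i)
        - (∑ i, ∑ j, (Real.sqrt d * x i) * (Real.sqrt d * x j) * a2 i j)/2)‖
        ≤ (Real.sqrt d) ^ 3 * (B ^ Fintype.card ι * (∑ i, |x i|) ^ 3) := by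
    intro x
    have := taylorDD hG hB w (Real.sqrt d • x)
    simp only [Pi.smul_apply, smul_eq_mul, abs_mul, ← Finset.mul_sum, abs_of_nonneg (Real.sqrt_nonneg d)] at this
    simp only [Real.norm_eq_abs]
    refine this.trans (le_of_eq ?_)
    ring
  have := norm_integral_le_of_norm_le (((integrable_abs3 h).const_mul (B ^ Fintype.card ι)).const_mul ((Real.sqrt d)^3)) (Filter.Eventually.of_forall bd)
  rw [integral_const_mul, integral_const_mul] at this
  exact this

/-- law of `√p x + √q y`. -/
noncomputable def MM (μ ν : Measure (ι → ℝ)) (p q : ℝ) : Measure (ι → ℝ) :=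
  (μ.prod ν).map (fun z => Real.sqrt p • z.1 + Real.sqrt q • z.2)

lemma MM_add_left (h : CG μ K) (h' : CG ν K') {p q d : ℝ} (hp : 0 ≤ p) (hq : 0 ≤ q) (hd : 0 ≤ d) :
    ((MM μ ν p q).prod μ).map (fun z => z.1 + Real.sqrt d • z.2) = MM μ ν (p+d) q := by
  have h1 := (h.comb h' hp hq)
  have h2 := h1.comb h (zero_le_one) hd
  have h3 := h.comb h' (add_nonneg hp hd) hq
  simp only [Real.sqrt_one, one_smul, one_mul] at h2
  refine CG.ext (K := fun i j => p * K i j + q * K' i j + d * K i j) h2 ?_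
  have e : (fun i j => p * K i j + q * K' i j + d * K i j) = fun i j => (p+d) * K i j + q * K' i j := by
    funext i j; ring
  rw [e]; exact h3

lemma MM_add_right (h : CG μ K) (h' : CG ν K') {p q d : ℝ} (hp : 0 ≤ p) (hq : 0 ≤ q) (hd : 0 ≤ d) :
    ((MM μ ν p q).prod ν).map (fun z => z.1 + Real.sqrt d • z.2) = MM μ ν p (q+d) := by
  have h1 := (h.comb h' hp hq)
  have h2 := h1.comb h' (zero_le_one) hd
  have h3 := h.comb h' hp (add_nonneg hq hd)
  simp only [Real.sqrt_one, one_smul, one_mul] at h2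
  refine CG.ext (K := fun i j => p * K i j + q * K' i j + d * K' i j) h2 ?_
  have e : (fun i j => p * K i j + q * K' i j + d * K' i j) = fun i j => p * K i j + (q+d) * K' i j := by
    funext i j; ring
  rw [e]; exact h3

lemma taylor_int2 (hG : ∀ k x, HasDerivAt (G k) (G (k+1) x) x) {B : ℝ}
    (hB : ∀ k ≤ 3, ∀ x, |G k x| ≤ B) (h : CG μ K) (hK : ∀ i j, K i j = K j i) {d : ℝ} (hd : 0 ≤ d)
    [IsProbabilityMeasure lam] :
    |∫ w, DD G 0 w ∂((lam.prod μ).map (fun z => z.1 + Real.sqrt d • z.2)) - ∫ w, DD G 0 w ∂lam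
      - d / 2 * ∑ i, ∑ j, K i j * ∫ w, DD G (Pi.single i 1 + Pi.single j 1) w ∂lam|
      ≤ (Real.sqrt d) ^ 3 * (B ^ Fintype.card ι * ∫ x, (∑ i, |x i|) ^ 3 ∂μ) := by
  have := h.isGaussian
  have hc := cont_DD (ι := ι) hG 0
  have e2 : ∀ i j l : ι, ((Pi.single i 1 + Pi.single j 1 : ι → ℕ)) l ≤ 3 := by
      intro i j l
      simp only [Pi.add_apply, Pi.single_apply]
      split_ifs <;> omega
  rw [integral_map (Measurable.aemeasurable (by fun_prop)) hc.aestronglyMeasurable]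
  have ii : Integrable (fun z : (ι → ℝ) × (ι → ℝ) => DD G 0 (z.1 + Real.sqrt d • z.2)) (lam.prod μ) := by
    refine Integrable.of_bound (C := B ^ Fintype.card ι) ?_ ?_
    · exact (hc.comp (by fun_prop)).aestronglyMeasurable
    · exact Filter.Eventually.of_forall fun x => abs_DD_le hB 0 (by simp) _
  rw [integral_prod _ ii]
  have i2 : ∀ i j, Integrable (fun w => K i j * DD G (Pi.single i 1 + Pi.single j 1) w) lam := fun i j =>
    (integrable_DD hG hB _ (e2 i j)).const_mul _
  have i3 : Integrable (fun w => d / 2 * ∑ i, ∑ j, K i j * DD G (Pi.single i 1 + Pi.single j 1) w) lam :=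
    (integrable_finset_sum _ fun i _ => integrable_finset_sum _ fun j _ => i2 i j).const_mul _
  have i0 : Integrable (DD G (0 : ι → ℕ)) lam := integrable_DD hG hB 0 (by simp)
  have i1 := ii.integral_prod_left
  have i4 : Integrable (fun w => ∫ x, DD G 0 (w + Real.sqrt d • x) ∂μ - DD G 0 w) lam := i1.sub i0
  have key : ∫ w, ∫ x, DD G 0 (w + Real.sqrt d • x) ∂μ ∂lam - ∫ w, DD G 0 w ∂lam
      - d / 2 * ∑ i, ∑ j, K i j * ∫ w, DD G (Pi.single i 1 + Pi.single j 1) w ∂lam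
     = ∫ w, (∫ x, DD G 0 (w + Real.sqrt d • x) ∂μ - DD G 0 w
      - d / 2 * ∑ i, ∑ j, K i j * DD G (Pi.single i 1 + Pi.single j 1) w) ∂lam := by
    rw [integral_sub i4 i3, integral_sub i1 i0, integral_const_mul,
      integral_finset_sum _ fun i _ => integrable_finset_sum _ fun j _ => i2 i j]
    congr 2
    refine Finset.sum_congr rfl fun i _ => ?_
    rw [integral_finset_sum _ fun j _ => i2 i j]
    refine Finset.sum_congr rfl fun j _ => ?_
    rw [integral_const_mul]
  rw [key]
  have bd : ∀ w, ‖∫ x, DD G 0 (w + Real.sqrt d • x) ∂μ - DD G 0 w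
      - d / 2 * ∑ i, ∑ j, K i j * DD G (Pi.single i 1 + Pi.single j 1) w‖
      ≤ (Real.sqrt d) ^ 3 * (B ^ Fintype.card ι * ∫ x, (∑ i, |x i|) ^ 3 ∂μ) :=
    fun w => taylor_int hG hB h hK hd w
  have := norm_integral_le_of_norm_le_const (μ := lam) (Filter.Eventually.of_forall bd)
  rw [probReal_univ, mul_one] at this
  exact this

theorem berman_abs (hG : ∀ k x, HasDerivAt (G k) (G (k+1) x) x) {B : ℝ}
    (hB : ∀ k ≤ 3, ∀ x, |G k x| ≤ B) (h : CG μ K) (h' : CG ν K') (hK : ∀ i j, K i j = K j i)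
    (hK' : ∀ i j, K' i j = K' j i) {E : ℝ}
    (hE : ∀ p q : ℝ, 0 ≤ p → 0 ≤ q → 1/2 ≤ p + q → p + q ≤ 1 →
      ∑ i, ∑ j, (K i j - K' i j) * ∫ w, DD G (Pi.single i 1 + Pi.single j 1) w ∂(MM μ ν p q) ≤ E) :
    ∫ w, DD G 0 w ∂μ ≤ ∫ w, DD G 0 w ∂ν + E / 2 := by
  have := h.isGaussian
  have := h'.isGaussian
  set J : ℝ → ℝ → ℝ := fun p q => ∫ w, DD G 0 w ∂(MM μ ν p q) with hJ
  set A := B ^ Fintype.card ι * ∫ x, (∑ i, |x i|) ^ 3 ∂μ with hA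
  set A' := B ^ Fintype.card ι * ∫ x, (∑ i, |x i|) ^ 3 ∂ν with hA'
  have step : ∀ p q d : ℝ, 0 ≤ p → 0 ≤ q → 0 ≤ d → d ≤ 1/2 → p + q + d = 1 →
      J (p+d) q - J p (q+d) ≤ d / 2 * E + (Real.sqrt d)^3 * (A + A') := by
    intro p q d hp hq hd hd2 hs
    have : IsProbabilityMeasure (MM μ ν p q) := Measure.isProbabilityMeasure_map (by fun_prop)
    have t1 := taylor_int2 (lam := MM μ ν p q) hG hB h hK hd
    have t2 := taylor_int2 (lam := MM μ ν p q) hG hB h' hK' hd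
    rw [MM_add_left h h' hp hq hd] at t1
    rw [MM_add_right h h' hp hq hd] at t2
    have e := hE p q hp hq (by linarith) (by linarith)
    simp only [sub_mul, Finset.sum_sub_distrib] at e
    have t1' := (abs_le.1 t1).2
    have t2' := (abs_le.1 t2).1
    have e' := mul_le_mul_of_nonneg_left e (by linarith : 0 ≤ d / 2)
    rw [mul_sub] at e'
    simp only [hJ]
    linarith
  have tot : ∀ m : ℕ, J 1 0 - J 0 1 ≤ E / 2 + (Real.sqrt (1/(m+2:ℝ))) * (A + A') := by
    intro m
    set d : ℝ := 1/(m+2:ℝ) with hd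
    have hm : (0:ℝ) < m + 2 := by positivity
    have hd0 : 0 ≤ d := by positivity
    have hd2 : d ≤ 1/2 := by
      rw [hd]; apply one_div_le_one_div_of_le <;> linarith [(Nat.cast_nonneg m : (0:ℝ) ≤ m)]
    have hdm : (m + 2) * d = 1 := by rw [hd]; field_simp
    have ind : ∀ k : ℕ, k ≤ m + 2 → J 1 0 - J (1 - k * d) (k * d) ≤ k * (d / 2 * E + (Real.sqrt d)^3 * (A + A')) := by
      intro k
      induction k with
      | zero => intro _; simp
      | succ k ih =>
        intro hk
        have ih' := ih (by omega)
        have hkm : ((k:ℝ) + 1) ≤ m + 2 := by exact_mod_cast hk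
        have : (k + 1) * d ≤ 1 := by
          calc (k + 1) * d ≤ (m+2) * d := mul_le_mul_of_nonneg_right hkm hd0
            _ = 1 := hdm
        have s := step (1 - (k+1) * d) (k * d) d (by linarith) (by positivity) hd0 hd2 (by ring)
        have e1 : 1 - ((k:ℝ)+1) * d + d = 1 - k * d := by ring
        have e2 : (k:ℝ) * d + d = (k+1) * d := by ring
        rw [e1, e2] at s
        push_cast
        linarith
    have := ind (m+2) le_rfl
    push_cast at this
    rw [hdm, sub_self] at this
    have e3 : ((m:ℝ)+2) * (d / 2 * E + (Real.sqrt d)^3 * (A + A')) = E / 2 + Real.sqrt d * (A + A') := by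
      have : Real.sqrt d ^ 3 = d * Real.sqrt d := by
        rw [pow_succ, Real.sq_sqrt hd0]
      rw [this]
      linear_combination (E / 2 + Real.sqrt d * (A+A')) * hdm
    rw [e3] at this
    exact this
  have lim : Tendsto (fun m : ℕ => E / 2 + (Real.sqrt (1/(m+2:ℝ))) * (A + A')) atTop (𝓝 (E / 2 + Real.sqrt 0 * (A + A'))) := by
    refine Tendsto.const_add _ (Tendsto.mul_const _ ?_)
    refine (Real.continuous_sqrt.tendsto 0).comp ?_
    refine Tendsto.div_atTop tendsto_const_nhds ?_
    exact tendsto_atTop_add_const_right _ _ tendsto_natCast_atTop_atTop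
  have fin := ge_of_tendsto' lim tot
  have m1 : MM μ ν 1 0 = μ := by
    refine CG.ext (K := K) ?_ h
    have := h.comb h' zero_le_one (le_refl 0)
    simpa [MM] using this
  have m2 : MM μ ν 0 1 = ν := by
    refine CG.ext (K := K') ?_ h'
    have := h.comb h' (le_refl 0) zero_le_one
    simpa [MM] using this
  simp only [hJ, m1, m2] at fin
  simp at fin
  linarith

end Taylor
end UB

open MeasureTheory ProbabilityTheory Filter Set Topology
set_option linter.unusedSectionVars false
set_option linter.deprecated false
set_option linter.unusedSimpArgs false

namespace UB

section Decomp
variable {ι : Type*} [Fintype ι] [DecidableEq ι] {μ ν : Measure (ι → ℝ)} {K K' : ι → ι → ℝ}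

lemma quad_shift (hK : ∀ i j, K i j = K j i) (i0 : ι) (c : ι → ℝ) (x : ℝ) :
    ∑ i, ∑ j, (c i - x * (Pi.single i0 1 : ι → ℝ) i) * (c j - x * (Pi.single i0 1 : ι → ℝ) j) * K i j
      = (∑ i, ∑ j, c i * c j * K i j) - 2 * x * (∑ j, c j * K j i0) + x ^ 2 * K i0 i0 := by
  have e : ∀ i j, (c i - x * (Pi.single i0 1 : ι → ℝ) i) * (c j - x * (Pi.single i0 1 : ι → ℝ) j) * K i j
      = c i * c j * K i j - (Pi.single i0 1 : ι → ℝ) j * (x * c i * K i j) - (Pi.single i0 1 : ι → ℝ) i * (x * c j * K i j)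
        + (Pi.single i0 1 : ι → ℝ) i * ((Pi.single i0 1 : ι → ℝ) j * (x ^ 2 * K i j)) := by
    intro i j; ring
  simp only [e, Finset.sum_add_distrib, Finset.sum_sub_distrib]
  simp only [Pi.single_apply, ite_mul, one_mul, zero_mul, Finset.sum_ite_eq', Finset.mem_univ, if_true, ← Finset.mul_sum]
  have e1 : ∑ i, x * c i * K i i0 = x * ∑ j, c j * K j i0 := by
    rw [Finset.mul_sum]; exact Finset.sum_congr rfl fun _ _ => by ring
  have e2 : ∑ j, x * c j * K i0 j = x * ∑ j, c j * K j i0 := by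
    rw [Finset.mul_sum]; exact Finset.sum_congr rfl fun j _ => by rw [hK i0 j]; ring
  have e3 : ∑ i, (if i = i0 then ∑ j, x * c j * K i j else 0) = x * ∑ j, c j * K j i0 := by
    simp [e2]
  simp only [Finset.sum_ite_irrel, Finset.sum_const_zero, e1]
  simp
  rw [e2]; ring

/-- decomposition along the coordinate `i0`. -/
lemma CG.decomp (h : CG μ K) (hK : ∀ i j, K i j = K j i) (i0 : ι) {s : ℝ} (hs : 0 < s) (hKs : K i0 i0 = s) :
    μ = ((gaussianReal 0 s.toNNReal).prod μ).map
      (fun z : ℝ × (ι → ℝ) => fun j => (K j i0 / s) * z.1 + (z.2 j - (K j i0 / s) * z.2 i0)) := by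
  have := h.isGaussian
  refine CG.ext h ⟨h.1, fun c => ?_⟩
  set x : ℝ := ∑ j, c j * (K j i0 / s) with hx
  rw [Measure.map_map (by fun_prop) (by fun_prop)]
  have e : ((fun x : ι → ℝ => ∑ i, c i * x i) ∘ (fun z : ℝ × (ι → ℝ) => fun j => (K j i0 / s) * z.1 + (z.2 j - (K j i0 / s) * z.2 i0)))
      = (fun z : ℝ × (ι → ℝ) => x * z.1) + fun z => ∑ i, (c i - x * (Pi.single i0 1 : ι → ℝ) i) * z.2 i := by
    funext z
    have e1 : ∑ i, (c i - x * (Pi.single i0 1 : ι → ℝ) i) * z.2 i = (∑ i, c i * z.2 i) - x * z.2 i0 := by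
      simp [sub_mul, Finset.sum_sub_distrib, Pi.single_apply]
    simp only [Function.comp, Pi.add_apply]
    rw [e1, hx, Finset.sum_mul, Finset.sum_mul, ← Finset.sum_sub_distrib, ← Finset.sum_add_distrib]
    exact Finset.sum_congr rfl fun _ _ => by ring
  rw [e]
  have ind : IndepFun (fun z : ℝ × (ι → ℝ) => x * z.1)
      (fun z => ∑ i, (c i - x * (Pi.single i0 1 : ι → ℝ) i) * z.2 i) ((gaussianReal 0 s.toNNReal).prod μ) :=
    indepFun_prod (X := fun a : ℝ => x * a)
        (Y := fun w : ι → ℝ => ∑ i, (c i - x * (Pi.single i0 1 : ι → ℝ) i) * w i) (by fun_prop) (by fun_prop)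
  have m1 : ((gaussianReal 0 s.toNNReal).prod μ).map (fun z : ℝ × (ι → ℝ) => x * z.1) = gaussianReal 0 (Real.toNNReal (x ^ 2 * s)) := by
    have : (fun z : ℝ × (ι → ℝ) => x * z.1) = (fun y => x * y) ∘ Prod.fst := rfl
    rw [this, ← Measure.map_map (by fun_prop) (by fun_prop), Measure.map_fst_prod]
    simp only [measure_univ, one_smul]
    rw [gaussianReal_map_const_mul]
    congr 1
    · simp
    · ext; simp [Real.toNNReal_mul (sq_nonneg x), sq_nonneg, hs.le]
  have m2 : ((gaussianReal 0 s.toNNReal).prod μ).map (fun z : ℝ × (ι → ℝ) => ∑ i, (c i - x * (Pi.single i0 1 : ι → ℝ) i) * z.2 i)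
      = gaussianReal 0 (Real.toNNReal (∑ i, ∑ j, (c i - x * (Pi.single i0 1 : ι → ℝ) i) * (c j - x * (Pi.single i0 1 : ι → ℝ) j) * K i j)) := by
    have : (fun z : ℝ × (ι → ℝ) => ∑ i, (c i - x * (Pi.single i0 1 : ι → ℝ) i) * z.2 i)
      = (fun w : ι → ℝ => ∑ i, (c i - x * (Pi.single i0 1 : ι → ℝ) i) * w i) ∘ Prod.snd := rfl
    rw [this, ← Measure.map_map (by fun_prop) (by fun_prop), Measure.map_snd_prod]
    simp only [measure_univ, one_smul]
    exact h.2 _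
  rw [gaussianReal_add_gaussianReal_of_indepFun ind m1 m2]
  congr 1
  · simp
  · rw [← Real.toNNReal_add (by positivity) (h.1 _), quad_shift hK, hKs]
    congr 1
    have : ∑ j, c j * K j i0 = x * s := by
      rw [hx, Finset.sum_mul]
      refine Finset.sum_congr rfl fun j _ => ?_
      field_simp
    rw [this]; ring

/-- law of `w j - κ w i`. -/
lemma CG.map_diff (h : CG μ K) (hK : ∀ i j, K i j = K j i) (i j : ι) (k : ℝ) :
    μ.map (fun w => w j - k * w i) = gaussianReal 0 (Real.toNNReal (K j j - 2 * k * K j i + k ^ 2 * K i i)) := by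
  have := h.2 (fun l => (Pi.single j 1 : ι → ℝ) l - k * (Pi.single i 1 : ι → ℝ) l)
  rw [quad_shift hK] at this
  simp only [Pi.single_apply, mul_ite, ite_mul, one_mul, zero_mul, mul_one, mul_zero, sub_mul, Finset.sum_sub_distrib,
    Finset.sum_ite_eq', Finset.mem_univ, if_true] at this
  exact this

lemma CG.map_eval (h : CG μ K) (i : ι) : μ.map (fun w => w i) = gaussianReal 0 (Real.toNNReal (K i i)) := by
  have := h.2 (Pi.single i 1)
  simp only [Pi.single_apply, mul_ite, ite_mul, one_mul, zero_mul, mul_one, mul_zero, 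
    Finset.sum_ite_eq', Finset.mem_univ, if_true] at this
  exact this

end Decomp

section Pair
variable {ι : Type*} [Fintype ι] [DecidableEq ι] {μ ν : Measure (ι → ℝ)} {K K' : ι → ι → ℝ}

lemma dens_bound {s k ρ v x z : ℝ} (hs : 1/2 ≤ s) (hs1 : s ≤ 1) (hk : 0 ≤ k) (hkρ : k ≤ ρ) (hρ : ρ < 1)
    (hv : 0 < v) (hx : v ≤ x) (hz : v ≤ z) :
    gaussianPDFReal 0 s.toNNReal x * gaussianPDFReal (k * x) (Real.toNNReal (s * (1 - k^2))) z
      ≤ 1 / (1 - ρ) * Real.exp (- v ^ 2 / (1 + ρ)) := by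
  have h1 : 0 < 1 - k := by linarith
  have h2 : 0 < 1 - k ^ 2 := by nlinarith
  have hs0 : 0 < s := by linarith
  rw [gaussianPDFReal, gaussianPDFReal, Real.coe_toNNReal _ hs0.le, Real.coe_toNNReal _ (by positivity)]
  have e : ∀ a b c d : ℝ, a * Real.exp b * (c * Real.exp d) = (a * c) * Real.exp (b + d) := by
    intro a b c d; rw [Real.exp_add]; ring
  rw [e]
  have pi3 := Real.pi_gt_three
  refine mul_le_mul ?_ ?_ (Real.exp_pos _).le (by apply one_div_nonneg.2; linarith)
  · rw [← mul_inv, ← Real.sqrt_mul (by positivity), inv_eq_one_div]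
    apply one_div_le_one_div_of_le (by linarith)
    apply Real.le_sqrt_of_sq_le
    have : (1 - ρ) ^ 2 ≤ 1 - k ^ 2 := by nlinarith
    have h3 : 1 ≤ 2 * Real.pi * s := by nlinarith
    have h4 : 1 ≤ (2 * Real.pi * s) * (2 * Real.pi * s) := by nlinarith
    calc (1-ρ)^2 ≤ 1 - k ^ 2 := this
      _ ≤ (2 * Real.pi * s) * (2 * Real.pi * s) * (1 - k^2) := by nlinarith
      _ = _ := by ring
  · apply Real.exp_le_exp.2
    have e2 : -(x - 0) ^ 2 / (2 * s) + -(z - k * x) ^ 2 / (2 * (s * (1 - k ^ 2)))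
        = - ((1 - k) * (x^2 + z^2) + k * (x - z)^2) / (2 * s * (1 - k^2)) := by
      field_simp; ring
    rw [e2, neg_div, neg_div, neg_le_neg_iff]
    have : (1-k) * (2 * v^2) ≤ (1 - k) * (x^2 + z^2) + k * (x - z)^2 := by
      have : 2 * v ^2 ≤ x^2+z^2 := by nlinarith
      nlinarith [mul_nonneg hk (sq_nonneg (x - z)), mul_le_mul_of_nonneg_left this h1.le]
    calc v^2 / (1+ρ) ≤ v^2/ (s * (1+k)) := by
          apply div_le_div_of_nonneg_left (by positivity) (by positivity)
          nlinarith
      _ = (1-k) * (2 * v^2) / (2 * s * (1 - k^2)) := by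
          have : (1 - k^2) = (1-k)*(1+k) := by ring
          rw [this]; field_simp
      _ ≤ _ := by gcongr

lemma pair_bound (h : CG μ K) (hK : ∀ i j, K i j = K j i) (i j : ι) {s ρ v : ℝ} (hs : 1/2 ≤ s) (hs1 : s ≤ 1)
    (hi : K i i = s) (hj : K j j = s) (hc : 0 ≤ K j i) (hcρ : K j i ≤ ρ * s) (hρ : ρ < 1) (hv : 0 < v)
    {f : ℝ → ℝ} (hf : Continuous f) (hf0 : ∀ x, 0 ≤ f x) (hfv : ∀ x < v, f x = 0) {B : ℝ} (hB : ∀ x, f x ≤ B)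
    (hfi : Integrable f) (hf1 : ∫ x, f x = 1) :
    ∫ w, f (w i) * f (w j) ∂μ ≤ 1 / (1 - ρ) * Real.exp (- v ^ 2 / (1 + ρ)) := by
  have := h.isGaussian
  have hs0 : 0 < s := by linarith
  set k := K j i / s with hk
  have hk0 : 0 ≤ k := by positivity
  have hkρ : k ≤ ρ := by rw [hk]; exact (div_le_iff₀ hs0).2 hcρ
  have hρ0 : 0 < 1 - ρ := by linarith
  have h2 : 0 < 1 - k ^ 2 := by nlinarith
  have hB0 : 0 ≤ B := (hf0 0).trans (hB 0)
  conv_lhs => rw [h.decomp hK i hs0 hi]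
  rw [integral_map (Measurable.aemeasurable (by fun_prop))
    (Continuous.aestronglyMeasurable (by fun_prop))]
  have ei : K i i / s = 1 := by rw [hi]; exact div_self hs0.ne'
  simp only [ei, one_mul, sub_self, add_zero, ← hk]
  rw [integral_prod]
  swap
  · refine Integrable.of_bound (C := B * B) (Continuous.aestronglyMeasurable (by fun_prop)) (Eventually.of_forall fun z => ?_)
    rw [Real.norm_eq_abs, abs_of_nonneg (mul_nonneg (hf0 _) (hf0 _))]
    exact mul_le_mul (hB _) (hB _) (hf0 _) hB0
  have var : K j j - 2 * k * K j i + k ^ 2 * K i i = s * (1 - k^2) := by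
    have : K j i = k * s := by rw [hk]; field_simp
    rw [hi, hj, this]; ring
  have hne : (Real.toNNReal (s * (1 - k^2))) ≠ 0 := by
    simp; positivity
  have inner : ∀ x : ℝ, ∫ w, f x * f (k * x + (w j - k * w i)) ∂μ
      = f x * ∫ z, gaussianPDFReal (k * x) (Real.toNNReal (s * (1 - k^2))) z * f z := by
    intro x
    rw [integral_const_mul]
    congr 1
    have m := h.map_diff hK i j k
    rw [var] at m
    have : ∫ w, f (k * x + (w j - k * w i)) ∂μ = ∫ y, f y ∂(((μ.map (fun w => w j - k * w i)).map (k * x + ·))) := by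
      rw [integral_map (by fun_prop) hf.aestronglyMeasurable,
        integral_map (Measurable.aemeasurable (by fun_prop)) (Continuous.aestronglyMeasurable (by fun_prop))]
    rw [this, m, gaussianReal_map_const_add, zero_add, integral_gaussianReal_eq_integral_smul hne]
    simp
  simp only [inner]
  rw [integral_gaussianReal_eq_integral_smul (by simp; positivity)]
  simp only [smul_eq_mul]
  set D := 1 / (1 - ρ) * Real.exp (- v ^ 2 / (1 + ρ)) with hD
  have hD0 : 0 ≤ D := by positivity
  have : ∫ x, gaussianPDFReal 0 s.toNNReal x * (f x * ∫ z, gaussianPDFReal (k * x) (Real.toNNReal (s * (1 - k^2))) z * f z)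
      ≤ ∫ x, D * f x := by
    refine integral_mono_of_nonneg (Eventually.of_forall fun x => ?_) (hfi.const_mul _) (Eventually.of_forall fun x => ?_)
    · exact mul_nonneg (gaussianPDFReal_nonneg _ _ _) (mul_nonneg (hf0 _) (integral_nonneg fun z => mul_nonneg (gaussianPDFReal_nonneg _ _ _) (hf0 _)))
    · by_cases hx : x < v
      · simp [hfv x hx]
      push Not at hx
      simp only
      have : gaussianPDFReal 0 s.toNNReal x * (∫ z, gaussianPDFReal (k * x) (Real.toNNReal (s * (1 - k^2))) z * f z) ≤ D := by
        rw [← integral_const_mul]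
        calc _ ≤ ∫ z, D * f z := ?_
          _ = D := by rw [integral_const_mul, hf1, mul_one]
        refine integral_mono_of_nonneg (Eventually.of_forall fun z => ?_) (hfi.const_mul _) (Eventually.of_forall fun z => ?_)
        · exact mul_nonneg (gaussianPDFReal_nonneg _ _ _) (mul_nonneg (gaussianPDFReal_nonneg _ _ _) (hf0 _))
        · by_cases hz : z < v
          · simp [hfv z hz]
          push Not at hz
          simp only
          rw [← mul_assoc]
          exact mul_le_mul_of_nonneg_right (dens_bound hs hs1 hk0 hkρ hρ hv hx hz) (hf0 z)
      calc _ = (gaussianPDFReal 0 s.toNNReal x * (∫ z, gaussianPDFReal (k * x) (Real.toNNReal (s * (1 - k^2))) z * f z)) * f x := by ring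
        _ ≤ _ := mul_le_mul_of_nonneg_right this (hf0 x)
  rw [integral_const_mul, hf1, mul_one] at this
  exact this
end Pair
end UB

open MeasureTheory ProbabilityTheory Filter Set Topology
set_option linter.unusedSectionVars false
set_option linter.deprecated false
set_option linter.unusedSimpArgs false

namespace UB

section Smooth

noncomputable def gg (v h : ℝ) (x : ℝ) : ℝ := 1 - Real.smoothTransition ((x - v) / h)

noncomputable def GG (v h : ℝ) (k : ℕ) : ℝ → ℝ := iteratedDeriv k (gg v h)

variable {v h : ℝ}

lemma gg_contDiff (v h : ℝ) (n : ℕ) : ContDiff ℝ n (gg v h) := by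
  unfold gg
  have : ContDiff ℝ n Real.smoothTransition := Real.smoothTransition.contDiff (n := (n : ℕ∞))
  exact contDiff_const.sub (this.comp ((contDiff_id.sub contDiff_const).div_const _))

lemma GG_hasDerivAt (v h : ℝ) (k : ℕ) (x : ℝ) : HasDerivAt (GG v h k) (GG v h (k+1) x) x := by
  unfold GG
  rw [iteratedDeriv_succ]
  exact ((gg_contDiff v h (k+1)).differentiable_iteratedDeriv' k x).hasDerivAt

lemma GG_cont (v h : ℝ) (k : ℕ) : Continuous (GG v h k) :=
  continuous_iff_continuousAt.2 fun x => (GG_hasDerivAt v h k x).continuousAt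

lemma gg_nonneg (x : ℝ) : 0 ≤ gg v h x := by
  unfold gg; linarith [Real.smoothTransition.le_one ((x - v)/h)]
lemma gg_le_one (x : ℝ) : gg v h x ≤ 1 := by
  unfold gg; linarith [Real.smoothTransition.nonneg ((x - v)/h)]
lemma gg_one (hh : 0 < h) {x : ℝ} (hx : x ≤ v) : gg v h x = 1 := by
  unfold gg; rw [Real.smoothTransition.zero_of_nonpos (div_nonpos_of_nonpos_of_nonneg (by linarith) hh.le)]; simp
lemma gg_zero (hh : 0 < h) {x : ℝ} (hx : v + h ≤ x) : gg v h x = 0 := by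
  unfold gg; rw [Real.smoothTransition.one_of_one_le ((one_le_div hh).2 (by linarith))]; simp
lemma gg_anti (hh : 0 < h) : Antitone (gg v h) := by
  intro x y hxy
  unfold gg
  have := Real.smoothTransition.monotone (div_le_div_of_nonneg_right (sub_le_sub_right hxy v) hh.le)
  linarith

lemma GG_out (hh : 0 < h) {k : ℕ} (hk : k ≠ 0) {x : ℝ} (hx : x < v ∨ v + h < x) : GG v h k x = 0 := by
  unfold GG
  rcases hx with hx | hx
  · have : gg v h =ᶠ[𝓝 x] fun _ => 1 := by
      filter_upwards [Iio_mem_nhds hx] with y hy using gg_one hh (le_of_lt hy)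
    rw [(this.iteratedDeriv k).eq_of_nhds, iteratedDeriv_const]; simp [hk]
  · have : gg v h =ᶠ[𝓝 x] fun _ => 0 := by
      filter_upwards [Ioi_mem_nhds hx] with y hy using gg_zero hh (le_of_lt hy)
    rw [(this.iteratedDeriv k).eq_of_nhds, iteratedDeriv_const]; simp

lemma GG_bdd1 (hh : 0 < h) (k : ℕ) : ∃ B, 0 ≤ B ∧ ∀ x, |GG v h k x| ≤ B := by
  by_cases hk : k = 0
  · refine ⟨1, zero_le_one, fun x => ?_⟩
    subst hk
    simp only [GG, iteratedDeriv_zero]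
    rw [abs_of_nonneg (gg_nonneg x)]; exact gg_le_one x
  · obtain ⟨B, hB⟩ := isCompact_Icc (a := v) (b := v+h) |>.exists_bound_of_continuousOn (GG_cont v h k).continuousOn
    refine ⟨max B 0, le_max_right _ _, fun x => ?_⟩
    by_cases hx : x ∈ Icc v (v+h)
    · exact (hB x hx).trans (le_max_left _ _)
    · rw [GG_out hh hk]
      · simp
      · by_contra hcon
        push Not at hcon
        exact hx hcon

lemma GG_bdd (hh : 0 < h) : ∃ B, ∀ k ≤ 3, ∀ x, |GG v h k x| ≤ B := by
  choose B hB0 hB using GG_bdd1 (v := v) hh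
  refine ⟨∑ k ∈ Finset.range 4, B k, fun k hk x => (hB k x).trans ?_⟩
  exact Finset.single_le_sum (f := B) (fun i _ => hB0 i) (Finset.mem_range.2 (by omega))

lemma GG1_nonpos (hh : 0 < h) (x : ℝ) : GG v h 1 x ≤ 0 := by
  unfold GG
  rw [iteratedDeriv_one]
  exact (gg_anti hh).deriv_nonpos

lemma GG1_integrable (hh : 0 < h) : Integrable (GG v h 1) := by
  refine (GG_cont v h 1).integrable_of_hasCompactSupport ?_
  refine HasCompactSupport.of_support_subset_isCompact (isCompact_Icc (a := v) (b := v+h)) ?_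
  intro x hx
  by_contra hcon
  apply hx
  apply GG_out hh one_ne_zero
  by_contra h2
  push Not at h2
  exact hcon h2

lemma GG1_integral (hh : 0 < h) : ∫ x, - GG v h 1 x = 1 := by
  rw [integral_neg]
  have : ∫ x, GG v h 1 x = ∫ x in v..(v+h), GG v h 1 x := by
    rw [intervalIntegral.integral_of_le (by linarith), ← integral_Icc_eq_integral_Ioc]
    rw [setIntegral_eq_integral_of_forall_compl_eq_zero]
    intro x hx
    apply GG_out hh one_ne_zero
    by_contra h2
    push Not at h2
    exact hx h2
  rw [this, intervalIntegral.integral_eq_sub_of_hasDerivAt (f := GG v h 0) (fun x _ => GG_hasDerivAt v h 0 x)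
    ((GG_cont v h 1).intervalIntegrable _ _)]
  simp only [GG, iteratedDeriv_zero]
  rw [gg_one hh le_rfl, gg_zero hh le_rfl]; norm_num

end Smooth

section Berman
variable {ι : Type*} [Fintype ι] [DecidableEq ι] {μ ν : Measure (ι → ℝ)} {K K' : ι → ι → ℝ}

lemma DD_pair {v h : ℝ} (hh : 0 < h) {i j : ι} (hij : i ≠ j) (w : ι → ℝ) :
    0 ≤ DD (GG v h) (Pi.single i 1 + Pi.single j 1) w ∧
    DD (GG v h) (Pi.single i 1 + Pi.single j 1) w ≤ (- GG v h 1 (w i)) * (- GG v h 1 (w j)) := by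
  unfold DD
  rw [← Finset.mul_prod_erase Finset.univ _ (Finset.mem_univ i),
    ← Finset.mul_prod_erase (Finset.univ.erase i) _ (Finset.mem_erase.2 ⟨hij.symm, Finset.mem_univ j⟩)]
  have e1 : (Pi.single i 1 + Pi.single j 1 : ι → ℕ) i = 1 := by simp [hij, Pi.single_apply]
  have e2 : (Pi.single i 1 + Pi.single j 1 : ι → ℕ) j = 1 := by simp [hij.symm, Pi.single_apply]
  rw [e1, e2, ← mul_assoc]
  have a : 0 ≤ GG v h 1 (w i) * GG v h 1 (w j) := mul_nonneg_of_nonpos_of_nonpos (GG1_nonpos hh _) (GG1_nonpos hh _)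
  have e3 : ∀ x ∈ (Finset.univ.erase i).erase j, GG v h ((Pi.single i 1 + Pi.single j 1 : ι → ℕ) x) (w x) = gg v h (w x) := by
    intro x hx
    simp only [Finset.mem_erase] at hx
    have : (Pi.single i 1 + Pi.single j 1 : ι → ℕ) x = 0 := by simp [Pi.single_apply, hx.1, hx.2.1]
    rw [this, GG, iteratedDeriv_zero]
  rw [Finset.prod_congr rfl e3]
  have p0 : 0 ≤ ∏ x ∈ (Finset.univ.erase i).erase j, gg v h (w x) := Finset.prod_nonneg fun _ _ => gg_nonneg _
  have p1 : ∏ x ∈ (Finset.univ.erase i).erase j, gg v h (w x) ≤ 1 := Finset.prod_le_one (fun _ _ => gg_nonneg _) fun _ _ => gg_le_one _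
  refine ⟨mul_nonneg a p0, ?_⟩
  rw [neg_mul_neg]
  exact mul_le_of_le_one_right a p1

theorem berman (h : CG μ K) (h' : CG ν K') (hK : ∀ i j, K i j = K j i) (hK' : ∀ i j, K' i j = K' j i)
    (hd : ∀ i, K i i = 1) (hd' : ∀ i, K' i i = 1) {u hh : ℝ} (hu : 0 < u) (hh0 : 0 < hh) (e : ι → ι → ℝ)
    (he0 : ∀ i j, 0 ≤ e i j)
    (he : ∀ i j, K i j = K' i j ∨ (K' i j = 0 ∧ (0 < K i j → K i j < 1 ∧ 
      K i j * (1 / (1 - K i j)) * Real.exp (- u^2 / (1 + K i j)) ≤ e i j))) :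
    μ.real {w | ∀ i, w i ≤ u} ≤ ν.real {w | ∀ i, w i ≤ u + hh} + ∑ i, ∑ j, e i j := by
  have := h.isGaussian
  have := h'.isGaussian
  obtain ⟨B, hB⟩ := GG_bdd (v := u) hh0
  have hG := GG_hasDerivAt u hh
  have key := berman_abs (E := ∑ i, ∑ j, e i j) hG hB h h' hK hK' ?_
  · have s0 : 0 ≤ ∑ i, ∑ j, e i j := Finset.sum_nonneg fun i _ => Finset.sum_nonneg fun j _ => he0 i j
    have ms : ∀ x : ℝ, MeasurableSet {w : ι → ℝ | ∀ i, w i ≤ x} := by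
      intro x
      have : {w : ι → ℝ | ∀ i, w i ≤ x} = ⋂ i, {w | w i ≤ x} := by ext; simp
      rw [this]
      exact MeasurableSet.iInter fun i => measurableSet_le (by fun_prop) (by fun_prop)
    have dd : ∀ w : ι → ℝ, DD (GG u hh) 0 w = ∏ i, gg u hh (w i) := by
      intro w; simp [DD, GG]
    have lo : μ.real {w | ∀ i, w i ≤ u} ≤ ∫ w, DD (GG u hh) 0 w ∂μ := by
      rw [← integral_indicator_one (ms u)]
      refine integral_mono_of_nonneg (Eventually.of_forall fun w => ?_) (integrable_DD hG hB 0 (by simp)) (Eventually.of_forall fun w => ?_)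
      · exact indicator_nonneg (by simp) _
      · by_cases hw : w ∈ {w : ι → ℝ | ∀ i, w i ≤ u}
        · simp only [indicator_of_mem hw, Pi.one_apply]
          rw [dd, Finset.prod_eq_one]
          intro i _; exact gg_one hh0 (hw i)
        · simp only [indicator_of_notMem hw]
          rw [dd]; exact Finset.prod_nonneg fun _ _ => gg_nonneg _
    have hi : ∫ w, DD (GG u hh) 0 w ∂ν ≤ ν.real {w | ∀ i, w i ≤ u + hh} := by
      rw [← integral_indicator_one (ms (u+hh))]
      refine integral_mono_of_nonneg (Eventually.of_forall fun w => ?_) ?_ (Eventually.of_forall fun w => ?_)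
      · simp only [dd]; exact Finset.prod_nonneg fun _ _ => gg_nonneg _
      · exact (integrable_const (1:ℝ)).indicator (ms _)
      · by_cases hw : w ∈ {w : ι → ℝ | ∀ i, w i ≤ u + hh}
        · simp only [indicator_of_mem hw, Pi.one_apply]
          rw [dd]; exact Finset.prod_le_one (fun _ _ => gg_nonneg _) fun _ _ => gg_le_one _
        · simp only [indicator_of_notMem hw]
          rw [dd]
          simp only [mem_setOf_eq, not_forall, not_le] at hw
          obtain ⟨i, hi⟩ := hw
          rw [Finset.prod_eq_zero (Finset.mem_univ i) (gg_zero hh0 hi.le)]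
    linarith
  · intro p q hp hq hpq hpq1
    refine Finset.sum_le_sum fun i _ => Finset.sum_le_sum fun j _ => ?_
    rcases he i j with h1 | ⟨h1, h2⟩
    · rw [h1]; simpa using he0 i j
    by_cases hpos : 0 < K i j
    · obtain ⟨h3, h4⟩ := h2 hpos
      have hij : i ≠ j := by
        rintro rfl; rw [hd'] at h1; exact one_ne_zero h1
      rw [h1, sub_zero]
      have hm : CG (MM μ ν p q) _ := h.comb h' hp hq
      have hmg := hm.isGaussian
      have pb := pair_bound hm (fun i j => by rw [hK i j, hK' i j]) i j (s := p + q) (ρ := K i j) (v := u) hpq hpq1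
        (by simp only [hd, hd']; ring) (by simp only [hd, hd']; ring) (by rw [hK' j i, h1, hK j i]; positivity)
        (by rw [hK' j i, h1, hK j i]; nlinarith) h3 hu (f := fun x => - GG u hh 1 x) (GG_cont u hh 1).neg
        (fun x => neg_nonneg.2 (GG1_nonpos hh0 x)) (fun x hx => by rw [GG_out hh0 one_ne_zero (Or.inl hx), neg_zero])
        (B := B) (fun x => (neg_le_abs _).trans (hB 1 (by norm_num) x)) (GG1_integrable hh0).neg (GG1_integral hh0)
      refine le_trans ?_ h4
      rw [mul_assoc]
      refine mul_le_mul_of_nonneg_left (le_trans ?_ pb) hpos.le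
      refine integral_mono_of_nonneg (Eventually.of_forall fun w => (DD_pair hh0 hij w).1) ?_ (Eventually.of_forall fun w => (DD_pair hh0 hij w).2)
      have hc := GG_cont u hh 1
      refine Integrable.of_bound (C := B * B) (Continuous.aestronglyMeasurable (by fun_prop)) (Eventually.of_forall fun z => ?_)
      rw [neg_mul_neg, norm_mul]
      exact mul_le_mul (hB 1 (by norm_num) _) (hB 1 (by norm_num) _) (norm_nonneg _) ((abs_nonneg _).trans (hB 1 (by norm_num) 0))
    · have hij : i ≠ j := by
        rintro rfl; rw [hd'] at h1; exact one_ne_zero h1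
      rw [h1, sub_zero]
      push Not at hpos
      refine le_trans (mul_nonpos_of_nonpos_of_nonneg hpos ?_) (he0 i j)
      exact integral_nonneg fun w => (DD_pair hh0 hij w).1
end Berman
end UB

open MeasureTheory ProbabilityTheory Filter Set Topology
set_option linter.unusedSectionVars false
set_option linter.deprecated false
set_option linter.unusedSimpArgs false

namespace UB

section Proc
variable {Ω : Type*} [MeasurableSpace Ω] 

/-- regular version of a stationary centered Gaussian process. -/
structure SG (P : Measure Ω) (X : ℝ → Ω → ℝ) (r : ℝ → ℝ) : Prop where
  meas : ∀ t, Measurable (X t)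
  cont : ∀ ω, ContinuousOn (fun t => X t ω) (Ici 0)
  r0 : r 0 = 1
  cg : ∀ (n : ℕ) (t : Fin n → ℝ), (∀ i, 0 ≤ t i) →
    CG (P.map (fun ω i => X (t i) ω)) (fun i j => r |t i - t j|)

variable {P : Measure Ω} [IsProbabilityMeasure P] {X : ℝ → Ω → ℝ} {r : ℝ → ℝ}

lemma modification (hae : ∀ t, 0 ≤ t → AEMeasurable (X t) P)
    (hcont : ∀ᵐ ω ∂P, ContinuousOn (fun t => X t ω) (Ici 0)) :
    ∃ X' : ℝ → Ω → ℝ, (∀ t, Measurable (X' t)) ∧ (∀ ω, ContinuousOn (fun t => X' t ω) (Ici 0)) ∧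
      ∀ᵐ ω ∂P, ∀ t, 0 ≤ t → X' t ω = X t ω := by
  classical
  set T : ℕ × ℕ → ℝ := fun p => (p.1 : ℝ) / (p.2 + 1) with hT
  have hT0 : ∀ p, 0 ≤ T p := fun p => by positivity
  have h1 : ∀ᵐ ω ∂P, ContinuousOn (fun t => X t ω) (Ici 0) ∧ ∀ p, X (T p) ω = (hae (T p) (hT0 p)).mk _ ω := by
    refine hcont.and (ae_all_iff.2 fun p => (hae (T p) (hT0 p)).ae_eq_mk)
  set N := toMeasurable P {ω | ContinuousOn (fun t => X t ω) (Ici 0) ∧ ∀ p, X (T p) ω = (hae (T p) (hT0 p)).mk _ ω}ᶜ with hN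
  have hN0 : P N = 0 := by rw [hN, measure_toMeasurable]; exact h1
  have hNm : MeasurableSet N := measurableSet_toMeasurable _ _
  have hNs : ∀ ω, ω ∉ N → ContinuousOn (fun t => X t ω) (Ici 0) ∧ ∀ p, X (T p) ω = (hae (T p) (hT0 p)).mk _ ω := by
    intro ω hω
    by_contra hcon
    exact hω (subset_toMeasurable _ _ hcon)
  set X' : ℝ → Ω → ℝ := fun t ω => if ω ∈ N then 0 else X (max t 0) ω with hX'
  have hc : ∀ ω, ContinuousOn (fun t => X' t ω) (Ici 0) := by
    intro ω
    by_cases hω : ω ∈ N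
    · simp only [hX', hω, if_true]; exact continuousOn_const
    · simp only [hX', hω, if_false]
      refine (hNs ω hω).1.congr ?_
      intro t ht
      simp [max_eq_left (mem_Ici.1 ht)]
  refine ⟨X', fun t => ?_, hc, ?_⟩
  · wlog ht : 0 ≤ t generalizing t
    · have := this 0 le_rfl
      have e : X' t = X' 0 := by
        funext ω; simp [hX', max_eq_right (le_of_not_ge ht)]
      rw [e]; exact this
    have hp : ∀ p, Measurable (X' (T p)) := by
      intro p
      have : X' (T p) = fun ω => if ω ∈ N then 0 else (hae (T p) (hT0 p)).mk _ ω := by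
        funext ω
        by_cases hω : ω ∈ N
        · simp [hX', hω]
        · simp only [hX', hω, if_false, max_eq_left (hT0 p)]; exact (hNs ω hω).2 p
      rw [this]
      exact Measurable.ite hNm measurable_const (hae (T p) (hT0 p)).measurable_mk
    refine measurable_of_tendsto_metrizable (f := fun n : ℕ => X' (T (⌊t * (n+1)⌋₊, n))) (fun n => hp _) ?_
    rw [tendsto_pi_nhds]
    intro ω
    have lim : Tendsto (fun n : ℕ => T (⌊t * (n+1)⌋₊, n)) atTop (𝓝[Ici 0] t) := by
      refine tendsto_nhdsWithin_iff.2 ⟨?_, Eventually.of_forall fun n => hT0 _⟩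
      have h1 : Tendsto (fun n : ℕ => (n:ℝ) + 1) atTop atTop := tendsto_atTop_add_const_right _ _ tendsto_natCast_atTop_atTop
      exact (tendsto_nat_floor_mul_div_atTop ht).comp h1
    exact ((hc ω) t ht).tendsto.comp lim
  · have : ∀ᵐ ω ∂P, ω ∉ N := measure_eq_zero_iff_ae_notMem.1 hN0
    filter_upwards [this] with ω hω t ht
    simp [hX', hω, max_eq_left ht]

lemma integral_sq_gaussianReal (v : NNReal) : ∫ y, y ^ 2 ∂(gaussianReal 0 v) = v := by
  have hv := variance_fun_id_gaussianReal (μ := 0) (v := v)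
  rw [variance_eq_integral (by fun_prop)] at hv
  simpa only [integral_id_gaussianReal, sub_zero] using hv

lemma SG.mk' (hm : ∀ t, Measurable (X t)) (hc : ∀ ω, ContinuousOn (fun t => X t ω) (Ici 0))
    (hG : ∀ (n : ℕ) (c : Fin n → ℝ) (t : Fin n → ℝ), (∀ i, 0 ≤ t i) →
      Measure.map (fun ω => ∑ i, c i * X (t i) ω) P
        = gaussianReal 0 (Real.toNNReal (∑ i, ∑ j, c i * c j * r (|t i - t j|))))
    (hr : Tendsto r (𝓝[>] 0) (𝓝 1)) : SG P X r := by
  have L2 : ∀ (n : ℕ) (c : Fin n → ℝ) (t : Fin n → ℝ), (∀ i, 0 ≤ t i) →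
      ∫ ω, (∑ i, c i * X (t i) ω) ^ 2 ∂P = max (∑ i, ∑ j, c i * c j * r (|t i - t j|)) 0 := by
    intro n c t ht
    have : ∫ ω, (∑ i, c i * X (t i) ω) ^ 2 ∂P = ∫ y, y ^ 2 ∂(P.map (fun ω => ∑ i, c i * X (t i) ω)) := by
      rw [integral_map (Measurable.aemeasurable (by fun_prop)) (by fun_prop)]
    rw [this, hG n c t ht, integral_sq_gaussianReal, Real.coe_toNNReal']
  have one : ∀ t, 0 ≤ t → P.map (X t) = gaussianReal 0 (Real.toNNReal (r 0)) := by
    intro t ht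
    have := hG 1 (fun _ => 1) (fun _ => t) (fun _ => ht)
    simpa using this
  have m2 : ∀ t, 0 ≤ t → MemLp (X t) 2 P := by
    intro t ht
    have : MemLp id 2 (P.map (X t)) := by rw [one t ht]; exact memLp_id_gaussianReal 2
    exact (memLp_map_measure_iff (by fun_prop) (hm t).aemeasurable).1 this
  have sq1 : ∀ t, 0 ≤ t → ∫ ω, (X t ω)^2 ∂P = max (r 0) 0 := by
    intro t ht
    have := L2 1 (fun _ => 1) (fun _ => t) (fun _ => ht)
    simpa using this
  have sqp : ∀ s t, 0 ≤ s → 0 ≤ t → ∫ ω, (X s ω + X t ω)^2 ∂P = max (2 * r 0 + 2 * r |s - t|) 0 := by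
    intro s t hs ht
    have := L2 2 ![1, 1] ![s, t] (by intro i; fin_cases i <;> simpa)
    simp [Fin.sum_univ_two] at this
    rw [this, abs_sub_comm t s]; congr 1; ring
  have sqm : ∀ s t, 0 ≤ s → 0 ≤ t → ∫ ω, (X s ω - X t ω)^2 ∂P = max (2 * r 0 - 2 * r |s - t|) 0 := by
    intro s t hs ht
    have := L2 2 ![1, -1] ![s, t] (by intro i; fin_cases i <;> simpa)
    simp [Fin.sum_univ_two, ← sub_eq_add_neg] at this
    rw [this, abs_sub_comm t s]; congr 1; ring
  have imul : ∀ s t, 0 ≤ s → 0 ≤ t → Integrable (fun ω => X s ω * X t ω) P := fun s t hs ht =>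
    (m2 s hs).integrable_mul (m2 t ht)
  have ep : ∀ s t, 0 ≤ s → 0 ≤ t → ∫ ω, (X s ω + X t ω)^2 ∂P = 2 * max (r 0) 0 + 2 * ∫ ω, X s ω * X t ω ∂P := by
    intro s t hs ht
    have e : (fun ω => (X s ω + X t ω)^2) = fun ω => X s ω ^ 2 + X t ω ^ 2 + 2 * (X s ω * X t ω) := by funext ω; ring
    have i12 : Integrable (fun ω => X s ω ^ 2 + X t ω ^ 2) P := (m2 s hs).integrable_sq.add (m2 t ht).integrable_sq
    rw [e, integral_add i12 ((imul s t hs ht).const_mul 2),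
      integral_add (m2 s hs).integrable_sq (m2 t ht).integrable_sq, integral_const_mul, sq1 s hs, sq1 t ht]; ring
  have em : ∀ s t, 0 ≤ s → 0 ≤ t → ∫ ω, (X s ω - X t ω)^2 ∂P = 2 * max (r 0) 0 - 2 * ∫ ω, X s ω * X t ω ∂P := by
    intro s t hs ht
    have e : (fun ω => (X s ω - X t ω)^2) = fun ω => X s ω ^ 2 + X t ω ^ 2 - 2 * (X s ω * X t ω) := by funext ω; ring
    have i12 : Integrable (fun ω => X s ω ^ 2 + X t ω ^ 2) P := (m2 s hs).integrable_sq.add (m2 t ht).integrable_sq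
    rw [e, integral_sub i12 ((imul s t hs ht).const_mul 2),
      integral_add (m2 s hs).integrable_sq (m2 t ht).integrable_sq, integral_const_mul, sq1 s hs, sq1 t ht]; ring
  -- r 0 > 0
  have hr0 : 0 < r 0 := by
    by_contra hneg
    push Not at hneg
    have zero : ∀ t, 0 ≤ t → X t =ᵐ[P] 0 := by
      intro t ht
      have h0 := sq1 t ht
      rw [max_eq_right hneg, integral_eq_zero_iff_of_nonneg (fun ω => sq_nonneg _) (m2 t ht).integrable_sq] at h0
      filter_upwards [h0] with ω hω
      simpa using hω
    obtain ⟨δ, hδ, hδr⟩ : ∃ δ > 0, ∀ t, 0 < t → t < δ → 1/2 < r t := by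
      have := hr.eventually (lt_mem_nhds (by norm_num : (1/2:ℝ) < 1))
      rw [eventually_nhdsWithin_iff] at this
      obtain ⟨δ, hδ, h⟩ := Metric.eventually_nhds_iff.1 this
      exact ⟨δ, hδ, fun t ht ht2 => h (by simpa [abs_of_pos ht] using ht2) ht⟩
    obtain ⟨n, hn⟩ := exists_nat_gt (2 - 2 * r 0)
    have hn0 : (0:ℝ) < n := by linarith
    have hL := L2 n (fun _ => 1) (fun i => (i:ℝ) * (δ / (n+1))) (fun i => by positivity)
    have hz : ∫ ω, (∑ i : Fin n, 1 * X ((i:ℝ) * (δ / (n+1))) ω) ^ 2 ∂P = 0 := by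
      have : (fun ω => (∑ i : Fin n, 1 * X ((i:ℝ) * (δ / (n+1))) ω) ^ 2) =ᵐ[P] 0 := by
        have := ae_all_iff.2 (fun i : Fin n => zero ((i:ℝ) * (δ / (n+1))) (by positivity))
        filter_upwards [this] with ω hω
        simp at hω
        simp [hω]
      rw [integral_congr_ae this]; simp
    rw [hz] at hL
    have h2 : ∑ i : Fin n, ∑ j : Fin n, (1:ℝ) * 1 * r |(i:ℝ) * (δ / (n+1)) - (j:ℝ) * (δ / (n+1))|
        ≥ ∑ i : Fin n, ∑ j : Fin n, (1/2 + if i = j then (r 0 - 1/2) else 0) := by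
      refine Finset.sum_le_sum fun i _ => Finset.sum_le_sum fun j _ => ?_
      by_cases hij : i = j
      · subst hij; simp
      · simp only [hij, if_false]
        have e : (i:ℝ) * (δ / (n+1)) - (j:ℝ) * (δ / (n+1)) = ((i:ℝ) - j) * (δ / (n+1)) := by ring
        rw [e, abs_mul, abs_of_pos (by positivity : 0 < δ / (n+1))]
        have hne : (i:ℝ) - j ≠ 0 := by
          rw [sub_ne_zero]; exact_mod_cast fun h => hij (Fin.ext h)
        have hle : |(i:ℝ) - j| ≤ n := by
          have := i.2.le; have := j.2.le
          have a : (i:ℝ) ≤ n := by exact_mod_cast i.2.le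
          have b : (j:ℝ) ≤ n := by exact_mod_cast j.2.le
          have a' : (0:ℝ) ≤ (i:ℝ) := by positivity
          have b' : (0:ℝ) ≤ (j:ℝ) := by positivity
          rw [abs_le]; constructor <;> linarith
        have := hδr (|(i:ℝ) - j| * (δ / (n+1))) (mul_pos (abs_pos.2 hne) (by positivity)) (by
          calc |(i:ℝ) - j| * (δ / (n+1)) ≤ n * (δ / (n+1)) := by gcongr
            _ < δ := by
              rw [← mul_div_assoc, div_lt_iff₀ (by positivity)]; nlinarith)
        linarith
    simp only [Finset.sum_add_distrib, Finset.sum_ite_eq, Finset.mem_univ, if_true, Finset.sum_const, Finset.card_univ, Fintype.card_fin, nsmul_eq_mul] at h2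
    have h3 : (0:ℝ) < ↑n * (↑n * (1 / 2)) + ↑n * (r 0 - 1 / 2) := by nlinarith
    have h4 := le_max_left (∑ i : Fin n, ∑ j : Fin n, (1:ℝ) * 1 * r |(i:ℝ) * (δ / (n+1)) - (j:ℝ) * (δ / (n+1))|) 0
    linarith
  have hrle : ∀ s t, 0 ≤ s → 0 ≤ t → |r (|s - t|)| ≤ r 0 := by
    intro s t hs ht
    have h1 := ep s t hs ht
    have h2 := em s t hs ht
    rw [sqp s t hs ht] at h1
    rw [sqm s t hs ht] at h2
    rw [max_eq_left hr0.le] at h1 h2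
    rw [abs_le]
    by_contra hcon
    rcases max_cases (2 * r 0 + 2 * r |s - t|) 0 with ⟨a, b⟩ | ⟨a, b⟩ <;>
    rcases max_cases (2 * r 0 - 2 * r |s - t|) 0 with ⟨a', b'⟩ | ⟨a', b'⟩ <;> rw [a] at h1 <;> rw [a'] at h2 <;>
    · apply hcon; constructor <;> linarith
  have hr1 : r 0 = 1 := by
    have law : ∀ s t, 0 ≤ s → 0 ≤ t → P.map (fun ω => X s ω - X t ω) = gaussianReal 0 (Real.toNNReal (2 * r 0 - 2 * r |s - t|)) := by
      intro s t hs ht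
      have := hG 2 ![1, -1] ![s, t] (by intro i; fin_cases i <;> simpa)
      simp [Fin.sum_univ_two, ← sub_eq_add_neg] at this
      rw [this, abs_sub_comm t s]; congr 2; ring
    have cf : ∀ n : ℕ, ∫ ω, Complex.exp ((X (1/(n+1)) ω - X 0 ω : ℝ) * Complex.I) ∂P
        = Complex.exp (-((r 0 - r (1/(n+1)) : ℝ) : ℂ)) := by
      intro n
      have hp : (0:ℝ) < 1/((n:ℝ)+1) := by positivity
      have h1 := charFun_gaussianReal (μ := 0) (v := Real.toNNReal (2 * r 0 - 2 * r |1/((n:ℝ)+1) - 0|)) 1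
      rw [← law _ _ hp.le le_rfl, charFun_apply_real, integral_map (Measurable.aemeasurable (by have := hm; fun_prop)) (by fun_prop)] at h1
      have hle := hrle _ _ hp.le le_rfl
      simp only [sub_zero, abs_of_pos hp] at h1 hle
      rw [Real.coe_toNNReal _ (by linarith [(abs_le.1 hle).2])] at h1
      simp only [Complex.ofReal_one, one_mul] at h1
      rw [h1]
      congr 1
      push_cast; ring
    have t0 : Tendsto (fun n : ℕ => (1:ℝ)/((n:ℝ)+1)) atTop (𝓝 0) := tendsto_one_div_add_atTop_nhds_zero_nat
    have l1 : Tendsto (fun n : ℕ => ∫ ω, Complex.exp ((X (1/(n+1)) ω - X 0 ω : ℝ) * Complex.I) ∂P) atTop (𝓝 (∫ ω, (1:ℂ) ∂P)) := by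
      refine tendsto_integral_of_dominated_convergence (fun _ => 1) (fun n => ?_) (integrable_const _) (fun n => Eventually.of_forall fun ω => ?_) (Eventually.of_forall fun ω => ?_)
      · exact Measurable.aestronglyMeasurable (by have := hm; fun_prop)
      · rw [Complex.norm_exp_ofReal_mul_I]
      · have h2 : Tendsto (fun n : ℕ => X (1/((n:ℝ)+1)) ω) atTop (𝓝 (X 0 ω)) := by
          have := ((hc ω) 0 (by simp)).tendsto
          refine this.comp (tendsto_nhdsWithin_iff.2 ⟨t0, Eventually.of_forall fun n => ?_⟩)
          simp only [mem_Ici]; positivity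
        have h3 : Continuous (fun x : ℝ => Complex.exp ((x - X 0 ω : ℝ) * Complex.I)) := by fun_prop
        have h4 := (h3.tendsto (X 0 ω)).comp h2
        simpa [Function.comp_def] using h4
    have l2 : Tendsto (fun n : ℕ => Complex.exp (-((r 0 - r (1/((n:ℝ)+1)) : ℝ) : ℂ))) atTop (𝓝 (Complex.exp (-((r 0 - 1 : ℝ) : ℂ)))) := by
      have h3 : Continuous (fun x : ℝ => Complex.exp (-((r 0 - x : ℝ) : ℂ))) := by fun_prop
      refine (h3.tendsto 1).comp (hr.comp (tendsto_nhdsWithin_iff.2 ⟨t0, Eventually.of_forall fun n => ?_⟩))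
      simp only [mem_Ioi]; positivity
    simp only [cf] at l1
    have := tendsto_nhds_unique l1 l2
    simp only [integral_const, probReal_univ, one_smul] at this
    have h5 : (1:ℝ) = Real.exp (-(r 0 - 1)) := by
      exact_mod_cast this
    have h6 := congrArg Real.log h5
    rw [Real.log_exp, Real.log_one] at h6
    linarith
  have cov : ∀ s t, 0 ≤ s → 0 ≤ t → ∫ ω, X s ω * X t ω ∂P = r |s - t| := by
    intro s t hs ht
    have h1 := em s t hs ht
    have := (abs_le.1 (hrle s t hs ht)).2
    rw [sqm s t hs ht, max_eq_left (by linarith), max_eq_left hr0.le] at h1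
    linarith
  refine ⟨hm, hc, hr1, fun n t ht => ?_⟩
  have psd : ∀ c : Fin n → ℝ, ∑ i, ∑ j, c i * c j * r |t i - t j| = ∫ ω, (∑ i, c i * X (t i) ω) ^ 2 ∂P := by
    intro c
    have e : (fun ω => (∑ i, c i * X (t i) ω) ^ 2) = fun ω => ∑ i, ∑ j, c i * c j * (X (t i) ω * X (t j) ω) := by
      funext ω
      rw [sq, Finset.sum_mul_sum]
      exact Finset.sum_congr rfl fun i _ => Finset.sum_congr rfl fun j _ => by ring
    rw [e, integral_finset_sum _ fun i _ => integrable_finset_sum _ fun j _ => (imul _ _ (ht i) (ht j)).const_mul _]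
    refine Finset.sum_congr rfl fun i _ => ?_
    rw [integral_finset_sum _ fun j _ => (imul _ _ (ht i) (ht j)).const_mul _]
    refine Finset.sum_congr rfl fun j _ => ?_
    rw [integral_const_mul, cov _ _ (ht i) (ht j)]
  refine ⟨fun c => ?_, fun c => ?_⟩
  · rw [psd]; exact integral_nonneg fun ω => sq_nonneg _
  · rw [Measure.map_map (by fun_prop) (by fun_prop)]
    exact hG n c t ht

/-- general index type. -/
lemma SG.cg' (h : SG P X r) {ι : Type*} [Fintype ι] (t : ι → ℝ) (ht : ∀ i, 0 ≤ t i) :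
    CG (P.map (fun ω i => X (t i) ω)) (fun i j => r |t i - t j|) := by
  have hm := h.meas
  set e := (Fintype.equivFin ι).symm with he
  have h1 := h.cg _ (fun i => t (e i)) (fun i => ht _)
  have q : ∀ c : ι → ℝ, ∑ i, ∑ j, c (e i) * c (e j) * r |t (e i) - t (e j)| = ∑ i, ∑ j, c i * c j * r |t i - t j| := by
    intro c
    rw [← e.sum_comp]
    refine Finset.sum_congr rfl fun i _ => ?_
    rw [← e.sum_comp]
  refine ⟨fun c => ?_, fun c => ?_⟩
  · rw [← q]; exact h1.1 (fun i => c (e i))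
  · have h2 := h1.2 (fun i => c (e i))
    rw [q] at h2
    rw [← h2, Measure.map_map (by fun_prop) (by fun_prop), Measure.map_map (by fun_prop) (by fun_prop)]
    congr 1
    funext ω
    simp only [Function.comp]
    rw [← e.sum_comp]

end Proc
end UB

open MeasureTheory ProbabilityTheory Filter Set Topology
set_option linter.unusedSectionVars false
set_option linter.deprecated false
set_option linter.unusedSimpArgs false

namespace UB

noncomputable def Psi (u : ℝ) : ℝ := (gaussianReal 0 1).real (Ioi u)

lemma Psi_nonneg (u : ℝ) : 0 ≤ Psi u := measureReal_nonneg

lemma Psi_anti : Antitone Psi := fun _ _ h => measureReal_mono (Ioi_subset_Ioi h)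

lemma gauss_tail {v : NNReal} {V x : ℝ} (hV : 0 < V) (hv : (v:ℝ) ≤ V) (hx : 0 ≤ x) :
    (gaussianReal 0 v).real (Ici x) ≤ Real.exp (- x^2 / (2 * V)) := by
  have h := measure_ge_le_exp_mul_mgf (μ := gaussianReal 0 v) (X := id) x (t := x / V) (by positivity) (by
    exact integrable_exp_mul_gaussianReal _)
  have e : {ω : ℝ | x ≤ id ω} = Ici x := rfl
  rw [e, mgf_id_gaussianReal] at h
  refine h.trans ?_
  simp only [zero_mul, zero_add]
  rw [← Real.exp_add]
  apply Real.exp_le_exp.2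
  have : (v:ℝ) * (x/V)^2 / 2 ≤ V * (x/V)^2/2 := by gcongr
  have e2 : V * (x/V)^2/2 = x^2/(2*V) := by field_simp
  have e3 : -(x/V) * x = - 2 * (x^2/(2*V)) := by field_simp
  rw [e3, neg_div]; linarith

lemma gauss_tail' {v : NNReal} {V x : ℝ} (hV : 0 < V) (hv : (v:ℝ) ≤ V) (hx : 0 ≤ x) :
    (gaussianReal 0 v).real (Iic (-x)) ≤ Real.exp (- x^2 / (2 * V)) := by
  have : gaussianReal 0 v = (gaussianReal 0 v).map (fun y => -y) := by
    rw [gaussianReal_map_neg, neg_zero]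
  rw [this, map_measureReal_apply measurable_neg measurableSet_Iic]
  have e : (fun y : ℝ => -y) ⁻¹' (Iic (-x)) = Ici x := by ext; simp
  rw [e]; exact gauss_tail hV hv hx

lemma Psi_le_exp {u : ℝ} (hu : 0 ≤ u) : Psi u ≤ Real.exp (-u^2/2) := by
  have := gauss_tail (v := 1) (V := 1) one_pos (by simp) hu
  rw [mul_one] at this
  exact (measureReal_mono Ioi_subset_Ici_self).trans this

lemma Psi_eq (u : ℝ) : Psi u = ∫ x in Ioi u, gaussianPDFReal 0 1 x := by
  unfold Psi
  rw [measureReal_def, gaussianReal_apply_eq_integral 0 (by simp), ENNReal.toReal_ofReal]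
  exact integral_nonneg fun x => gaussianPDFReal_nonneg _ _ _

lemma pdf_eq (x : ℝ) : gaussianPDFReal 0 1 x = (Real.sqrt (2 * Real.pi))⁻¹ * Real.exp (-x^2/2) := by
  simp [gaussianPDFReal]

lemma sqrt2pi_ge_one : 1 ≤ Real.sqrt (2 * Real.pi) := by
  rw [Real.one_le_sqrt]; nlinarith [Real.pi_gt_three]

/-- Mills upper bound. -/
lemma Psi_le {u : ℝ} (hu : 0 < u) : Psi u ≤ Real.exp (-u^2/2) / u := by
  rw [Psi_eq]
  have hd : ∀ x ∈ Ici u, HasDerivAt (fun x : ℝ => - Real.exp (-x^2/2) / u) (x / u * Real.exp (-x^2/2)) x := by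
    intro x _
    have h1 : HasDerivAt (fun x : ℝ => -x^2/2) (-x) x := by
      have := ((hasDerivAt_pow 2 x).neg).div_const 2
      refine this.congr_deriv ?_
      simp; ring
    have := (h1.exp.neg).div_const u
    refine this.congr_deriv ?_
    ring
  have hlim : Tendsto (fun x : ℝ => - Real.exp (-x^2/2) / u) atTop (𝓝 0) := by
    have h1 : Tendsto (fun x : ℝ => -x^2/2) atTop atBot := by
      have : Tendsto (fun x : ℝ => x^2/2) atTop atTop := (tendsto_pow_atTop two_ne_zero).atTop_div_const (by norm_num)
      have h2 := tendsto_neg_atTop_atBot.comp this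
      refine h2.congr fun x => ?_
      simp [neg_div]
    have := (((Real.tendsto_exp_atBot.comp h1).neg).div_const u)
    simpa using this
  have hInt := integrableOn_Ioi_deriv_of_nonneg' hd (fun x hx => by
    have : u < x := hx
    have : 0 < x := by linarith
    positivity) hlim
  have hval := integral_Ioi_of_hasDerivAt_of_tendsto' hd hInt hlim
  calc ∫ x in Ioi u, gaussianPDFReal 0 1 x ≤ ∫ x in Ioi u, x / u * Real.exp (-x^2/2) := by
        refine setIntegral_mono_on (integrable_gaussianPDFReal 0 1).integrableOn hInt measurableSet_Ioi fun x hx => ?_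
        rw [pdf_eq]
        refine mul_le_mul_of_nonneg_right ?_ (Real.exp_pos _).le
        have h1 : 1 ≤ x / u := (one_le_div hu).2 (le_of_lt hx)
        exact (inv_le_one_of_one_le₀ sqrt2pi_ge_one).trans h1
    _ = _ := by rw [hval]; ring

noncomputable def cP : ℝ := (Real.sqrt (2 * Real.pi))⁻¹ * Real.exp (-3/2)
lemma cP_pos : 0 < cP := by unfold cP; positivity

lemma Psi_ge {u : ℝ} (hu : 1 ≤ u) : cP * Real.exp (-u^2/2) / u ≤ Psi u := by
  have hu0 : 0 < u := by linarith
  rw [Psi_eq]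
  have hsub : Ioc u (u + 1/u) ⊆ Ioi u := fun x hx => hx.1
  calc cP * Real.exp (-u^2/2) / u = ∫ x in Ioc u (u+1/u), cP * Real.exp (-u^2/2) := by
        rw [setIntegral_const]; simp [measureReal_def]
        rw [ENNReal.toReal_ofReal (by positivity)]; ring
    _ ≤ ∫ x in Ioc u (u+1/u), gaussianPDFReal 0 1 x := by
        refine setIntegral_mono_on (integrable_const _) (integrable_gaussianPDFReal 0 1).integrableOn measurableSet_Ioc fun x hx => ?_
        rw [pdf_eq, cP, mul_assoc, ← Real.exp_add]
        gcongr
        have h1 : x ≤ u + 1/u := hx.2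
        have h2 : x^2 ≤ (u+1/u)^2 := by
          have : u < x := hx.1
          nlinarith
        have h3 : (u + 1/u)^2 = u^2 + 2 + (1/u)^2 := by field_simp; ring
        have h4 : (1/u)^2 ≤ 1 := by
          rw [div_pow, one_pow, div_le_one (by positivity)]; nlinarith
        linarith
    _ ≤ _ := by
        refine setIntegral_mono_set (integrable_gaussianPDFReal 0 1).integrableOn (Eventually.of_forall fun x => gaussianPDFReal_nonneg _ _ _) (HasSubset.Subset.eventuallyLE hsub)

lemma Psi_pos {u : ℝ} (hu : 1 ≤ u) : 0 < Psi u := by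
  have hu0 : 0 < u := by linarith
  refine lt_of_lt_of_le ?_ (Psi_ge hu)
  have := cP_pos
  positivity

lemma Psi_shift {c u : ℝ} (hc : 0 ≤ c) (hu : 1 ≤ u) (huc : 2 * c ≤ u^2) :
    Psi (u - c / u) ≤ (2 * Real.exp c / cP) * Psi u := by
  have hu0 : 0 < u := by linarith
  have hcp := cP_pos
  have h1 : u / 2 ≤ u - c/u := by
    have : c / u ≤ u / 2 := by rw [div_le_div_iff₀ hu0 two_pos]; nlinarith
    linarith
  have h2 : (0:ℝ) < u - c/u := by linarith
  calc Psi (u - c/u) ≤ Real.exp (-(u-c/u)^2/2) / (u - c/u) := Psi_le h2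
    _ ≤ (Real.exp c * Real.exp (-u^2/2)) / (u/2) := by
        gcongr
        rw [← Real.exp_add]
        apply Real.exp_le_exp.2
        have : (u - c/u)^2 = u^2 - 2 * c + (c/u)^2 := by field_simp; ring
        rw [this]; nlinarith [sq_nonneg (c/u)]
    _ = (2 * Real.exp c / cP) * (cP * Real.exp (-u^2/2) / u) := by field_simp
    _ ≤ _ := by
        refine mul_le_mul_of_nonneg_left (Psi_ge hu) (by positivity)

lemma exp_le_Psi : ∀ᶠ u : ℝ in atTop, Real.exp (-u^2) ≤ Psi u := by
  have h1 : Tendsto (fun u : ℝ => u ^ 1 * Real.exp (-u)) atTop (𝓝 0) := Real.tendsto_pow_mul_exp_neg_atTop_nhds_zero 1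
  have h2 := h1.eventually (gt_mem_nhds cP_pos)
  filter_upwards [h2, eventually_ge_atTop 2] with u hu hu2
  refine le_trans ?_ (Psi_ge (by linarith))
  rw [le_div_iff₀ (by linarith)]
  calc Real.exp (-u^2) * u = (u * Real.exp (-u^2/2)) * Real.exp (-u^2/2) := by
        rw [mul_assoc, ← Real.exp_add]
        have : -u^2/2 + -u^2/2 = -u^2 := by ring
        rw [this]; ring
    _ ≤ cP * Real.exp (-u^2/2) := by
        gcongr
        refine le_trans ?_ hu.le
        rw [pow_one]
        have : -u^2/2 ≤ -u := by nlinarith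
        gcongr

/-- exponential decay beats cubic. -/
lemma exp_cubic {k p : ℝ} (hk : 0 < k) (hp : 0 < p) : ∃ A > 0, ∀ x : ℝ, 1 ≤ x → Real.exp (-(k * x ^ p)) ≤ A * (x^3)⁻¹ := by
  obtain ⟨n, hn⟩ := exists_nat_gt (3 / p)
  refine ⟨n.factorial / k^n, by positivity, fun x hx => ?_⟩
  have hx0 : 0 < x := by linarith
  have h1 := Real.pow_div_factorial_le_exp (k * x^p) (by positivity) n
  rw [Real.exp_neg, ← div_eq_mul_inv, inv_le_comm₀ (Real.exp_pos _) (by positivity)]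
  refine le_trans ?_ h1
  rw [inv_div, mul_pow, div_div_eq_mul_div]
  rw [mul_comm (x^3)]
  have h3 : x^3 ≤ (x^p)^n := by
    rw [← Real.rpow_natCast, ← Real.rpow_natCast, ← Real.rpow_mul hx0.le]
    apply Real.rpow_le_rpow_of_exponent_le hx
    rw [div_lt_iff₀ hp] at hn
    push_cast; linarith
  gcongr

end UB

open MeasureTheory ProbabilityTheory Filter Set Topology
set_option linter.unusedSectionVars false
set_option linter.deprecated false
set_option linter.unusedSimpArgs false

namespace UB

section Pair2
variable {Ω : Type*} [MeasurableSpace Ω] {P : Measure Ω} [IsProbabilityMeasure P] {X : ℝ → Ω → ℝ} {r : ℝ → ℝ}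

lemma SG.pair (h : SG P X r) {s t y g D : ℝ} (hs : 0 ≤ s) (ht : 0 ≤ t) (hy : 0 < y) (hg : 0 < g) (hD : 0 < D)
    (hr1 : r |s - t| ≤ 1) (hrD : 1 - r |s - t| ≤ D) :
    P.real {ω | y < X t ω ∧ X s ω ≤ y - g} ≤ Psi y * Real.exp (- g^2 / (16 * D)) + Psi (g / (2 * D)) := by
  have hm := h.meas
  set ρ := r |s - t| with hρ
  have cg := h.cg' (ι := Bool) (fun b => if b then t else s) (by intro b; cases b <;> simp [hs, ht])
  set μ := P.map (fun ω (b : Bool) => X (if b then t else s) ω) with hμ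
  have := cg.isGaussian
  have hsym : ∀ i j : Bool, r |(if i then t else s) - (if j then t else s)| = r |(if j then t else s) - (if i then t else s)| := by
    intro i j; rw [abs_sub_comm]
  have e1 : P.real {ω | y < X t ω ∧ X s ω ≤ y - g} = μ.real {w | y < w true ∧ w false ≤ y - g} := by
    rw [hμ, map_measureReal_apply (by fun_prop)]
    · rfl
    · exact MeasurableSet.inter (s₁ := {w : Bool → ℝ | y < w true}) (s₂ := {w | w false ≤ y - g})
        (measurableSet_lt (by fun_prop) (by fun_prop)) (measurableSet_le (by fun_prop) (by fun_prop))
  rw [e1]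
  have sub : {w : Bool → ℝ | y < w true ∧ w false ≤ y - g} ⊆
      {w | y < w true ∧ w false - ρ * w true ≤ - (g/2)} ∪ {w | g / (2 * D) < w true} := by
    rintro w ⟨h1, h2⟩
    by_cases h3 : w false - ρ * w true ≤ - (g/2)
    · left; exact ⟨h1, h3⟩
    · right
      push Not at h3
      simp only [mem_setOf_eq]
      rw [div_lt_iff₀ (by positivity)]
      nlinarith
  refine (measureReal_mono sub).trans ((measureReal_union_le _ _).trans (add_le_add ?_ ?_))
  · have d := cg.decomp hsym true one_pos (by simp [h.r0])
    simp only [div_one, if_true] at d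
    rw [d, map_measureReal_apply (by fun_prop)]
    swap
    · exact MeasurableSet.inter (s₁ := {w : Bool → ℝ | y < w true}) (s₂ := {w | w false - ρ * w true ≤ - (g/2)})
        (measurableSet_lt (by fun_prop) (by fun_prop)) (measurableSet_le (by fun_prop) (by fun_prop))
    have e2 : (fun (z : ℝ × (Bool → ℝ)) (j : Bool) => r |(if j then t else s) - t| * z.1 + (z.2 j - r |(if j then t else s) - t| * z.2 true))
        ⁻¹' {w | y < w true ∧ w false - ρ * w true ≤ - (g/2)} = (Ioi y) ×ˢ {w | w false - ρ * w true ≤ -(g/2)} := by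
      ext ⟨z, w⟩
      simp [h.r0, ← hρ]
      intro _
      constructor <;> intro _ <;> linarith
    have e2' : ((gaussianReal 0 (Real.toNNReal 1)).prod μ).real (Ioi y ×ˢ {w : Bool → ℝ | w false - ρ * w true ≤ -(g/2)})
        ≤ Psi y * Real.exp (- g^2 / (16 * D)) := by
      rw [measureReal_prod_prod, Real.toNNReal_one]
      refine mul_le_mul_of_nonneg_left ?_ (Psi_nonneg _)
      have md := cg.map_diff hsym true false ρ
      have e3 : μ.real {w : Bool → ℝ | w false - ρ * w true ≤ -(g/2)} = (μ.map (fun w => w false - ρ * w true)).real (Iic (-(g/2))) := by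
        rw [map_measureReal_apply (by fun_prop) measurableSet_Iic]; rfl
      rw [e3, md]
      refine (gauss_tail' (V := 2 * D) (by positivity) ?_ (by positivity)).trans (le_of_eq ?_)
      · simp only [Bool.false_eq_true, if_false, if_true, sub_self, abs_zero, h.r0, ← hρ]
        rw [Real.coe_toNNReal']
        refine max_le ?_ (by positivity)
        nlinarith [sq_nonneg (1-ρ)]
      · congr 1; field_simp; norm_num
    rw [e2]; exact e2'
  · have me := cg.map_eval true
    simp only [if_true, sub_self, abs_zero, h.r0, Real.toNNReal_one] at me
    have e3 : μ.real {w : Bool → ℝ | g / (2 * D) < w true} = (μ.map (fun w => w true)).real (Ioi (g / (2 * D))) := by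
        rw [map_measureReal_apply (by fun_prop) measurableSet_Ioi]; rfl
    rw [e3, me]; rfl
end Pair2
end UB

open MeasureTheory ProbabilityTheory Filter Set Topology
set_option linter.unusedSectionVars false
set_option linter.deprecated false
set_option linter.unusedSimpArgs false

namespace UB

lemma level_bound {η κ D0 : ℝ} (hη : 0 < η) (hκ : 0 < κ) (hD0 : 0 < D0) :
    ∃ A > 0, ∃ x0 ≥ 1, ∃ u0 ≥ 2, ∀ x ≥ x0, ∀ u ≥ u0, ∀ y ≥ u - 1/u,
      Psi y * Real.exp (- (κ * x^(-η) / u)^2 / (16 * (D0 * x^(-(4*η)) / u^2))) + Psi ((κ * x^(-η) / u) / (2 * (D0 * x^(-(4*η)) / u^2)))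
        ≤ A * (x^3)⁻¹ * Psi u := by
  obtain ⟨A1, hA1, h1⟩ := exp_cubic (k := κ^2/(16 * D0)) (p := 2*η) (by positivity) (by positivity)
  obtain ⟨A2, hA2, h2⟩ := exp_cubic (k := (κ/(2*D0))^2/4) (p := 6*η) (by positivity) (by positivity)
  obtain ⟨u1, hu1⟩ := eventually_atTop.1 exp_le_Psi
  have hlim : Tendsto (fun x : ℝ => (κ/(2*D0))^2 * x^(6*η)) atTop atTop :=
    (tendsto_rpow_atTop (by positivity)).const_mul_atTop (by positivity)
  obtain ⟨x1, hx1⟩ := eventually_atTop.1 (hlim.eventually_ge_atTop 4)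
  have hcp := cP_pos
  refine ⟨(2 * Real.exp 1 / cP) * A1 + A2, by positivity, max x1 1, le_max_right _ _, max u1 2, le_max_right _ _, ?_⟩
  intro x hx u hu y hy
  have hxx1 : x1 ≤ x := (le_max_left _ _).trans hx
  have hx1' : 1 ≤ x := (le_max_right _ _).trans hx
  have hx0 : 0 < x := by linarith
  have huu1 : u1 ≤ u := (le_max_left _ _).trans hu
  have hu2 : 2 ≤ u := (le_max_right _ _).trans hu
  have hu0 : 0 < u := by linarith
  have hΨ : 0 < Psi u := Psi_pos (by linarith)
  have e4 : x^(-(4*η)) = (x^η)⁻¹^4 := by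
    rw [Real.rpow_neg hx0.le, mul_comm, Real.rpow_mul hx0.le, inv_pow]; norm_cast
  have e1 : x^(-η) = (x^η)⁻¹ := Real.rpow_neg hx0.le _
  have e2 : x^(2*η) = (x^η)^2 := by rw [mul_comm, Real.rpow_mul hx0.le]; norm_cast
  have e6 : x^(6*η) = (x^η)^6 := by rw [mul_comm, Real.rpow_mul hx0.le]; norm_cast
  set w := x^η with hw
  have hw0 : 0 < w := by positivity
  have q1 : - (κ * x^(-η) / u)^2 / (16 * (D0 * x^(-(4*η)) / u^2)) = -((κ^2/(16*D0)) * x^(2*η)) := by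
    rw [e4, e1, e2]; field_simp
  have q2 : (κ * x^(-η) / u) / (2 * (D0 * x^(-(4*η)) / u^2)) = (κ/(2*D0)) * w^3 * u := by
    rw [e4, e1]; field_simp
  rw [q1, q2]
  have t1 : Psi y * Real.exp (-((κ^2/(16*D0)) * x^(2*η))) ≤ ((2 * Real.exp 1 / cP) * Psi u) * (A1 * (x^3)⁻¹) := by
    refine mul_le_mul ?_ (h1 x hx1') (Real.exp_pos _).le (by positivity)
    exact (Psi_anti hy).trans (Psi_shift zero_le_one (by linarith) (by nlinarith))
  have t2 : Psi ((κ/(2*D0)) * w^3 * u) ≤ Psi u * (A2 * (x^3)⁻¹) := by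
    have h4 := hx1 x hxx1
    have h5 := h2 x hx1'
    rw [e6] at h4 h5
    calc Psi ((κ/(2*D0)) * w^3 * u) ≤ Real.exp (-((κ/(2*D0)) * w^3 * u)^2/2) := Psi_le_exp (by positivity)
      _ ≤ Real.exp (-u^2 + -((κ/(2*D0))^2/4 * w^6)) := by
        apply Real.exp_le_exp.2
        have e : ((κ/(2*D0)) * w^3 * u)^2 = ((κ/(2*D0))^2 * w^6) * u^2 := by ring
        rw [e]
        set W := (κ/(2*D0))^2 * w^6 with hW
        have e' : (κ/(2*D0))^2/4 * w^6 = W/4 := by rw [hW]; ring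
        rw [e']
        have a1 : 4 * u^2 ≤ W * u^2 := by gcongr
        have a2 : W * 1 ≤ W * u^2 := by
          apply mul_le_mul_of_nonneg_left _ (by positivity); nlinarith
        linarith
      _ = Real.exp (-u^2) * Real.exp (-((κ/(2*D0))^2/4 * w^6)) := Real.exp_add _ _
      _ ≤ Psi u * (A2 * (x^3)⁻¹) := mul_le_mul (hu1 u huu1) h5 (Real.exp_pos _).le hΨ.le
  calc _ ≤ _ := add_le_add t1 t2
    _ = _ := by ring

lemma dyadic_approx {σ : ℝ} (h0 : 0 ≤ σ) (h1 : σ ≤ 1) (k : ℕ) : ∃ j : ℕ, j < 2^k ∧ |(j:ℝ) / 2^k - σ| ≤ 1 / 2^k := by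
  have hp : (0:ℝ) < 2^k := by positivity
  rcases h1.lt_or_eq with h | h
  · refine ⟨⌊σ * 2^k⌋₊, ?_, ?_⟩
    · rw [Nat.floor_lt (by positivity)]; push_cast; nlinarith
    · have a := Nat.floor_le (by positivity : 0 ≤ σ * 2^k)
      have b := Nat.lt_floor_add_one (σ * 2^k)
      have e : (⌊σ * 2^k⌋₊:ℝ) / 2^k - σ = (⌊σ * 2^k⌋₊ - σ * 2^k)/2^k := by field_simp
      rw [e, abs_div, abs_of_pos hp]
      gcongr
      rw [abs_le]; constructor <;> linarith
  · refine ⟨2^k - 1, Nat.sub_lt (by positivity) one_pos, ?_⟩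
    rw [Nat.cast_sub Nat.one_le_two_pow]
    push_cast
    rw [h]
    have e : ((2:ℝ)^k - 1)/2^k - 1 = -(1/2^k) := by field_simp; ring
    rw [e, abs_neg, abs_of_pos (by positivity)]

section Chain
variable {Ω : Type*} [MeasurableSpace Ω] {P : Measure Ω} [IsProbabilityMeasure P] {X : ℝ → Ω → ℝ} {r : ℝ → ℝ}

lemma chain_cover {u t b : ℝ} (hb : 0 < b) (ht : 0 ≤ t) {x : ℝ → ℝ} (hx : ContinuousOn x (Ici 0)) {L : ℕ → ℝ} (hL : ∀ k, L k ≤ u)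
    (hs : ∃ s ∈ Icc t (t+b), u < x s) (h0 : x t ≤ L 0) :
    ∃ k j : ℕ, j < 2^(k+1) ∧ L (k+1) < x (t + j * (b / 2^(k+1))) ∧ x (t + (j/2 : ℕ) * (b / 2^k)) ≤ L k := by
  obtain ⟨s, hs, hus⟩ := hs
  -- find a dyadic point above u
  have ex : ∃ k j : ℕ, j < 2^k ∧ u < x (t + j * (b / 2^k)) := by
    choose j hj hj2 using dyadic_approx (σ := (s - t)/b) (div_nonneg (by linarith [hs.1]) hb.le) ((div_le_one hb).2 (by linarith [hs.2]))
    have lim : Tendsto (fun k => t + j k * (b / 2^k)) atTop (𝓝[Ici 0] s) := by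
      refine tendsto_nhdsWithin_iff.2 ⟨?_, Eventually.of_forall fun k => ?_⟩
      · have l1 : Tendsto (fun k => (j k : ℝ) / 2^k - (s-t)/b) atTop (𝓝 0) := by
          refine squeeze_zero_norm hj2 ?_
          have := tendsto_pow_atTop_nhds_zero_of_lt_one (r := (1/2:ℝ)) (by norm_num) (by norm_num)
          refine this.congr fun k => ?_
          rw [one_div_pow]
        have l2 := ((l1.mul_const b).add_const s)
        simp only [zero_mul, zero_add] at l2
        refine l2.congr fun k => ?_
        field_simp; ring
      · simp only [mem_Ici]; positivity
    have hs0 : s ∈ Ici (0:ℝ) := by simp only [mem_Ici]; linarith [hs.1]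
    have := ((hx s hs0).tendsto.comp lim).eventually (lt_mem_nhds hus)
    obtain ⟨k, hk⟩ := this.exists
    exact ⟨k, j k, hj k, hk⟩
  obtain ⟨k, j, hj, hk⟩ := ex
  by_contra hcon
  push Not at hcon
  have : ∀ k j : ℕ, j < 2^k → x (t + j * (b / 2^k)) ≤ L k := by
    intro k
    induction k with
    | zero => intro j hj; simp at hj; subst hj; simpa using h0
    | succ k ih =>
      intro j hj
      by_contra h2
      push Not at h2
      have h3 := hcon k j hj h2
      have h4 := ih (j/2) (by rw [pow_succ] at hj; omega)
      linarith
  have := this k j hj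
  linarith [hL k]

theorem chaining (h : SG P X r) {α D0 t0 : ℝ} (hα : 0 < α) (hD0 : 0 < D0) (ht0 : 0 < t0)
    (hr1 : ∀ t, 0 ≤ t → r t ≤ 1) (hD : ∀ t, 0 < t → t ≤ t0 → 1 - r t ≤ D0 * t^α) :
    ∃ K > 0, ∃ a0 > 0, a0 ≤ 1 ∧ ∃ u0 ≥ 2, ∀ a, 0 < a → a ≤ a0 → ∀ u ≥ u0, ∀ t ≥ 0,
      P.real {ω | (∃ s ∈ Icc t (t + a * u^(-(2/α))), u < X s ω) ∧ X t ω ≤ u - a^(α/4)/u} ≤ K * a^3 * Psi u := by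
  set η := α/4 with hη
  have hη0 : 0 < η := by positivity
  have hκ : 0 < (2:ℝ)^η - 1 := by
    have := Real.one_lt_rpow (by norm_num : (1:ℝ) < 2) hη0; linarith
  set κ := (2:ℝ)^η - 1 with hκd
  obtain ⟨A, hA, x0, hx0, u0, hu0, lb⟩ := level_bound hη0 hκ hD0
  refine ⟨A, hA, min (1/x0) (min t0 1), by positivity, (min_le_right _ _).trans (min_le_right _ _), u0, hu0, ?_⟩
  intro a ha haa u hu t ht
  have hu2 : 2 ≤ u := by linarith
  have hu' : 0 < u := by linarith
  have hx0' : 0 < x0 := by linarith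
  have ha1 : a ≤ 1 := haa.trans ((min_le_right _ _).trans (min_le_right _ _))
  have hat : a ≤ t0 := haa.trans ((min_le_right _ _).trans (min_le_left _ _))
  have hax : x0 ≤ 1/a := by
    rw [le_div_iff₀ ha, mul_comm, ← le_div_iff₀ hx0']; exact haa.trans (min_le_left _ _)
  have hΨ : 0 < Psi u := Psi_pos (by linarith)
  set b := a * u^(-(2/α)) with hb
  have hb0 : 0 < b := by positivity
  have hub : u^(-(2/α)) ≤ 1 := Real.rpow_le_one_of_one_le_of_nonpos (by linarith) (by simp; positivity)
  have hbt : b ≤ t0 := by rw [hb]; nlinarith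
  set L : ℕ → ℝ := fun k => u - (2^k/a)^(-η)/u with hL
  have hxk : ∀ k : ℕ, 1/a ≤ 2^k/a := fun k => by gcongr; exact one_le_pow₀ (by norm_num)
  set bad : ℕ → ℕ → Set Ω := fun k j => {ω | L (k+1) < X (t + j * (b / 2^(k+1))) ω ∧ X (t + (j/2 : ℕ) * (b / 2^k)) ω ≤ L k} with hbad
  have one_le : 1 ≤ 1/a := by rw [le_div_iff₀ ha]; linarith
  have Lge : ∀ k, u - 1/u ≤ L k := by
    intro k
    simp only [hL]
    gcongr
    exact Real.rpow_le_one_of_one_le_of_nonpos (one_le.trans (hxk k)) (by linarith)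
  have bound : ∀ k j, j < 2^(k+1) → P.real (bad k j) ≤ A * ((2^(k+1)/a)^3)⁻¹ * Psi u := by
    intro k j _
    set x : ℝ := 2^(k+1)/a with hx
    have hxpos : 0 < x := by positivity
    have exk : (2^k/a : ℝ) = x / 2 := by rw [hx, pow_succ]; ring
    have eL : L k = L (k+1) - κ * x^(-η)/u := by
      simp only [hL]
      rw [← hx, exk, Real.div_rpow hxpos.le (by norm_num), Real.rpow_neg (by norm_num : (0:ℝ) ≤ 2), hκd]
      field_simp; ring
    rcases Nat.even_or_odd' j with ⟨i, hi | hi⟩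
    · have : bad k j = ∅ := by
        ext ω
        simp only [hbad, mem_setOf_eq, mem_empty_iff_false, iff_false, not_and, not_le]
        intro h1
        have e : (t + ((j/2 : ℕ):ℝ) * (b / 2^k)) = t + j * (b / 2^(k+1)) := by
          rw [hi, Nat.mul_div_cancel_left _ two_pos, pow_succ]; push_cast; field_simp
        rw [e]
        have : 0 < κ * x^(-η)/u := by positivity
        linarith
      rw [this]; simp; positivity
    · have e : |(t + ((j/2 : ℕ):ℝ) * (b / 2^k)) - (t + j * (b / 2^(k+1)))| = x⁻¹ * u^(-(2/α)) := by
        have : j / 2 = i := by omega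
        rw [this, hi, pow_succ]; push_cast
        have : t + (i:ℝ) * (b / 2 ^ k) - (t + (2 * i + 1) * (b / (2 ^ k * 2))) = -(b/(2^(k+1))) := by
          rw [pow_succ]; field_simp; ring
        rw [this, abs_neg, abs_of_pos (by positivity), hb, hx]; field_simp
      have dle : x⁻¹ * u^(-(2/α)) ≤ t0 := by
        have : x⁻¹ ≤ a := by
          rw [inv_le_comm₀ hxpos ha, ← one_div]; exact hxk (k+1)
        calc _ ≤ a * 1 := by gcongr
          _ ≤ t0 := by linarith
      have hDD : (x⁻¹ * u^(-(2/α)))^α = x^(-(4*η)) / u^2 := by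
        rw [Real.mul_rpow (by positivity) (by positivity), ← Real.rpow_mul hu'.le, Real.inv_rpow hxpos.le, ← Real.rpow_neg hxpos.le]
        have e1 : -(2/α) * α = -2 := by field_simp
        have e2 : 4 * η = α := by rw [hη]; ring
        rw [e1, e2, Real.rpow_neg hu'.le]; norm_cast
      have pr := h.pair (s := t + ((j/2 : ℕ):ℝ) * (b / 2^k)) (t := t + j * (b / 2^(k+1))) (y := L (k+1)) (g := κ * x^(-η)/u)
        (D := D0 * x^(-(4*η)) / u^2) (by positivity) (by positivity) (by
          have := Lge (k+1)
          have : 1/u ≤ 1 := by rw [div_le_one hu']; linarith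
          linarith) (by positivity) (by positivity) (hr1 _ (abs_nonneg _)) (by
          rw [e, mul_div_assoc, ← hDD]; exact hD _ (by positivity) dle)
      rw [← eL] at pr
      exact pr.trans (lb x (hax.trans (hxk (k+1))) u hu _ (Lge (k+1)))
  have cover : {ω | (∃ s ∈ Icc t (t + b), u < X s ω) ∧ X t ω ≤ u - a^η/u} ⊆ ⋃ k, ⋃ j ∈ Finset.range (2^(k+1)), bad k j := by
    rintro ω ⟨h1, h2⟩
    have hl0 : L 0 = u - a^η/u := by
      simp only [hL, pow_zero, one_div]; rw [Real.rpow_neg (by positivity), Real.inv_rpow ha.le, inv_inv]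
    obtain ⟨k, j, hj, h3⟩ := chain_cover (L := L) hb0 ht (h.cont ω) (fun k => by
      simp only [hL]; have : 0 ≤ (2^k/a)^(-η)/u := by positivity
      linarith) h1 (by rw [hl0]; exact h2)
    simp only [mem_iUnion, Finset.mem_range]
    exact ⟨k, j, hj, h3⟩
  have lev : ∀ k, P (⋃ j ∈ Finset.range (2^(k+1)), bad k j) ≤ ENNReal.ofReal ((1/2)^(k+1) * (A * a^3 * Psi u)) := by
    intro k
    calc P (⋃ j ∈ Finset.range (2^(k+1)), bad k j) ≤ ∑ j ∈ Finset.range (2^(k+1)), P (bad k j) := measure_biUnion_finset_le _ _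
      _ ≤ ∑ j ∈ Finset.range (2^(k+1)), ENNReal.ofReal (A * ((2^(k+1)/a)^3)⁻¹ * Psi u) := by
          refine Finset.sum_le_sum fun j hj => ?_
          rw [← ofReal_measureReal]
          exact ENNReal.ofReal_le_ofReal (bound k j (Finset.mem_range.1 hj))
      _ = ENNReal.ofReal (2^(k+1) * (A * ((2^(k+1)/a)^3)⁻¹ * Psi u)) := by
          rw [Finset.sum_const, Finset.card_range, nsmul_eq_mul, ENNReal.ofReal_mul (p := 2^(k+1)) (by positivity)]
          congr 1
          rw [ENNReal.ofReal_pow (by norm_num)]; norm_num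
      _ ≤ _ := by
          apply ENNReal.ofReal_le_ofReal
          have : (2:ℝ)^(k+1) * (A * ((2^(k+1)/a)^3)⁻¹ * Psi u) = ((2:ℝ)^(k+1))⁻¹^2 * (A * a^3 * Psi u) := by
            field_simp
          rw [this]
          have h1 : ((2:ℝ)^(k+1))⁻¹ ≤ 1 := inv_le_one_of_one_le₀ (one_le_pow₀ (by norm_num))
          have h2 : 0 < ((2:ℝ)^(k+1))⁻¹ := by positivity
          have h3 : ((2:ℝ)^(k+1))⁻¹^2 ≤ (1/2:ℝ)^(k+1) := by
            rw [one_div, inv_pow (2:ℝ)]; nlinarith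
          exact mul_le_mul_of_nonneg_right h3 (by positivity)
  have tot : P {ω | (∃ s ∈ Icc t (t + b), u < X s ω) ∧ X t ω ≤ u - a^η/u} ≤ ENNReal.ofReal (A * a^3 * Psi u) := by
    refine (measure_mono cover).trans ((measure_iUnion_le _).trans ((ENNReal.tsum_le_tsum lev).trans ?_))
    have hs : Summable (fun k : ℕ => (1/2:ℝ)^(k+1) * (A * a^3 * Psi u)) := by
      refine Summable.mul_right _ ?_
      exact (summable_nat_add_iff 1).2 summable_geometric_two
    rw [← ENNReal.ofReal_tsum_of_nonneg (fun k => by positivity) hs]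
    apply ENNReal.ofReal_le_ofReal
    rw [tsum_mul_right]
    have : ∑' k : ℕ, (1/2:ℝ)^(k+1) = 1 := by
      simp_rw [pow_succ]; rw [tsum_mul_right, tsum_geometric_two]; norm_num
    rw [this, one_mul]
  rw [measureReal_def]
  exact ENNReal.toReal_le_of_le_ofReal (by positivity) tot

end Chain
end UB

open MeasureTheory ProbabilityTheory Filter Set Topology
set_option linter.unusedSectionVars false
set_option linter.deprecated false
set_option linter.unusedSimpArgs false

namespace UB

lemma gauss_Icc_le {a b : ℝ} (ha : 0 ≤ a) :
    gaussianReal 0 1 (Icc a b) ≤ gaussianPDF 0 1 a * ENNReal.ofReal (b - a) := by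
  rw [gaussianReal_apply 0 one_ne_zero]
  calc ∫⁻ x in Icc a b, gaussianPDF 0 1 x ≤ ∫⁻ x in Icc a b, gaussianPDF 0 1 a := by
        refine setLIntegral_mono (by fun_prop) fun x hx => ?_
        unfold gaussianPDF gaussianPDFReal
        apply ENNReal.ofReal_le_ofReal
        simp only [sub_zero, NNReal.coe_one, mul_one]
        have := hx.1
        gcongr
    _ = _ := by rw [setLIntegral_const, Real.volume_Icc]

lemma le_gauss_Icc {a b : ℝ} (ha : 0 ≤ a) :
    gaussianPDF 0 1 b * ENNReal.ofReal (b - a) ≤ gaussianReal 0 1 (Icc a b) := by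
  rw [gaussianReal_apply 0 one_ne_zero]
  calc _ = ∫⁻ x in Icc a b, gaussianPDF 0 1 b := by rw [setLIntegral_const, Real.volume_Icc]
    _ ≤ ∫⁻ x in Icc a b, gaussianPDF 0 1 x := by
        refine setLIntegral_mono (by fun_prop) fun x hx => ?_
        unfold gaussianPDF gaussianPDFReal
        apply ENNReal.ofReal_le_ofReal
        simp only [sub_zero, NNReal.coe_one, mul_one]
        have := hx.1
        have := hx.2
        have : 0 ≤ x := by linarith
        gcongr

lemma reg1 {ι : Type*} (κ y : ι → ℝ) (hκ1 : ∀ j, 1/2 ≤ κ j) (hκ2 : ∀ j, κ j ≤ 1) {u γ : ℝ}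
    (hu : 2 ≤ u) (hγ : 0 < γ) (hγ1 : γ ≤ 1/10) :
    gaussianReal 0 1 {z | 1 < z ∧ (∃ j, u - γ/u < κ j * z + y j) ∧ ∀ j, κ j * z + y j ≤ u + γ/u}
      ≤ ENNReal.ofReal (16 * γ) * gaussianReal 0 1 {z | ∃ j, u - 2/u < κ j * z + y j} := by
  have hu0 : 0 < u := by linarith
  set A := {z : ℝ | 1 < z ∧ (∃ j, u - γ/u < κ j * z + y j) ∧ ∀ j, κ j * z + y j ≤ u + γ/u} with hA
  rcases A.eq_empty_or_nonempty with h0 | ⟨z1, h1, ⟨j1, hj1⟩, h3⟩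
  · rw [h0]; simp
  set d := γ/u with hd
  have hd0 : 0 < d := by positivity
  have hdu : d * u = γ := by rw [hd]; field_simp
  set v := 1/u with hv
  have hv0 : 0 < v := by positivity
  have hv1 : v ≤ 1/2 := by rw [hv]; gcongr
  have hdv : d ≤ v / 10 := by rw [hd, hv, div_div, div_le_div_iff₀ (by positivity) (by positivity)]; nlinarith
  have sub : A ⊆ Icc (z1 - 4*d) (z1 + 4*d) := by
    rintro z ⟨-, ⟨j, hj⟩, hz⟩
    constructor
    · have a := h3 j
      have b := hκ1 j
      by_contra hc
      push Not at hc
      nlinarith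
    · have a := hz j1
      have b := hκ1 j1
      by_contra hc
      push Not at hc
      nlinarith
  have sub2 : Icc (z1 - 4*d - v/2) (z1 - 4*d) ⊆ {z | ∃ j, u - 2/u < κ j * z + y j} := by
    rintro z ⟨hz1, hz2⟩
    refine ⟨j1, ?_⟩
    have e : 2/u = 2 * v := by rw [hv]; ring
    rw [e]
    have b := hκ1 j1
    have b2 := hκ2 j1
    nlinarith
  have l1 := (measure_mono sub).trans (gauss_Icc_le (a := z1 - 4*d) (b := z1+4*d) (by linarith))
  have l2 := (le_gauss_Icc (a := z1 - 4*d - v/2) (b := z1 - 4*d) (by linarith)).trans (measure_mono sub2)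
  refine l1.trans (le_trans ?_ (mul_le_mul_right l2 _))
  rw [mul_left_comm, ← ENNReal.ofReal_mul (by positivity)]
  gcongr
  have : z1 - 4*d - (z1 - 4*d - v/2) = v/2 := by ring
  rw [this, ← hdu, hv]
  apply le_of_eq; field_simp; ring

section Reg
variable {Ω : Type*} [MeasurableSpace Ω] {P : Measure Ω} [IsProbabilityMeasure P] {X : ℝ → Ω → ℝ} {r : ℝ → ℝ}

lemma SG.reg (h : SG P X r) {ι : Type*} [Fintype ι] [DecidableEq ι] (i0 : ι) (t : ι → ℝ) (ht : ∀ i, 0 ≤ t i)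
    (hκ1 : ∀ j, 1/2 ≤ r |t j - t i0|) (hκ2 : ∀ j, r |t j - t i0| ≤ 1) {u γ : ℝ}
    (hu : 2 ≤ u) (hγ : 0 < γ) (hγ1 : γ ≤ 1/10) :
    P.real {ω | (∃ j, u - γ/u < X (t j) ω) ∧ ∀ j, X (t j) ω ≤ u + γ/u} ≤
      16 * γ * P.real {ω | ∃ j, u - 2/u < X (t j) ω} + P.real {ω | (∃ j, u - 2/u < X (t j) ω) ∧ X (t i0) ω ≤ 1} := by
  have hm := h.meas
  have cg := h.cg' t ht
  set μ := P.map (fun ω i => X (t i) ω) with hμ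
  have := cg.isGaussian
  have hsym : ∀ i j, r |t i - t j| = r |t j - t i| := by
    intro i j; rw [abs_sub_comm]
  have mE : ∀ c : ℝ, MeasurableSet {w : ι → ℝ | ∃ j, c < w j} := by
    intro c
    rw [show {w : ι → ℝ | ∃ j, c < w j} = ⋃ j, {w | c < w j} by ext; simp]
    exact MeasurableSet.iUnion fun j => measurableSet_lt (by fun_prop) (by fun_prop)
  have mA : ∀ c : ℝ, MeasurableSet {w : ι → ℝ | ∀ j, w j ≤ c} := by
    intro c
    rw [show {w : ι → ℝ | ∀ j, w j ≤ c} = ⋂ j, {w | w j ≤ c} by ext; simp]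
    exact MeasurableSet.iInter fun j => measurableSet_le (by fun_prop) (by fun_prop)
  have m1 : ∀ c : ℝ, MeasurableSet {w : ι → ℝ | c < w i0} := fun c => measurableSet_lt (by fun_prop) (by fun_prop)
  set S := {w : ι → ℝ | 1 < w i0 ∧ (∃ j, u - γ/u < w j) ∧ ∀ j, w j ≤ u + γ/u} with hS
  set B := {w : ι → ℝ | ∃ j, u - 2/u < w j} with hB
  have mS : MeasurableSet S := (m1 1).inter ((mE _).inter (mA _))
  have mB : MeasurableSet B := mE _
  have key : μ.real S ≤ 16 * γ * μ.real B := by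
    have d := cg.decomp hsym i0 one_pos (by simp [h.r0])
    simp only [div_one, Real.toNNReal_one] at d
    have F : Measurable (fun (z : ℝ × (ι → ℝ)) (j : ι) => r |t j - t i0| * z.1 + (z.2 j - r |t j - t i0| * z.2 i0)) := by fun_prop
    have k1 : μ S ≤ ENNReal.ofReal (16 * γ) * μ B := by
      rw [d, Measure.map_apply F mS, Measure.map_apply F mB, Measure.prod_apply_symm (F mS), Measure.prod_apply_symm (F mB), ← lintegral_const_mul']
      · refine lintegral_mono fun w => ?_
        have := reg1 (fun j => r |t j - t i0|) (fun j => w j - r |t j - t i0| * w i0) hκ1 hκ2 hu hγ hγ1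
        convert this using 2
        · ext z
          simp [hS, h.r0]
        · rfl
      · exact ENNReal.ofReal_ne_top
    rw [measureReal_def, measureReal_def]
    have := ENNReal.toReal_mono (ENNReal.mul_ne_top ENNReal.ofReal_ne_top (measure_ne_top _ _)) k1
    rwa [ENNReal.toReal_mul, ENNReal.toReal_ofReal (by positivity)] at this
  rw [hμ, map_measureReal_apply (by fun_prop) mS, map_measureReal_apply (by fun_prop) mB] at key
  refine le_trans (measureReal_mono ?_) ((measureReal_union_le _ _).trans (add_le_add_left key _))
  rintro ω ⟨⟨j, hj⟩, h2⟩
  by_cases h1 : 1 < X (t i0) ω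
  · left; exact ⟨h1, ⟨j, hj⟩, h2⟩
  · right; refine ⟨⟨j, lt_of_le_of_lt ?_ hj⟩, not_lt.1 h1⟩
    gcongr; linarith
end Reg
end UB

open MeasureTheory ProbabilityTheory Filter Set Topology
set_option linter.unusedSectionVars false
set_option linter.deprecated false
set_option linter.unusedSimpArgs false

namespace UB

section Cons
variable {Ω : Type*} [MeasurableSpace Ω] {P : Measure Ω} [IsProbabilityMeasure P] {X : ℝ → Ω → ℝ} {r : ℝ → ℝ}

lemma SG.single (h : SG P X r) {t : ℝ} (ht : 0 ≤ t) (u : ℝ) : P.real {ω | u < X t ω} = Psi u := by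
  have hm := h.meas
  have cg := h.cg' (ι := Unit) (fun _ => t) (fun _ => ht)
  have me := cg.map_eval ()
  simp only [sub_self, abs_zero, h.r0, Real.toNNReal_one] at me
  rw [Measure.map_map (by fun_prop) (by fun_prop)] at me
  unfold Psi
  rw [← me, map_measureReal_apply (by fun_prop) measurableSet_Ioi]
  rfl

set_option maxHeartbeats 1000000 in
theorem cons (h : SG P X r) {α D0 t0 : ℝ} (hα : 0 < α) (hD0 : 0 < D0) (ht0 : 0 < t0)
    (hr1 : ∀ t, 0 ≤ t → r t ≤ 1) (hD : ∀ t, 0 < t → t ≤ t0 → 1 - r t ≤ D0 * t^α) :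
    ∃ K > 0, ∃ a0 > 0, a0 ≤ 1 ∧ ∃ u0 ≥ 2,
      (∀ a, 0 < a → a ≤ a0 → ∀ u ≥ u0, ∀ t ≥ 0,
        P.real {ω | (∃ s ∈ Icc t (t + a * u^(-(2/α))), u < X s ω) ∧ X t ω ≤ u - a^(α/4)/u} ≤ K * a^3 * Psi u) ∧
      (∀ l, 0 ≤ l → ∀ u ≥ u0, ∀ t ≥ 0,
        P.real {ω | ∃ s ∈ Icc t (t + l), u < X s ω} ≤ K * (l * u^(2/α) + 1) * Psi u) ∧
      (∀ N : ℕ, 0 < N → ∀ a, 0 < a → N * a ≤ a0 → ∀ γ, 0 < γ → γ ≤ 1/10 → ∀ u ≥ u0, ∀ t ≥ 0,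
        P.real {ω | (∃ i < N, u - γ/u < X (t + i * (a * u^(-(2/α)))) ω) ∧
          ∀ i < N, X (t + i * (a * u^(-(2/α)))) ω ≤ u + γ/u} ≤ K * (γ + (N*a)^3) * Psi u) := by
  obtain ⟨K, hK, a0, ha0, ha01, u0, hu0, ch⟩ := chaining h hα hD0 ht0 hr1 hD
  have hcP := cP_pos
  set S := 2 * Real.exp 2 / cP with hS
  have hS0 : 0 < S := by positivity
  -- one-cell bound
  have cell : ∀ a, 0 < a → a ≤ a0 → ∀ u ≥ u0, ∀ t ≥ 0,
      P.real {ω | ∃ s ∈ Icc t (t + a * u^(-(2/α))), u < X s ω} ≤ (K + S) * Psi u := by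
    intro a ha haa u hu t ht
    have hu2 : 2 ≤ u := by linarith
    have hΨ : 0 < Psi u := Psi_pos (by linarith)
    have sub : {ω | ∃ s ∈ Icc t (t + a * u^(-(2/α))), u < X s ω} ⊆
        {ω | (∃ s ∈ Icc t (t + a * u^(-(2/α))), u < X s ω) ∧ X t ω ≤ u - a^(α/4)/u} ∪ {ω | u - 2/u < X t ω} := by
      intro ω hω
      by_cases h1 : X t ω ≤ u - a^(α/4)/u
      · left; exact ⟨hω, h1⟩
      · right
        push Not at h1
        refine lt_of_le_of_lt ?_ h1
        gcongr
        have : a^(α/4) ≤ 1 := Real.rpow_le_one ha.le (by linarith) (by positivity)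
        linarith
    refine (measureReal_mono sub).trans ((measureReal_union_le _ _).trans ?_)
    rw [add_mul, h.single ht]
    refine add_le_add ((ch a ha haa u hu t ht).trans ?_) (Psi_shift (by norm_num) (by linarith) (by nlinarith))
    have : a^3 ≤ 1 := pow_le_one₀ ha.le (by linarith)
    nlinarith [mul_pos hK hΨ]
  set a1 := min a0 t0 with ha1
  have ha1p : 0 < a1 := by positivity
  set K' := max K (max ((K+S)/a0 + (K+S)) (16*(K+S)*S + K*S)) with hK'
  have k1 : K ≤ K' := le_max_left _ _
  have k2 : (K+S)/a0 + (K+S) ≤ K' := (le_max_left _ _).trans (le_max_right _ _)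
  have k3 : 16*(K+S)*S + K*S ≤ K' := (le_max_right _ _).trans (le_max_right _ _)
  have hK'0 : 0 < K' := by linarith
  refine ⟨K', hK'0, a1, ha1p, (min_le_left _ _).trans ha01, max (u0+2) (2*D0), ?_, ?_, ?_, ?_⟩
  · have := le_max_left (u0+2) (2*D0); linarith
  · intro a ha haa u hu t ht
    have hu1 : u0 + 2 ≤ u := (le_max_left _ _).trans hu
    refine (ch a ha (haa.trans (min_le_left _ _)) u (by linarith) t ht).trans ?_
    have := Psi_nonneg u
    gcongr
  · intro l hl u hu t ht
    have hu1 : u0 + 2 ≤ u := (le_max_left _ _).trans hu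
    have hup : 0 < u := by linarith
    have hΨ := Psi_nonneg u
    set b := a0 * u^(-(2/α)) with hb
    have hb0 : 0 < b := by positivity
    have sub : {ω | ∃ s ∈ Icc t (t + l), u < X s ω} ⊆ ⋃ k ∈ Finset.range (⌊l/b⌋₊+1),
        {ω | ∃ s ∈ Icc (t + k * b) (t + k * b + b), u < X s ω} := by
      rintro ω ⟨s, hs, hsu⟩
      simp only [mem_iUnion, Finset.mem_range]
      have h0 : 0 ≤ (s-t)/b := div_nonneg (by linarith [hs.1]) hb0.le
      refine ⟨⌊(s-t)/b⌋₊, ?_, s, ⟨?_, ?_⟩, hsu⟩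
      · rw [Nat.lt_succ_iff]
        apply Nat.floor_le_floor
        gcongr; linarith [hs.2]
      · have := Nat.floor_le h0
        rw [le_div_iff₀ hb0] at this; linarith
      · have := Nat.lt_floor_add_one ((s-t)/b)
        rw [div_lt_iff₀ hb0] at this; nlinarith
    refine (measureReal_mono sub (measure_ne_top _ _)).trans ((measureReal_biUnion_finset_le _ _).trans ?_)
    calc _ ≤ ∑ k ∈ Finset.range (⌊l/b⌋₊+1), (K+S) * Psi u :=
          Finset.sum_le_sum fun k _ => cell a0 ha0 le_rfl u (by linarith) _ (by positivity)
      _ = (⌊l/b⌋₊+1) * ((K+S) * Psi u) := by simp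
      _ ≤ (l/b+1) * ((K+S) * Psi u) := by
          have : (⌊l/b⌋₊:ℝ) ≤ l/b := Nat.floor_le (by positivity)
          gcongr
      _ = ((K+S)/a0 * (l * u^(2/α)) + (K+S)) * Psi u := by
          rw [hb, Real.rpow_neg hup.le]; field_simp
      _ ≤ K' * (l * u^(2/α) + 1) * Psi u := by
          have : 0 ≤ l * u^(2/α) := by positivity
          have : 0 ≤ (K+S)/a0 := by positivity
          gcongr
          nlinarith
  · intro N hN a ha haN γ hγ hγ1 u hu t ht
    have hu1 : u0 + 2 ≤ u := (le_max_left _ _).trans hu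
    have hu2 : 2*D0 ≤ u := (le_max_right _ _).trans hu
    have hup : 0 < u := by linarith
    have hNp : (0:ℝ) < N := by exact_mod_cast hN
    set b := a * u^(-(2/α)) with hb
    have hb0 : 0 < b := by positivity
    set v := u - 2/u with hv
    have h2u : 2/u ≤ 1 := by rw [div_le_one hup]; linarith
    have h2u0 : 0 < 2/u := by positivity
    have hv0 : u0 ≤ v := by linarith
    have hub : u^(-(2/α)) ≤ 1 := Real.rpow_le_one_of_one_le_of_nonpos (by linarith) (by simp; positivity)
    have hvu : u^(-(2/α)) ≤ v^(-(2/α)) := Real.rpow_le_rpow_of_nonpos (by linarith) (by linarith) (by simp; positivity)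
    have sh : Psi v ≤ S * Psi u := Psi_shift (by norm_num) (by linarith) (by nlinarith)
    have ab : ∀ j : Fin N, |t + (j:ℕ) * b - (t + ((⟨0, hN⟩ : Fin N):ℕ) * b)| = (j:ℕ) * b := by
      intro j; simp [hb0.le]
    have jb : ∀ j : Fin N, (j:ℕ) * b ≤ N * a * u^(-(2/α)) := by
      intro j
      have : ((j:ℕ):ℝ) ≤ N := by exact_mod_cast j.2.le
      rw [hb, mul_assoc]; gcongr
    have hNa1 : N * a ≤ 1 := haN.trans ((min_le_left _ _).trans ha01)
    have hk1 : ∀ j : Fin N, 1/2 ≤ r |t + (j:ℕ) * b - (t + ((⟨0, hN⟩ : Fin N):ℕ) * b)| := by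
        intro j
        rw [ab]
        rcases Nat.eq_zero_or_pos (j:ℕ) with h0 | h0
        · rw [h0]; simp [h.r0]; norm_num
        have hj0 : (0:ℝ) < (j:ℕ) := by exact_mod_cast h0
        have hjb := jb j
        have d := hD ((j:ℕ) * b) (by positivity) (hjb.trans (by
          have : N * a ≤ t0 := haN.trans (min_le_right _ _)
          have : 0 < N * a := by positivity
          nlinarith))
        have : (((j:ℕ):ℝ) * b)^α ≤ (u^(-(2/α)))^α := by
          gcongr
          refine hjb.trans ?_
          have : 0 < u^(-(2/α)) := by positivity
          nlinarith
        rw [← Real.rpow_mul hup.le, show -(2/α)*α = -2 by field_simp, Real.rpow_neg hup.le] at this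
        have e2 : (u^(2:ℝ))⁻¹ = (u^2)⁻¹ := by norm_cast
        rw [e2] at this
        have : D0 * (((j:ℕ):ℝ) * b)^α ≤ D0 * (u^2)⁻¹ := by gcongr
        have : D0 * (u^2)⁻¹ ≤ 1/2 := by
          rw [← div_eq_mul_inv, div_le_div_iff₀ (by positivity) (by norm_num)]
          have : u ≤ u^2 := by nlinarith
          linarith
        linarith
    have rg := h.reg (ι := Fin N) ⟨0, hN⟩ (fun j => t + (j:ℕ) * b) (fun i => by positivity)
      hk1
      (fun j => hr1 _ (abs_nonneg _)) (u := u) (by linarith) hγ hγ1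
    have s1 : {ω | ∃ j : Fin N, v < X (t + (j:ℕ) * b) ω} ⊆ {ω | ∃ s ∈ Icc t (t + N * a * v^(-(2/α))), v < X s ω} := by
      rintro ω ⟨j, hj⟩
      refine ⟨_, ⟨?_, ?_⟩, hj⟩
      · have : 0 ≤ ((j:ℕ):ℝ) * b := by positivity
        linarith
      · have := jb j
        have : N * a * u^(-(2/α)) ≤ N * a * v^(-(2/α)) := by gcongr
        linarith
    have b1 := (measureReal_mono s1 (μ := P)).trans (cell (N*a) (by positivity) (haN.trans (min_le_left _ _)) v hv0 t ht)
    have b2 : P.real {ω | (∃ j : Fin N, v < X (t + (j:ℕ) * b) ω) ∧ X (t + ((⟨0, hN⟩ : Fin N):ℕ) * b) ω ≤ 1} ≤ K * (N*a)^3 * Psi v := by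
      refine le_trans (measureReal_mono ?_) (ch (N*a) (by positivity) (haN.trans (min_le_left _ _)) v hv0 t ht)
      rintro ω ⟨h1, h2⟩
      refine ⟨s1 h1, ?_⟩
      simp at h2
      refine h2.trans ?_
      have : (N*a)^(α/4) ≤ 1 := Real.rpow_le_one (by positivity) hNa1 (by positivity)
      have : (N*a)^(α/4)/v ≤ 1 := by
        rw [div_le_one (by linarith)]; linarith
      linarith
    have e1 : {ω | (∃ i < N, u - γ/u < X (t + i * b) ω) ∧ ∀ i < N, X (t + i * b) ω ≤ u + γ/u} =
        {ω | (∃ j : Fin N, u - γ/u < X (t + (j:ℕ) * b) ω) ∧ ∀ j : Fin N, X (t + (j:ℕ) * b) ω ≤ u + γ/u} := by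
      ext ω
      simp [Fin.exists_iff, Fin.forall_iff]
    rw [e1]
    refine rg.trans ?_
    have hΨ := Psi_nonneg u
    calc _ ≤ 16 * γ * ((K+S) * Psi v) + K * (N*a)^3 * Psi v := by gcongr
      _ ≤ 16 * γ * ((K+S) * (S * Psi u)) + K * (N*a)^3 * (S * Psi u) := by gcongr
      _ = (16*(K+S)*S * γ + K*S * (N*a)^3) * Psi u := by ring
      _ ≤ _ := by
          refine mul_le_mul_of_nonneg_right ?_ hΨ
          have : 0 < (N*a)^3 := by positivity
          have : 0 < K*S := by positivity
          have : 0 < 16*(K+S)*S := by positivity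
          nlinarith

end Cons
end UB

open MeasureTheory ProbabilityTheory Filter Set Topology
set_option linter.unusedSectionVars false
set_option linter.deprecated false
set_option linter.unusedSimpArgs false

namespace UB

section Qd
variable {Ω : Type*} [MeasurableSpace Ω] {P : Measure Ω} [IsProbabilityMeasure P] {X : ℝ → Ω → ℝ} {r : ℝ → ℝ}

set_option maxHeartbeats 1000000 in
theorem qdiff (h : SG P X r) {α D0 t0 : ℝ} (hα : 0 < α) (hD0 : 0 < D0) (ht0 : 0 < t0)
    (hr1 : ∀ t, 0 ≤ t → r t ≤ 1) (hD : ∀ t, 0 < t → t ≤ t0 → 1 - r t ≤ D0 * t^α) :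
    ∃ K > 0, ∃ a0 > 0, a0 ≤ 1 ∧ ∃ u0 ≥ 2,
      (∀ u ≥ u0, P.real {ω | ∃ s ∈ Icc (0:ℝ) 1, u < X s ω} ≤ K * (u^(2/α) * Psi u)) ∧
      (∀ ε : ℝ, 0 ≤ ε → ε ≤ 1 → ∀ N : ℕ, 0 < N → ∀ a : ℝ, 0 < a → N * a ≤ a0 → a^(α/4) ≤ 1/10 → ∀ u ≥ u0,
        P.real {ω | ∃ s ∈ Icc (0:ℝ) 1, u < X s ω} ≤
          P.real {ω | ∃ i : ℕ, i < ⌊(1-ε)/(N * (a * u^(-(2/α))))⌋₊ * N ∧ u + a^(α/4)/u < X (i * (a * u^(-(2/α)))) ω}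
          + K * Psi u * ((ε * u^(2/α) + 2) + a^2 * u^(2/α) + u^(2/α)/(N*a) * (a^(α/4) + (N*a)^3))) := by
  obtain ⟨K, hK, a0, ha0, ha01, u0, hu0, c1, c2, c3⟩ := cons h hα hD0 ht0 hr1 hD
  refine ⟨2*K, by positivity, a0, ha0, ha01, u0, hu0, ?_, ?_⟩
  · intro u hu
    have := c2 1 zero_le_one u hu 0 le_rfl
    rw [zero_add, one_mul] at this
    refine this.trans ?_
    have h1 : 1 ≤ u^(2/α) := Real.one_le_rpow (by linarith) (by positivity)
    have := Psi_nonneg u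
    have : K * (u^(2/α) + 1) * Psi u ≤ K * (u^(2/α) + u^(2/α)) * Psi u := by gcongr
    linarith
  intro ε hε hε1 N hN a ha haN hγ u hu
  have hup : 0 < u := by linarith
  have hNp : (0:ℝ) < N := by exact_mod_cast hN
  have hΨ := Psi_nonneg u
  have h1 : 1 ≤ u^(2/α) := Real.one_le_rpow (by linarith) (by positivity)
  set γ := a^(α/4) with hγd
  have hγ0 : 0 < γ := by positivity
  set b := a * u^(-(2/α)) with hb
  have hb0 : 0 < b := by positivity
  have hbL : b * u^(2/α) = a := by rw [hb, Real.rpow_neg hup.le]; field_simp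
  set M := ⌊(1-ε)/(N * b)⌋₊ with hM
  have hM1 : (M:ℝ) * (N*b) ≤ 1 - ε := by
    rw [← le_div_iff₀ (by positivity)]; exact Nat.floor_le (div_nonneg (by linarith) (by positivity))
  have hM2 : 1 - ε < (M+1) * (N*b) := by
    rw [← div_lt_iff₀ (by positivity)]; exact Nat.lt_floor_add_one _
  set T := (M:ℝ) * (N*b) with hT
  have hT0 : 0 ≤ T := by positivity
  set E1 := {ω | ∃ s ∈ Icc T (T + (1 - T)), u < X s ω} with hE1
  set E2 : ℕ → Set Ω := fun i => {ω | (∃ s ∈ Icc (i*b) (i*b + b), u < X s ω) ∧ X (i*b) ω ≤ u - γ/u} with hE2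
  set E3 : ℕ → Set Ω := fun k => {ω | (∃ i : ℕ, i < N ∧ u - γ/u < X (k*(N*b) + i * b) ω) ∧
          ∀ i < N, X (k*(N*b) + i * b) ω ≤ u + γ/u} with hE3
  have sub : {ω | ∃ s ∈ Icc (0:ℝ) 1, u < X s ω} ⊆ {ω | ∃ i : ℕ, i < M*N ∧ u + γ/u < X (i * b) ω} ∪
      (E1 ∪ ((⋃ i ∈ Finset.range (M*N), E2 i) ∪ ⋃ k ∈ Finset.range M, E3 k)) := by
    rintro ω ⟨s, hs, hsu⟩
    by_cases hsT : T ≤ s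
    · right; left; exact ⟨s, ⟨hsT, by linarith [hs.2]⟩, hsu⟩
    push Not at hsT
    set i := ⌊s/b⌋₊ with hi
    have hi1 : (i:ℝ)*b ≤ s := by
      rw [← le_div_iff₀ hb0]; exact Nat.floor_le (div_nonneg hs.1 hb0.le)
    have hi2 : s < (i+1)*b := by
      rw [← div_lt_iff₀ hb0]; exact Nat.lt_floor_add_one _
    have hiM : i < M*N := by
      have : (i:ℝ)*b < (M*N)*b := by rw [hT] at hsT; nlinarith
      have := lt_of_mul_lt_mul_right this hb0.le
      exact_mod_cast this
    by_cases hX : X (i*b) ω ≤ u - γ/u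
    · right; right; left
      simp only [mem_iUnion, Finset.mem_range]
      exact ⟨i, hiM, ⟨s, ⟨hi1, by linarith⟩, hsu⟩, hX⟩
    push Not at hX
    by_cases hB : ∃ i : ℕ, i < M*N ∧ u + γ/u < X (i * b) ω
    · left; exact hB
    push Not at hB
    right; right; right
    simp only [mem_iUnion, Finset.mem_range]
    have hdm := Nat.div_add_mod i N
    have ek : ∀ j : ℕ, ((i/N : ℕ):ℝ)*(N*b) + j * b = ((N * (i/N) + j : ℕ):ℝ) * b := by
      intro j; push_cast; ring
    have hk : i / N < M := Nat.div_lt_of_lt_mul (by rwa [mul_comm])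
    refine ⟨i / N, hk, ⟨i % N, Nat.mod_lt _ hN, ?_⟩, ?_⟩
    · rw [ek, hdm]; exact hX
    · intro j hj
      rw [ek]
      apply hB
      calc N * (i/N) + j < N * (i/N) + N := by omega
        _ = N * (i/N + 1) := by ring
        _ ≤ N * M := Nat.mul_le_mul_left _ hk
        _ = M * N := mul_comm _ _
  have B1 : P.real E1 ≤ K * (ε * u^(2/α) + 2) * Psi u := by
    refine (c2 (1-T) (by linarith) u hu T hT0).trans ?_
    have : (1-T) * u^(2/α) ≤ ε * u^(2/α) + 1 := by
      have e : N * b * u^(2/α) = N * a := by rw [mul_assoc, hbL]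
      have : (1-T) * u^(2/α) ≤ (ε + N*b) * u^(2/α) := by
        gcongr; linarith
      linarith
    exact mul_le_mul_of_nonneg_right (mul_le_mul_of_nonneg_left (by linarith) hK.le) hΨ
  have cnt : (M:ℝ) ≤ u^(2/α)/(N*a) := by
    rw [le_div_iff₀ (by positivity), ← hbL]
    have : T * u^(2/α) ≤ 1 * u^(2/α) := by gcongr; linarith
    rw [hT] at this; linarith
  have B2 : P.real (⋃ i ∈ Finset.range (M*N), E2 i) ≤ K * (a^2 * u^(2/α)) * Psi u := by
    refine (measureReal_biUnion_finset_le _ _).trans ?_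
    calc _ ≤ ∑ i ∈ Finset.range (M*N), K * a^3 * Psi u :=
          Finset.sum_le_sum fun i _ => c1 a ha (le_trans (by
            have : (1:ℝ) ≤ N := by exact_mod_cast hN
            nlinarith) haN) u hu (i*b) (by positivity)
      _ = M * N * (K * a^3 * Psi u) := by simp
      _ ≤ u^(2/α)/(N*a) * N * (K * a^3 * Psi u) := by gcongr
      _ = _ := by field_simp
  have B3 : P.real (⋃ k ∈ Finset.range M, E3 k) ≤ K * (u^(2/α)/(N*a) * (γ + (N*a)^3)) * Psi u := by
    refine (measureReal_biUnion_finset_le _ _).trans ?_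
    calc _ ≤ ∑ i ∈ Finset.range M, K * (γ + (N*a)^3) * Psi u :=
          Finset.sum_le_sum fun k _ => c3 N hN a ha haN γ hγ0 hγ u hu (k*(N*b)) (by positivity)
      _ = M * (K * (γ + (N*a)^3) * Psi u) := by simp
      _ ≤ u^(2/α)/(N*a) * (K * (γ + (N*a)^3) * Psi u) := by gcongr
      _ = _ := by ring
  refine (measureReal_mono sub (measure_ne_top _ _)).trans ((measureReal_union_le _ _).trans ?_)
  refine add_le_add le_rfl ?_
  refine (measureReal_union_le _ _).trans ?_
  have := measureReal_union_le (μ := P) (⋃ i ∈ Finset.range (M*N), E2 i) (⋃ k ∈ Finset.range M, E3 k)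
  have z : 0 ≤ K * ((ε * u^(2/α) + 2) + a^2 * u^(2/α) + u^(2/α)/(N*a) * (γ + (N*a)^3)) * Psi u := by positivity
  nlinarith
end Qd
end UB

open MeasureTheory ProbabilityTheory Filter Set Topology
set_option linter.unusedSectionVars false
set_option linter.deprecated false
set_option linter.unusedSimpArgs false

namespace UB

lemma CG.block {ι κ : Type*} [Fintype ι] [Fintype κ] [DecidableEq κ] {μ0 : Measure (ι → ℝ)} {K0 : ι → ι → ℝ}
    (h : CG μ0 K0) :
    CG ((Measure.pi (fun _ : κ => μ0)).map (fun W (p : κ × ι) => W p.1 p.2))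
      (fun p q => if p.1 = q.1 then K0 p.2 q.2 else 0) := by
  have := h.isGaussian
  have key : ∀ c : κ × ι → ℝ, ∑ p, ∑ q, c p * c q * (if p.1 = q.1 then K0 p.2 q.2 else 0)
      = ∑ k, ∑ i, ∑ j, c (k,i) * c (k,j) * K0 i j := by
    intro c
    rw [Fintype.sum_prod_type]
    refine Finset.sum_congr rfl fun k _ => Finset.sum_congr rfl fun i _ => ?_
    rw [Fintype.sum_prod_type, Finset.sum_comm]
    refine Finset.sum_congr rfl fun j _ => ?_
    simp
  have nn : ∀ c : κ × ι → ℝ, ∀ k, 0 ≤ ∑ i, ∑ j, c (k,i) * c (k,j) * K0 i j := fun c k => h.1 (fun i => c (k,i))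
  constructor
  · intro c
    rw [key]
    exact Finset.sum_nonneg fun k _ => nn c k
  · intro c
    rw [Measure.map_map (by fun_prop) (by fun_prop), key]
    have e : (fun x : κ × ι → ℝ => ∑ p, c p * x p) ∘ (fun (W : κ → ι → ℝ) (p : κ × ι) => W p.1 p.2)
        = fun W => ∑ k, (∑ i, c (k,i) * W k i) := by
      funext W; simp [Function.comp, Fintype.sum_prod_type]
    rw [e]
    have mF : Measurable (fun W : κ → ι → ℝ => ∑ k, (∑ i, c (k,i) * W k i)) := by fun_prop
    have := Measure.isProbabilityMeasure_map (μ := Measure.pi (fun _ : κ => μ0)) mF.aemeasurable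
    apply Measure.ext_of_charFun
    have ind := iIndepFun_pi (μ := fun _ : κ => μ0) (X := fun k (w : ι → ℝ) => ∑ i, c (k,i) * w i)
      (fun k => Measurable.aemeasurable (by fun_prop))
    rw [ind.charFun_map_fun_sum_eq_prod (fun k => Measurable.aemeasurable (by fun_prop))]
    funext t
    have each : ∀ k, (Measure.pi (fun _ : κ => μ0)).map (fun W => ∑ i, c (k,i) * W k i)
        = gaussianReal 0 (Real.toNNReal (∑ i, ∑ j, c (k,i) * c (k,j) * K0 i j)) := by
      intro k
      rw [← h.2 (fun i => c (k,i))]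
      conv_rhs => rw [← (measurePreserving_eval (fun _ : κ => μ0) k).map_eq]
      rw [Measure.map_map (by fun_prop) (by fun_prop)]
      rfl
    simp only [Finset.prod_apply, each, charFun_gaussianReal]
    rw [← Complex.exp_sum]
    congr 1
    simp only [Complex.ofReal_zero, mul_zero, zero_mul, zero_sub]
    rw [Finset.sum_neg_distrib, ← Finset.sum_div, ← Finset.sum_mul]
    congr 3
    have : ∀ v : ℝ, 0 ≤ v → ((v.toNNReal : ℝ) : ℂ) = v := fun v hv => by rw [Real.coe_toNNReal _ hv]
    rw [this _ (Finset.sum_nonneg fun k _ => nn c k), Complex.ofReal_sum]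
    exact Finset.sum_congr rfl fun k _ => this _ (nn c k)

lemma block_measure {ι κ : Type*} [Fintype ι] [Fintype κ] {μ0 : Measure (ι → ℝ)} [IsProbabilityMeasure μ0] (y : ℝ) :
    ((Measure.pi (fun _ : κ => μ0)).map (fun W (p : κ × ι) => W p.1 p.2)).real {w | ∀ p, w p ≤ y}
      = (μ0.real {w | ∀ i, w i ≤ y})^(Fintype.card κ) := by
  have mA : MeasurableSet {w : κ × ι → ℝ | ∀ j, w j ≤ y} := by
    rw [show {w : κ × ι → ℝ | ∀ j, w j ≤ y} = ⋂ j, {w | w j ≤ y} by ext; simp]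
    exact MeasurableSet.iInter fun j => measurableSet_le (by fun_prop) (by fun_prop)
  rw [map_measureReal_apply (by fun_prop) mA]
  have e : (fun (W : κ → ι → ℝ) (p : κ × ι) => W p.1 p.2) ⁻¹' {w | ∀ p, w p ≤ y} = Set.pi univ (fun _ => {w | ∀ i, w i ≤ y}) := by
    ext W; simp
  rw [e, measureReal_def, Measure.pi_pi, Finset.prod_const, ENNReal.toReal_pow, Finset.card_univ, measureReal_def]

section Bl
variable {Ω : Type*} [MeasurableSpace Ω] {P : Measure Ω} [IsProbabilityMeasure P] {X : ℝ → Ω → ℝ} {r : ℝ → ℝ}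

noncomputable def FF (r : ℝ → ℝ) (u d : ℝ) : ℝ := if 0 < r d then r d * (1/(1 - r d)) * Real.exp (-u^2/(1 + r d)) else 0

lemma FF_nonneg {d : ℝ} (u : ℝ) (hr : r d ≤ 1) : 0 ≤ FF r u d := by
  unfold FF
  split_ifs with h0
  · have : 0 ≤ 1 / (1 - r d) := one_div_nonneg.2 (by linarith)
    positivity
  · exact le_rfl

lemma nat_dist {k l : ℕ} {x y ε : ℝ} (hkl : k ≠ l) (hx : 0 ≤ x) (hy : 0 ≤ y) (hx1 : x ≤ 1 - ε) (hy1 : y ≤ 1 - ε) :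
    ε ≤ |((k:ℝ) + x) - (l + y)| := by
  rcases lt_or_gt_of_ne hkl with h | h
  · have : (k:ℝ) + 1 ≤ l := by exact_mod_cast h
    rw [abs_sub_comm]
    refine le_trans ?_ (le_abs_self _)
    linarith
  · have : (l:ℝ) + 1 ≤ k := by exact_mod_cast h
    refine le_trans ?_ (le_abs_self _)
    linarith

lemma SG.r_le_one (h : SG P X r) (hr2 : ∀ t, 0 < t → r t < 1) {t : ℝ} (ht : 0 ≤ t) : r t ≤ 1 := by
  rcases ht.eq_or_lt with h0 | h0
  · rw [← h0, h.r0]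
  · exact (hr2 t h0).le

theorem SG.block_bound (h : SG P X r) (hr2 : ∀ t, 0 < t → r t < 1) {n G : ℕ} {b u hh ε : ℝ} (hb : 0 < b) (hε : 0 < ε)
    (hG : ∀ i < G, (i:ℝ) * b ≤ 1 - ε) (hu : 0 < u) (hh0 : 0 < hh) :
    P.real {ω | ∀ k < n, ∀ i < G, X (k + i * b) ω ≤ u} ≤ (P.real {ω | ∀ i < G, X (i * b) ω ≤ u + hh})^n
      + ∑ p : Fin n × Fin G, ∑ q : Fin n × Fin G, if p.1 = q.1 then 0 else
          FF r u |((p.1:ℕ) + (p.2:ℕ) * b : ℝ) - ((q.1:ℕ) + (q.2:ℕ) * b)| := by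
  have hm := h.meas
  have mA : ∀ {ι : Type} [Fintype ι] (y : ℝ), MeasurableSet {w : ι → ℝ | ∀ j, w j ≤ y} := by
    intro ι _ y
    rw [show {w : ι → ℝ | ∀ j, w j ≤ y} = ⋂ j, {w | w j ≤ y} by ext; simp]
    exact MeasurableSet.iInter fun j => measurableSet_le (by fun_prop) (by fun_prop)
  have c1 := h.cg' (ι := Fin n × Fin G) (fun p => (p.1:ℕ) + (p.2:ℕ) * b) (fun p => by positivity)
  have c0 := h.cg' (ι := Fin G) (fun i => (i:ℕ) * b) (fun p => by positivity)
  have c2 := c0.block (κ := Fin n)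
  have := c0.isGaussian
  have bm := berman c1 c2 (fun p q => by rw [abs_sub_comm]) (fun p q => by simp only [eq_comm, abs_sub_comm])
    (fun p => by simp [h.r0]) (fun p => by simp [h.r0]) hu hh0
    (fun p q => if p.1 = q.1 then 0 else
          FF r u |((p.1:ℕ) + (p.2:ℕ) * b : ℝ) - ((q.1:ℕ) + (q.2:ℕ) * b)|)
    (by
      intro p q
      split_ifs
      · exact le_rfl
      · exact FF_nonneg u (h.r_le_one hr2 (abs_nonneg _)))
    (by
      intro p q
      by_cases hpq : p.1 = q.1
      · left; simp [hpq]
      · right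
        refine ⟨by simp [hpq], fun h0 => ⟨hr2 _ (lt_of_lt_of_le hε ?_), ?_⟩⟩
        · refine nat_dist (fun hc => hpq (Fin.ext hc)) (by positivity) (by positivity) (hG _ p.2.2) (hG _ q.2.2)
        · simp [hpq, FF, h0])
  rw [block_measure, map_measureReal_apply (by fun_prop) (mA _), map_measureReal_apply (by fun_prop) (mA _), Fintype.card_fin] at bm
  have e1 : {ω | ∀ k < n, ∀ i < G, X (k + i * b) ω ≤ u} = (fun ω (p : Fin n × Fin G) => X ((p.1:ℕ) + (p.2:ℕ) * b) ω) ⁻¹' {w | ∀ j, w j ≤ u} := by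
    ext ω; simp [Fin.forall_iff]
  have e2 : {ω | ∀ i < G, X (i * b) ω ≤ u + hh} = (fun ω (i : Fin G) => X ((i:ℕ) * b) ω) ⁻¹' {w | ∀ j, w j ≤ u + hh} := by
    ext ω; simp [Fin.forall_iff]
  rw [e1, e2]
  exact bm

lemma SG.r_mod (h : SG P X r) {s t : ℝ} (hs : 0 ≤ s) (ht : 0 ≤ t) : (r s - r t)^2 ≤ 2 - 2 * r |s - t| := by
  have c := (h.cg' (ι := Fin 3) ![0, s, t] (fun i => by fin_cases i <;> simp [hs, ht])).1 ![-(r s - r t), 1, -1]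
  simp [Fin.sum_univ_succ, h.r0, abs_of_nonneg hs, abs_of_nonneg ht, abs_sub_comm t s] at c
  nlinarith

lemma SG.delta (h : SG P X r) (hr : Tendsto r (𝓝[>] 0) (𝓝 1)) (hr2 : ∀ t, 0 < t → r t < 1)
    (hr0 : Tendsto r atTop (𝓝 0)) {ε : ℝ} (hε : 0 < ε) :
    ∃ δ, 0 < δ ∧ δ < 1 ∧ ∀ t, ε ≤ t → r t ≤ δ := by
  have hc : ContinuousOn r (Ici 0) := by
    intro t ht
    rw [ContinuousWithinAt, Metric.tendsto_nhdsWithin_nhds]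
    intro e he
    rw [Metric.tendsto_nhdsWithin_nhds] at hr
    obtain ⟨d, hd, H⟩ := hr (e^2/2) (by positivity)
    refine ⟨d, hd, fun s hs hst => ?_⟩
    rw [Real.dist_eq] at hst ⊢
    have m := h.r_mod hs ht
    rcases eq_or_ne s t with rfl | hne
    · simpa using he
    have := H (x := |s - t|) (by simpa [sub_eq_zero] using hne) (by simpa [Real.dist_eq] using hst)
    rw [Real.dist_eq, abs_lt] at this
    apply abs_lt_of_sq_lt_sq _ he.le
    linarith [this.1]
  obtain ⟨T, hT⟩ := eventually_atTop.1 (hr0.eventually (gt_mem_nhds (show (0:ℝ) < 1/2 by norm_num)))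
  obtain ⟨x, hx, hmax⟩ := (isCompact_Icc (a := ε) (b := max ε T)).exists_isMaxOn ⟨ε, by simp⟩
    (hc.mono (fun y hy => by simp only [mem_Ici]; linarith [hy.1]))
  refine ⟨max (1/2) (r x), by positivity, max_lt (by norm_num) (hr2 x (by linarith [hx.1])), fun t ht => ?_⟩
  rcases le_total t T with h1 | h1
  · exact le_trans (hmax ⟨ht, h1.trans (le_max_right _ _)⟩) (le_max_right _ _)
  · exact (hT t h1).le.trans (le_max_left _ _)
end Bl
end UB

open MeasureTheory ProbabilityTheory Filter Set Topology
set_option linter.unusedSectionVars false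
set_option linter.deprecated false
set_option linter.unusedSimpArgs false

namespace UB

section Sm
variable {Ω : Type*} [MeasurableSpace Ω] {P : Measure Ω} [IsProbabilityMeasure P] {X : ℝ → Ω → ℝ} {r : ℝ → ℝ}

lemma nat_dist2 {k l W : ℕ} {x y : ℝ} (hkl : ¬ (k ≤ l + W ∧ l ≤ k + W)) (hx : 0 ≤ x) (hy : 0 ≤ y) (hx1 : x ≤ 1) (hy1 : y ≤ 1) :
    (W:ℝ) ≤ |((k:ℝ) + x) - (l + y)| := by
  by_cases h : k ≤ l + W
  · have : (k:ℝ) + W + 1 ≤ l := by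
      have : k + W + 1 ≤ l := by omega
      exact_mod_cast this
    rw [abs_sub_comm]
    refine le_trans ?_ (le_abs_self _)
    linarith
  · have : (l:ℝ) + W + 1 ≤ k := by
      have : l + W + 1 ≤ k := by omega
      exact_mod_cast this
    refine le_trans ?_ (le_abs_self _)
    linarith

lemma sum_bound {n G W : ℕ} {b u ε A1 A2 : ℝ} (hb : 0 < b) (hε : 0 < ε)
    (hG : ∀ i < G, (i:ℝ) * b ≤ 1 - ε) (hA1 : 0 ≤ A1) (hA2 : 0 ≤ A2)
    (h1 : ∀ d, ε ≤ d → FF r u d ≤ A1) (h2 : ∀ d, ε ≤ d → (W:ℝ) ≤ d → FF r u d ≤ A2) :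
    ∑ p : Fin n × Fin G, ∑ q : Fin n × Fin G, (if p.1 = q.1 then 0 else
          FF r u |((p.1:ℕ) + (p.2:ℕ) * b : ℝ) - ((q.1:ℕ) + (q.2:ℕ) * b)|)
      ≤ n * G^2 * (2*W+1) * A1 + (n*G)^2 * A2 := by
  have pt : ∀ p q : Fin n × Fin G, (if p.1 = q.1 then 0 else
          FF r u |((p.1:ℕ) + (p.2:ℕ) * b : ℝ) - ((q.1:ℕ) + (q.2:ℕ) * b)|) ≤
        (if (p.1:ℕ) ≤ q.1 + W ∧ (q.1:ℕ) ≤ p.1 + W then A1 else 0) + A2 := by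
    intro p q
    by_cases hpq : p.1 = q.1
    · rw [if_pos hpq]; positivity
    rw [if_neg hpq]
    have hd := nat_dist (fun hc => hpq (Fin.ext hc)) (x := (p.2:ℕ) * b) (y := (q.2:ℕ)*b) (by positivity) (by positivity) (hG _ p.2.2) (hG _ q.2.2)
    split_ifs with hc
    · linarith [h1 _ hd]
    · rw [zero_add]
      exact h2 _ hd (nat_dist2 hc (by positivity) (by positivity) (by linarith [hG _ p.2.2]) (by linarith [hG _ q.2.2]))
  have inner : ∀ k : ℕ, ∑ l : Fin n, (if k ≤ l + W ∧ (l:ℕ) ≤ k + W then A1 else 0) ≤ (2*W+1) * A1 := by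
    intro k
    rw [Fin.sum_univ_eq_sum_range (fun l => if k ≤ l + W ∧ l ≤ k + W then A1 else 0), ← Finset.sum_filter, Finset.sum_const, nsmul_eq_mul]
    refine mul_le_mul_of_nonneg_right ?_ hA1
    have : ((Finset.range n).filter (fun l => k ≤ l + W ∧ l ≤ k + W)).card ≤ (Finset.Icc (k-W) (k+W)).card := by
      apply Finset.card_le_card
      intro l hl
      simp only [Finset.mem_filter, Finset.mem_range, Finset.mem_Icc] at hl ⊢
      omega
    rw [Nat.card_Icc] at this
    have : ((Finset.range n).filter (fun l => k ≤ l + W ∧ l ≤ k + W)).card ≤ 2*W+1 := by omega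
    exact_mod_cast this
  calc _ ≤ ∑ p : Fin n × Fin G, ∑ q : Fin n × Fin G, ((if (p.1:ℕ) ≤ q.1 + W ∧ (q.1:ℕ) ≤ p.1 + W then A1 else 0) + A2) :=
        Finset.sum_le_sum fun p _ => Finset.sum_le_sum fun q _ => pt p q
    _ ≤ ∑ p : Fin n × Fin G, (G * ((2*W+1) * A1) + n * G * A2) := by
        refine Finset.sum_le_sum fun p _ => ?_
        rw [Finset.sum_add_distrib]
        refine add_le_add ?_ (by simp)
        rw [Fintype.sum_prod_type, Finset.sum_comm]
        calc _ ≤ ∑ j : Fin G, (2*W+1) * A1 := Finset.sum_le_sum fun j _ => inner p.1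
          _ = _ := by simp
    _ = _ := by simp; ring

lemma FF_near {d u δ : ℝ} (hδ0 : 0 < δ) (hδ : δ < 1) (hr : r d ≤ δ) :
    FF r u d ≤ 1/(1-δ) * Real.exp (-u^2/(1+δ)) := by
  have : 0 < 1 - δ := by linarith
  unfold FF
  split_ifs with h0
  · have h1 : r d * (1/(1 - r d)) ≤ 1 * (1/(1-δ)) := by
      have : 0 ≤ 1/(1 - r d) := one_div_nonneg.2 (by linarith)
      gcongr; linarith
    rw [one_mul] at h1
    refine mul_le_mul h1 ?_ (Real.exp_pos _).le (by positivity)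
    rw [Real.exp_le_exp, neg_div, neg_div, neg_le_neg_iff]
    gcongr
  · positivity

lemma FF_far {d u δ τ : ℝ} (hδ0 : 0 < δ) (hδ : δ < 1) (hr : r d ≤ δ) (hu : 0 < u) (hτ : 0 < τ) (hr2 : r d ≤ τ / u^2) :
    FF r u d ≤ 1/(1-δ) * (τ / u^2 * Real.exp (-u^2) * Real.exp τ) := by
  have : 0 < 1 - δ := by linarith
  unfold FF
  split_ifs with h0
  · have h1 : r d * (1/(1 - r d)) ≤ τ/u^2 * (1/(1-δ)) := by
      have : 0 ≤ 1/(1 - r d) := one_div_nonneg.2 (by linarith)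
      gcongr
    have h2 : Real.exp (-u^2/(1+r d)) ≤ Real.exp (-u^2) * Real.exp τ := by
      rw [← Real.exp_add, Real.exp_le_exp, div_le_iff₀ (by linarith)]
      have : r d * u^2 ≤ τ := by rwa [le_div_iff₀ (by positivity)] at hr2
      nlinarith [mul_pos h0 hτ, mul_pos h0 h0, mul_nonneg h0.le (sub_nonneg.2 this)]
    calc _ ≤ τ/u^2 * (1/(1-δ)) * (Real.exp (-u^2) * Real.exp τ) := by gcongr
      _ = _ := by ring
  · positivity

set_option maxHeartbeats 1000000 in
theorem SG.berman_small (h : SG P X r) (hr : Tendsto r (𝓝[>] 0) (𝓝 1)) (hr2 : ∀ t, 0 < t → r t < 1)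
    (hA3 : Tendsto (fun t => r t * Real.log t) atTop (𝓝 0)) {α ε a C' τ : ℝ} (hα : 0 < α)
    (hε : 0 < ε) (hε1 : ε < 1) (ha : 0 < a) (hC' : 0 < C') (hτ : 0 < τ) :
    ∀ᶠ u in atTop, ∀ n G : ℕ, n * (u^(2/α) * Psi u) ≤ C' → G ≤ u^(2/α)/a → ∀ b > 0,
      (∀ i < G, (i:ℝ) * b ≤ 1 - ε) → ∀ hh > 0,
      P.real {ω | ∀ k < n, ∀ i < G, X (k + i * b) ω ≤ u} ≤ (P.real {ω | ∀ i < G, X (i * b) ω ≤ u + hh})^n + τ := by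
  have hr0 : Tendsto r atTop (𝓝 0) := by
    have := hA3.mul (tendsto_inv_atTop_zero.comp Real.tendsto_log_atTop)
    rw [zero_mul] at this
    refine this.congr' ?_
    filter_upwards [eventually_gt_atTop (1:ℝ)] with t ht
    have := Real.log_pos ht
    simp only [Function.comp]; field_simp
  obtain ⟨δ, hδ0, hδ1, hδ⟩ := h.delta hr hr2 hr0 hε
  have hδp : 0 < 1 - δ := by linarith
  have hcP := cP_pos
  set β := (1/(1+δ) - 1/2)/2 with hβ
  have hβ0 : 0 < β := by
    have : 1/2 < 1/(1+δ) := by gcongr; linarith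
    rw [hβ]; linarith
  set Cn := C'/cP * (5/a^2) * (1/(1-δ)) with hCn
  set Cf := (C'/(a*cP))^2 * (1/(1-δ)) with hCf
  have hCf0 : 0 < Cf := by positivity
  obtain ⟨τ1, hτ1, hτ1'⟩ : ∃ τ1 > 0, Cf * (τ1 * Real.exp τ1) ≤ τ/2 := by
    have : Tendsto (fun x : ℝ => Cf * (x * Real.exp x)) (𝓝[>] 0) (𝓝 0) := by
      have : Continuous (fun x : ℝ => Cf * (x * Real.exp x)) := by fun_prop
      simpa using (this.tendsto 0).mono_left nhdsWithin_le_nhds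
    obtain ⟨x, hx, hx0⟩ := ((this.eventually (gt_mem_nhds (half_pos hτ))).and self_mem_nhdsWithin).exists
    exact ⟨x, hx0, hx.le⟩
  -- near term tends to zero
  have near : Tendsto (fun u : ℝ => Cn * (u^(2/α) * u * Real.exp (-β * u^2))) atTop (𝓝 0) := by
    have : Tendsto (fun u : ℝ => Cn * (u^(2/α+1) * Real.exp (-β * u^(2:ℝ)))) atTop (𝓝 (Cn * 0)) := by
      refine Tendsto.const_mul _ ?_
      have l := (tendsto_rpow_mul_exp_neg_mul_atTop_nhds_zero ((2/α+1)/2) β hβ0).comp (tendsto_rpow_atTop (show (0:ℝ) < 2 by norm_num))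
      refine l.congr' ?_
      filter_upwards [eventually_gt_atTop 0] with u hu
      simp only [Function.comp]
      rw [← Real.rpow_mul hu.le]; congr 2; ring
    rw [mul_zero] at this
    refine this.congr' ?_
    filter_upwards [eventually_gt_atTop 0] with u hu
    rw [Real.rpow_add hu, Real.rpow_one]; norm_cast
  obtain ⟨T, hT⟩ := eventually_atTop.1 (hA3.eventually (gt_mem_nhds (show (0:ℝ) < τ1 * β by positivity)))
  have big : Tendsto (fun u : ℝ => Real.exp (β * u^2)) atTop atTop :=
    Real.tendsto_exp_atTop.comp (Tendsto.const_mul_atTop hβ0 (tendsto_pow_atTop two_ne_zero))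
  filter_upwards [near.eventually (gt_mem_nhds (half_pos hτ)), big.eventually_ge_atTop T, eventually_ge_atTop 1] with u hn hbT hu1
  intro n G hnC hGL b hb hG hh hh0
  have hu0 : 0 < u := by linarith
  have hL : 0 < u^(2/α) := by positivity
  refine (h.block_bound hr2 hb hε hG hu0 hh0).trans (add_le_add le_rfl ?_)
  set W := ⌊Real.exp (β * u^2)⌋₊ + 1 with hW
  have W1 : Real.exp (β*u^2) ≤ W := by rw [hW]; push_cast; exact (Nat.lt_floor_add_one _).le
  have W2 : (W:ℝ) ≤ 2 * Real.exp (β*u^2) := by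
    have : (⌊Real.exp (β * u^2)⌋₊:ℝ) ≤ Real.exp (β * u^2) := Nat.floor_le (Real.exp_pos _).le
    have : 1 ≤ Real.exp (β*u^2) := Real.one_le_exp (by positivity)
    rw [hW]; push_cast; linarith
  have e1 : 1 ≤ Real.exp (β*u^2) := Real.one_le_exp (by positivity)
  have sb := sum_bound (r := r) (n := n) (G := G) (W := W) (u := u) hb hε hG
    (A1 := 1/(1-δ) * Real.exp (-u^2/(1+δ))) (A2 := 1/(1-δ) * (τ1 / u^2 * Real.exp (-u^2) * Real.exp τ1))
    (by positivity) (by positivity) (fun d hd => FF_near hδ0 hδ1 (hδ d hd))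
    (fun d hd hWd => FF_far hδ0 hδ1 (hδ d hd) hu0 hτ1 (by
      have hed : Real.exp (β*u^2) ≤ d := W1.trans hWd
      have hlog : β*u^2 ≤ Real.log d := (Real.le_log_iff_exp_le (by linarith)).2 hed
      have := hT d (hbT.trans hed)
      have l0 : 0 < β * u^2 := by positivity
      rcases le_or_gt (r d) 0 with h0 | h0
      · exact h0.trans (by positivity)
      rw [le_div_iff₀ (by positivity)]
      have : r d * (β * u^2) ≤ r d * Real.log d := by gcongr
      have : (r d * u^2) * β ≤ τ1 * β := by linarith
      exact le_of_mul_le_mul_right this hβ0))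
  refine sb.trans ?_
  have hΨ : 0 < Psi u := Psi_pos hu1
  have hΨg := Psi_ge hu1
  have n1 : (n:ℝ) * u^(2/α) ≤ C'/cP * (u * Real.exp (u^2/2)) := by
    have : (n:ℝ) * u^(2/α) * (cP * Real.exp (-u^2/2)/u) ≤ C' := by
      refine le_trans ?_ hnC
      rw [← mul_assoc]; gcongr
    have e : C'/cP * (u * Real.exp (u^2/2)) = C' / (cP * Real.exp (-u^2/2)/u) := by
      rw [neg_div, Real.exp_neg]; field_simp
    rw [e, le_div_iff₀ (by positivity)]; exact this
  have t1 : n * G^2 * (2*W+1) * (1/(1-δ) * Real.exp (-u^2/(1+δ))) ≤ τ/2 := by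
    refine le_trans ?_ hn.le
    have ex : Real.exp (u^2/2) * (Real.exp (β*u^2) * Real.exp (-u^2/(1+δ))) = Real.exp (-β*u^2) := by
      rw [← Real.exp_add, ← Real.exp_add]; congr 1; rw [hβ]; field_simp; ring
    calc n * G^2 * (2*W+1) * (1/(1-δ) * Real.exp (-u^2/(1+δ)))
        ≤ n * (u^(2/α)/a)^2 * (5 * Real.exp (β*u^2)) * (1/(1-δ) * Real.exp (-u^2/(1+δ))) := by
          gcongr; linarith
      _ = (n * u^(2/α)) * (u^(2/α) * (5/a^2) * Real.exp (β*u^2) * (1/(1-δ) * Real.exp (-u^2/(1+δ)))) := by ring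
      _ ≤ (C'/cP * (u * Real.exp (u^2/2))) * (u^(2/α) * (5/a^2) * Real.exp (β*u^2) * (1/(1-δ) * Real.exp (-u^2/(1+δ)))) := by gcongr
      _ = Cn * (u^(2/α) * u * (Real.exp (u^2/2) * (Real.exp (β*u^2) * Real.exp (-u^2/(1+δ))))) := by rw [hCn]; ring
      _ = _ := by rw [ex]
  have t2 : (n*G:ℝ)^2 * (1/(1-δ) * (τ1 / u^2 * Real.exp (-u^2) * Real.exp τ1)) ≤ τ/2 := by
    refine le_trans ?_ hτ1'
    have nG : (n*G:ℝ) ≤ C'/(a*cP) * (u * Real.exp (u^2/2)) := by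
      calc (n*G:ℝ) ≤ n * (u^(2/α)/a) := by gcongr
        _ = (n * u^(2/α)) / a := by ring
        _ ≤ (C'/cP * (u * Real.exp (u^2/2)))/a := by gcongr
        _ = _ := by field_simp
    have ex : Real.exp (u^2/2)^2 * Real.exp (-u^2) = 1 := by
      rw [← Real.exp_nat_mul, ← Real.exp_add, Real.exp_eq_one_iff]; push_cast; ring
    calc _ ≤ (C'/(a*cP) * (u * Real.exp (u^2/2)))^2 * (1/(1-δ) * (τ1 / u^2 * Real.exp (-u^2) * Real.exp τ1)) := by gcongr
      _ = Cf * (τ1 * Real.exp τ1) * (Real.exp (u^2/2)^2 * Real.exp (-u^2)) := by rw [hCf]; field_simp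
      _ = _ := by rw [ex, mul_one]
  linarith
end Sm
end UB

open MeasureTheory ProbabilityTheory Filter Set Topology
set_option linter.unusedSectionVars false
set_option linter.deprecated false
set_option linter.unusedSimpArgs false

namespace UB

section Asm
variable {Ω : Type*} [MeasurableSpace Ω] {P : Measure Ω} [IsProbabilityMeasure P] {X : ℝ → Ω → ℝ} {r : ℝ → ℝ}

lemma R_tendsto (p : ℝ) : Tendsto (fun u : ℝ => u^p * Psi u) atTop (𝓝 0) := by
  have l : Tendsto (fun u : ℝ => u^p * Real.exp (-(1/2) * u^(2:ℝ))) atTop (𝓝 0) := by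
    have l := (tendsto_rpow_mul_exp_neg_mul_atTop_nhds_zero (p/2) (1/2) (by norm_num)).comp (tendsto_rpow_atTop (show (0:ℝ) < 2 by norm_num))
    refine l.congr' ?_
    filter_upwards [eventually_gt_atTop 0] with u hu
    simp only [Function.comp]
    rw [← Real.rpow_mul hu.le]; congr 2; ring
  refine squeeze_zero' ?_ ?_ l
  · filter_upwards [eventually_gt_atTop 0] with u hu
    have := Psi_nonneg u
    positivity
  · filter_upwards [eventually_gt_atTop 0] with u hu
    have := Psi_le_exp hu.le
    have e : -(1/2) * u^(2:ℝ) = -u^2/2 := by norm_cast; ring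
    rw [e]; gcongr

lemma exp_lower {q : ℝ} (h0 : 0 ≤ q) (h1 : q ≤ 1/2) : Real.exp (-(2*q)) ≤ 1 - q := by
  have : 1 + 2*q ≤ Real.exp (2*q) := by linarith [Real.add_one_le_exp (2*q)]
  rw [Real.exp_neg, inv_le_comm₀ (Real.exp_pos _) (by linarith)]
  refine le_trans ?_ this
  rw [inv_le_iff_one_le_mul₀ (by linarith)]
  nlinarith

lemma params {K σ a0 α : ℝ} (hK : 0 < K) (hσ : 0 < σ) (ha0 : 0 < a0) (hα : 0 < α) :
    ∃ ε : ℝ, 0 < ε ∧ ε < 1 ∧ ∃ N : ℕ, 0 < N ∧ ∃ a : ℝ, 0 < a ∧ N * a ≤ a0 ∧ a^(α/4) ≤ 1/10 ∧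
      K * (ε + a^2 + 1/(N*a) * (a^(α/4) + (N*a)^3)) ≤ σ * (4/5) := by
  set w := σ/(5*K) with hw
  have hw0 : 0 < w := by positivity
  have hwK : K * w = σ/5 := by rw [hw]; field_simp
  set a1 := min a0 (min w 1) with ha1
  have ha1p : 0 < a1 := by positivity
  have h1 : a1 ≤ w := (min_le_right _ _).trans (min_le_left _ _)
  have h2 : a1 ≤ 1 := (min_le_right _ _).trans (min_le_right _ _)
  have lim : Tendsto (fun N : ℕ => (a1/(N:ℝ))^(α/4)) atTop (𝓝 0) := by
    have l1 : Tendsto (fun N : ℕ => a1/(N:ℝ)) atTop (𝓝 0) := tendsto_const_div_atTop_nhds_zero_nat a1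
    have := l1.rpow_const (p := α/4) (Or.inr (by positivity))
    rwa [Real.zero_rpow (by positivity)] at this
  have m0 : 0 < min (1/10) (a1*w) := by positivity
  obtain ⟨N, hN, hN1⟩ := ((lim.eventually (gt_mem_nhds m0)).and (eventually_ge_atTop 1)).exists
  have hNp : (0:ℝ) < N := by exact_mod_cast hN1
  have hN1' : (1:ℝ) ≤ N := by exact_mod_cast hN1
  have hNa : N * (a1/N) = a1 := by field_simp
  refine ⟨min (1/2) w, by positivity, lt_of_le_of_lt (min_le_left _ _) (by norm_num), N, hN1, a1/N, by positivity, ?_, ?_, ?_⟩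
  · rw [hNa]; exact min_le_left _ _
  · exact hN.le.trans (min_le_left _ _)
  · rw [hNa]
    have g := hN.le.trans (min_le_right _ _)
    have b1 : min (1/2) w ≤ w := min_le_right _ _
    have sq : a1^2 ≤ w := by nlinarith
    have b2 : (a1/N)^2 ≤ w := by
      refine le_trans ?_ sq
      have : a1/N ≤ a1 := div_le_self ha1p.le hN1'
      gcongr
    have b3 : 1/a1 * ((a1/N)^(α/4) + a1^3) ≤ 2 * w := by
      calc _ ≤ 1/a1 * (a1 * w + a1^3) := by gcongr
        _ = w + a1^2 := by field_simp
        _ ≤ _ := by linarith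
    calc _ ≤ K * (w + w + 2*w) := by gcongr
      _ = σ*(4/5) := by linarith

set_option maxHeartbeats 1000000 in
theorem main_SG (h : SG P X r) {α D0 t0 C' : ℝ} (hα : 0 < α) (hD0 : 0 < D0) (ht0 : 0 < t0)
    (hD : ∀ t, 0 < t → t ≤ t0 → 1 - r t ≤ D0 * t^α)
    (hr : Tendsto r (𝓝[>] 0) (𝓝 1)) (hr2 : ∀ t, 0 < t → r t < 1)
    (hA3 : Tendsto (fun t => r t * Real.log t) atTop (𝓝 0)) (hC' : 0 < C') {δ : ℝ} (hδ : 0 < δ) :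
    ∀ᶠ u in atTop, ∀ n : ℕ, n * (u^(2/α) * Psi u) ≤ C' →
      P.real {ω | ∀ s ∈ Icc (0:ℝ) n, X s ω ≤ u} ≤ (P.real {ω | ∀ s ∈ Icc (0:ℝ) 1, X s ω ≤ u})^n * (1 + δ) := by
  have hm := h.meas
  obtain ⟨K, hK, a0, ha0, ha01, u0, hu0, Q1, Q2⟩ := qdiff h hα hD0 ht0 (fun t ht => h.r_le_one hr2 ht) hD
  obtain ⟨σ, hσ, hσ'⟩ : ∃ σ > 0, Real.exp (2 * σ * C') ≤ 1 + δ/2 := by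
    refine ⟨Real.log (1 + δ/2) / (2 * C'), div_pos (Real.log_pos (by linarith)) (by positivity), ?_⟩
    have : 2 * (Real.log (1 + δ/2) / (2 * C')) * C' = Real.log (1+δ/2) := by field_simp
    rw [this, Real.exp_log (by linarith)]
  obtain ⟨ε, hε, hε1, N, hN, a, ha, haN, hγ, hpar⟩ := params hK hσ ha0 hα
  set c0 := Real.exp (-(2*K*C')) with hc0
  have hc0p : 0 < c0 := Real.exp_pos _
  have hNp : (0:ℝ) < N := by exact_mod_cast hN
  have small := h.berman_small hr hr2 hA3 (α := α) hα hε hε1 ha hC' (τ := c0 * (δ/2)) (by positivity)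
  have R1 := (R_tendsto (2/α)).eventually (gt_mem_nhds (show (0:ℝ) < min (1/(2*K)) 1 by positivity))
  have L1 := (tendsto_rpow_atTop (show 0 < 2/α by positivity)).eventually_ge_atTop (10*K/σ)
  filter_upwards [small, R1, L1, eventually_ge_atTop u0] with u hs hR hL hu
  intro n hn
  have hu2 : 2 ≤ u := by linarith
  have hup : 0 < u := by linarith
  have hΨ : 0 < Psi u := Psi_pos (by linarith)
  set L := u^(2/α) with hLd
  have hL0 : 0 < L := by positivity
  set R := L * Psi u with hRd
  have hR0 : 0 < R := by positivity
  set q := P.real {ω | ∃ s ∈ Icc (0:ℝ) 1, u < X s ω} with hq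
  have hq0 : 0 ≤ q := measureReal_nonneg
  have hqR : q ≤ K * R := Q1 u hu
  have hq2 : q ≤ 1/2 := by
    refine hqR.trans ?_
    have := (hR.trans_le (min_le_left _ _)).le
    calc K * R ≤ K * (1/(2*K)) := by gcongr
      _ = 1/2 := by field_simp
  set p := P.real {ω | ∀ s ∈ Icc (0:ℝ) 1, X s ω ≤ u} with hp
  have hpq : 1 - q ≤ p := by
    have : (univ : Set Ω) ⊆ {ω | ∀ s ∈ Icc (0:ℝ) 1, X s ω ≤ u} ∪ {ω | ∃ s ∈ Icc (0:ℝ) 1, u < X s ω} := by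
      intro ω _
      by_cases h1 : ∃ s ∈ Icc (0:ℝ) 1, u < X s ω
      · right; exact h1
      · left; push Not at h1; exact h1
    have := (measureReal_mono (μ := P) this).trans (measureReal_union_le _ _)
    rw [probReal_univ] at this
    linarith
  set b := a * u^(-(2/α)) with hb
  have hb0 : 0 < b := by positivity
  have hbL : b * L = a := by rw [hb, hLd, Real.rpow_neg hup.le]; field_simp
  set G := ⌊(1-ε)/(N*b)⌋₊ * N with hG
  have hGb : (G:ℝ) * b ≤ 1 - ε := by
    have : (⌊(1-ε)/(N*b)⌋₊:ℝ) * (N*b) ≤ 1 - ε := by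
      rw [← le_div_iff₀ (by positivity)]; exact Nat.floor_le (div_nonneg (by linarith) (by positivity))
    rw [hG]; push_cast; linarith
  have hGi : ∀ i < G, (i:ℝ) * b ≤ 1 - ε := by
    intro i hi
    have : (i:ℝ) ≤ G := by exact_mod_cast hi.le
    refine le_trans ?_ hGb
    gcongr
  have hGL : (G:ℝ) ≤ L/a := by
    rw [le_div_iff₀ ha, ← hbL]
    have : (G:ℝ) * b * L ≤ 1 * L := by gcongr; linarith
    linarith
  set hh := a^(α/4)/u with hhd
  have hh0 : 0 < hh := by positivity
  have B := hs n G hn hGL b hb0 hGi hh hh0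
  have sub : {ω | ∀ s ∈ Icc (0:ℝ) n, X s ω ≤ u} ⊆ {ω | ∀ k < n, ∀ i < G, X (k + i * b) ω ≤ u} := by
    intro ω hω k hk i hi
    apply hω
    have : (k:ℝ) + 1 ≤ n := by exact_mod_cast hk
    exact ⟨by positivity, by linarith [hGi i hi]⟩
  have B' := (measureReal_mono (μ := P) sub).trans B
  set q' := P.real {ω | ∃ i : ℕ, i < G ∧ u + hh < X (i * b) ω} with hq'
  have comp : P.real {ω | ∀ i < G, X (i * b) ω ≤ u + hh} = 1 - q' := by
    have ms : MeasurableSet {ω | ∃ i : ℕ, i < G ∧ u + hh < X (i * b) ω} := by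
      rw [show {ω | ∃ i : ℕ, i < G ∧ u + hh < X (i * b) ω} = ⋃ i : ℕ, ⋃ (_ : i < G), {ω | u + hh < X (i*b) ω} by ext; simp]
      exact MeasurableSet.iUnion fun i => MeasurableSet.iUnion fun _ => measurableSet_lt measurable_const (hm _)
    rw [hq', ← probReal_compl_eq_one_sub ms]
    congr 1
    ext ω; simp
  rw [comp] at B'
  have hq'1 : q' ≤ 1 := measureReal_le_one
  have qd : q ≤ q' + σ * R := by
    refine (Q2 ε hε.le hε1.le N hN a ha haN hγ u hu).trans (add_le_add le_rfl ?_)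
    have e : K * Psi u * ((ε * L + 2) + a^2 * L + L/(N*a) * (a^(α/4) + (N*a)^3)) =
      (K * (ε + a^2 + 1/(N*a) * (a^(α/4) + (N*a)^3))) * R + (2*K) * Psi u := by rw [hRd]; ring
    rw [e]
    have : 2*K ≤ σ*(1/5) * L := by
      rw [div_le_iff₀ hσ] at hL; linarith
    have f1 : (2*K) * Psi u ≤ σ*(1/5)*L * Psi u := by gcongr
    have f2 : (K * (ε + a^2 + 1/(N*a) * (a^(α/4) + (N*a)^3))) * R ≤ σ * (4/5) * R := by gcongr
    have : σ*(1/5)*L * Psi u = σ*(1/5)*R := by rw [hRd]; ring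
    linarith
  have hnn : (0:ℝ) ≤ n := Nat.cast_nonneg n
  have s1 : (1 - q')^n ≤ (1-q)^n * (1 + δ/2) := by
    have k1 : 1 - q' ≤ (1-q) * Real.exp (2*σ*R) := by
      have : 1 + 2*σ*R ≤ Real.exp (2*σ*R) := by linarith [Real.add_one_le_exp (2*σ*R)]
      have h3 : (1-q) * (1+2*σ*R) ≤ (1-q) * Real.exp (2*σ*R) := by gcongr; linarith
      have h4 : 0 < σ*R := by positivity
      nlinarith
    calc (1 - q')^n ≤ ((1-q) * Real.exp (2*σ*R))^n := by gcongr
      _ = (1-q)^n * Real.exp (2*σ*(n*R)) := by rw [mul_pow, ← Real.exp_nat_mul]; congr 2; ring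
      _ ≤ (1-q)^n * Real.exp (2*σ*C') := by
          have : 0 ≤ (1-q)^n := pow_nonneg (by linarith) _
          gcongr
      _ ≤ _ := by
          have : 0 ≤ (1-q)^n := pow_nonneg (by linarith) _
          gcongr
  have s2 : c0 ≤ (1-q)^n := by
    calc c0 ≤ Real.exp (-(2*q))^n := by
          rw [hc0, ← Real.exp_nat_mul, Real.exp_le_exp]
          have : n * q ≤ K * C' := by
            calc n * q ≤ n * (K * R) := by gcongr
              _ = K * (n*R) := by ring
              _ ≤ _ := by gcongr
          linarith
      _ ≤ _ := by gcongr; exact exp_lower hq0 hq2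
  have s3 : c0 * (δ/2) ≤ (1-q)^n * (δ/2) := by gcongr
  calc _ ≤ (1-q')^n + c0*(δ/2) := B'
    _ ≤ (1-q)^n * (1+δ) := by linarith
    _ ≤ p^n * (1+δ) := by gcongr; linarith
end Asm
end UB

open MeasureTheory ProbabilityTheory Filter Set Topology
set_option linter.unusedSectionVars false
set_option linter.deprecated false
set_option linter.unusedSimpArgs false

namespace UB

lemma exists_e {I : Set ℝ} {L R : ℝ → ℝ → ℝ}
    (H : ∀ δ > 0, ∀ᶠ u in atTop, ∀ x ∈ I, L u x ≤ R u x * (1 + δ)) :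
    ∃ e : ℝ → ℝ, Tendsto e atTop (𝓝 0) ∧ ∀ᶠ u : ℝ in atTop, ∀ x ∈ I, L u x ≤ R u x * (1 + e u) := by
  set S : ℝ → Set ℝ := fun u => {δ | 0 ≤ δ ∧ ∀ x ∈ I, L u x ≤ R u x * (1 + δ)} with hS
  have hb : ∀ u, BddBelow (S u) := fun u => ⟨0, fun δ h => h.1⟩
  have hcl : ∀ u, IsClosed (S u) := by
    intro u
    have : S u = Ici 0 ∩ ⋂ x ∈ I, {δ | L u x ≤ R u x * (1 + δ)} := by
      ext δ; simp [hS]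
    rw [this]
    exact isClosed_Ici.inter (isClosed_biInter fun x _ => isClosed_le (by fun_prop) (by fun_prop))
  refine ⟨fun u => sInf (S u), ?_, ?_⟩
  · rw [Metric.tendsto_nhds]
    intro ε hε
    filter_upwards [H (ε/2) (by positivity)] with u hu
    have h0 : 0 ≤ sInf (S u) := Real.sInf_nonneg fun δ h => h.1
    have h1 : sInf (S u) ≤ ε/2 := csInf_le (hb u) ⟨by positivity, hu⟩
    rw [Real.dist_eq, sub_zero, abs_of_nonneg h0]; linarith
  · filter_upwards [H 1 one_pos] with u hu
    exact ((hcl u).csInf_mem ⟨1, by norm_num, hu⟩ (hb u)).2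

variable {Ω : Type*} [MeasurableSpace Ω]

lemma A1_facts {r : ℝ → ℝ} {C α : ℝ} (hα : 0 < α) (hC : 0 < C)
    (hA1 : (fun t => r t - (1 - C * |t| ^ α)) =o[𝓝[>] (0:ℝ)] fun t => |t| ^ α) :
    Tendsto r (𝓝[>] 0) (𝓝 1) ∧ ∃ t0 > 0, ∀ t, 0 < t → t ≤ t0 → 1 - r t ≤ (2*C) * t^α := by
  have ht : Tendsto (fun t : ℝ => |t|^α) (𝓝[>] 0) (𝓝 0) := by
    have : Tendsto (fun t : ℝ => |t|^α) (𝓝 0) (𝓝 (|(0:ℝ)|^α)) :=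
      (continuous_abs.rpow_const (fun _ => Or.inr hα.le)).tendsto 0
    rw [abs_zero, Real.zero_rpow hα.ne'] at this
    exact this.mono_left nhdsWithin_le_nhds
  constructor
  · have h1 := hA1.trans_tendsto ht
    have h2 := h1.add ((tendsto_const_nhds (x := (1:ℝ))).sub (ht.const_mul C))
    simpa using h2
  · have hb := hA1.bound hC
    obtain ⟨t1, ht1, hb⟩ := mem_nhdsGT_iff_exists_Ioo_subset.1 hb
    have ht1' : (0:ℝ) < t1 := ht1
    refine ⟨t1/2, by positivity, fun t h0 h1 => ?_⟩
    have := hb (show t ∈ Ioo 0 t1 from ⟨h0, by linarith⟩)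
    simp only [mem_setOf_eq, Real.norm_eq_abs, abs_of_pos h0] at this
    rw [abs_of_nonneg (Real.rpow_nonneg h0.le α)] at this
    have := (abs_le.1 this).1
    linarith

end UB

theorem uniform_upper_bound_sup_le
    {Ω : Type*} [MeasurableSpace Ω] (P : Measure Ω) [IsProbabilityMeasure P]
    (X : ℝ → Ω → ℝ) (r : ℝ → ℝ) (C α : ℝ)
    (hα : 0 < α) (hα2 : α ≤ 2) (hC : 0 < C)
    -- centered stationary Gaussian process with covariance function r
    (hGauss : ∀ (n : ℕ) (c : Fin n → ℝ) (t : Fin n → ℝ), (∀ i, 0 ≤ t i) →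
      Measure.map (fun ω => ∑ i, c i * X (t i) ω) P
        = gaussianReal 0 (Real.toNNReal (∑ i, ∑ j, c i * c j * r (|t i - t j|))))
    -- a.s. continuous sample paths
    (hcont : ∀ᵐ ω ∂P, ContinuousOn (fun t => X t ω) (Ici 0))
    -- (A1)
    (hA1 : (fun t => r t - (1 - C * |t| ^ α)) =o[𝓝[>] (0:ℝ)] fun t => |t| ^ α)
    -- (A2)
    (hA2 : ∀ t : ℝ, 0 < t → r t < 1)
    -- (A3)
    (hA3 : Tendsto (fun t => r t * Real.log t) atTop (𝓝 0))
    -- Pickands constant, defined via a standard fractional Brownian motion `B`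
    -- with Hurst parameter `α/2`
    {Ω' : Type*} [MeasurableSpace Ω'] (P' : Measure Ω') [IsProbabilityMeasure P']
    (B : ℝ → Ω' → ℝ)
    (hB : ∀ (n : ℕ) (c : Fin n → ℝ) (t : Fin n → ℝ), (∀ i, 0 ≤ t i) →
      Measure.map (fun ω => ∑ i, c i * B (t i) ω) P'
        = gaussianReal 0 (Real.toNNReal (∑ i, ∑ j,
            c i * c j * ((t i ^ α + t j ^ α - |t i - t j| ^ α) / 2))))
    (HS : ℝ → ℝ)
    (hHS : ∀ S : ℝ, HS S
      = ∫ ω, Real.exp (sSup ((fun t => Real.sqrt 2 * B t ω - t ^ α) '' Icc 0 S)) ∂P')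
    (Hα : ℝ) (hHα : Tendsto (fun S => HS S / S) atTop (𝓝 Hα))
    -- the function m(u) = [C^{1/α} H_α u^{2/α} Ψ(u)]⁻¹
    (m : ℝ → ℝ)
    (hm : ∀ u : ℝ, m u
      = (C ^ (1/α) * Hα * u ^ (2/α) * ((gaussianReal 0 1) (Ioi u)).toReal)⁻¹)
    (A₀ Ainf : ℝ) (hA₀ : 0 < A₀) (hAA : A₀ < Ainf)
    :
    ∃ e : ℝ → ℝ, Tendsto e atTop (𝓝 0) ∧
      ∀ᶠ u : ℝ in atTop, ∀ x ∈ Icc A₀ Ainf,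
        (P {ω | sSup ((fun s => X s ω) '' Icc 0 (x * m u)) ≤ u}).toReal
          ≤ ((P {ω | sSup ((fun s => X s ω) '' Icc 0 (1:ℝ)) ≤ u}).toReal) ^ (⌊x * m u⌋₊)
            * (1 + e u) := by
  by_cases hH : Hα = 0
  · refine ⟨fun _ => 0, tendsto_const_nhds, Eventually.of_forall fun u x _ => ?_⟩
    have : m u = 0 := by rw [hm, hH]; simp
    rw [this]
    simp only [mul_zero, Nat.floor_zero, pow_zero, add_zero, mul_one]
    exact measureReal_le_one
  have hH0 : 0 ≤ Hα := by
    refine ge_of_tendsto hHα ?_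
    filter_upwards [eventually_gt_atTop 0] with S hS
    rw [hHS]
    exact div_nonneg (integral_nonneg fun _ => (Real.exp_pos _).le) hS.le
  have hHp : 0 < Hα := lt_of_le_of_ne hH0 (Ne.symm hH)
  obtain ⟨hr, t0, ht0, hD⟩ := UB.A1_facts hα hC hA1
  have hae : ∀ t, 0 ≤ t → AEMeasurable (X t) P := by
    intro t ht
    have h := hGauss 1 (fun _ => 1) (fun _ => t) (fun _ => ht)
    simp only [Finset.univ_unique, Finset.sum_singleton, one_mul] at h
    by_contra hn
    rw [show (fun ω => X t ω) = X t from rfl, Measure.map_of_not_aemeasurable hn] at h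
    have := congrArg (fun μ => μ univ) h
    simp at this
  obtain ⟨X', hm', hc', he⟩ := UB.modification hae hcont
  have hG' : ∀ (n : ℕ) (c : Fin n → ℝ) (t : Fin n → ℝ), (∀ i, 0 ≤ t i) →
      Measure.map (fun ω => ∑ i, c i * X' (t i) ω) P
        = gaussianReal 0 (Real.toNNReal (∑ i, ∑ j, c i * c j * r (|t i - t j|))) := by
    intro n c t ht
    rw [← hGauss n c t ht]
    refine Measure.map_congr ?_
    filter_upwards [he] with ω hω
    exact Finset.sum_congr rfl fun i _ => by rw [hω _ (ht i)]
  have hSG := UB.SG.mk' hm' hc' hG' hr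
  have hK : 0 < C ^ (1/α) * Hα := mul_pos (Real.rpow_pos_of_pos hC _) hHp
  refine UB.exists_e (I := Icc A₀ Ainf)
    (L := fun u x => (P {ω | sSup ((fun s => X s ω) '' Icc 0 (x * m u)) ≤ u}).toReal)
    (R := fun u x => ((P {ω | sSup ((fun s => X s ω) '' Icc 0 (1:ℝ)) ≤ u}).toReal) ^ (⌊x * m u⌋₊))
    fun δ hδ => ?_
  have hC' : 0 < Ainf / (C ^ (1/α) * Hα) := div_pos (hA₀.trans hAA) hK
  filter_upwards [UB.main_SG hSG hα (by positivity : 0 < 2*C) ht0 hD hr hA2 hA3 hC' hδ,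
    eventually_ge_atTop 1] with u hu hu1 x hx
  have hPsi : 0 < UB.Psi u := UB.Psi_pos hu1
  have hx0 : 0 < x := hA₀.trans_le hx.1
  set R := u^(2/α) * UB.Psi u with hR
  have hRp : 0 < R := mul_pos (Real.rpow_pos_of_pos (by linarith) _) hPsi
  have hmu : m u = (C ^ (1/α) * Hα * R)⁻¹ := by
    rw [hm u, hR, ← mul_assoc]; rfl
  have hmp : 0 < m u := by rw [hmu]; positivity
  have hn : (⌊x * m u⌋₊ : ℝ) ≤ x * m u := Nat.floor_le (by positivity)
  have hnR : ⌊x * m u⌋₊ * R ≤ Ainf / (C ^ (1/α) * Hα) := by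
    calc ⌊x * m u⌋₊ * R ≤ x * m u * R := by gcongr
      _ = x / (C ^ (1/α) * Hα) := by rw [hmu]; field_simp
      _ ≤ _ := by gcongr; exact hx.2
  have key := hu _ hnR
  have i1 : (P {ω | sSup ((fun s => X s ω) '' Icc 0 (x * m u)) ≤ u}).toReal ≤
      P.real {ω | ∀ s ∈ Icc (0:ℝ) ⌊x * m u⌋₊, X' s ω ≤ u} := by
    refine ENNReal.toReal_mono (measure_ne_top _ _) (measure_mono_ae ?_)
    filter_upwards [he, hcont] with ω hω hc hs s hs'
    rw [hω s hs'.1]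
    have hb : BddAbove ((fun s => X s ω) '' Icc 0 (x * m u)) :=
      (isCompact_Icc.image_of_continuousOn (hc.mono Icc_subset_Ici_self)).bddAbove
    exact (le_csSup hb ⟨s, ⟨hs'.1, hs'.2.trans hn⟩, rfl⟩).trans hs
  have i2 : P.real {ω | ∀ s ∈ Icc (0:ℝ) 1, X' s ω ≤ u} ≤
      (P {ω | sSup ((fun s => X s ω) '' Icc 0 (1:ℝ)) ≤ u}).toReal := by
    refine ENNReal.toReal_mono (measure_ne_top _ _) (measure_mono_ae ?_)
    filter_upwards [he] with ω hω hs
    refine csSup_le ((nonempty_Icc.2 zero_le_one).image _) ?_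
    rintro _ ⟨s, hs', rfl⟩
    have := hs s hs'
    rw [hω s hs'.1] at this
    exact this
  refine i1.trans (key.trans ?_)
  have : (0:ℝ) ≤ P.real {ω | ∀ s ∈ Icc (0:ℝ) 1, X' s ω ≤ u} := measureReal_nonneg
  gcongr
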